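/- Let X be a local dendrite and f : X → X a continuous map such that every point of X is recurrent for f. Then f is equicontinuous, i.e., the family of iterates {f^n : n ≥ 0} is equicontinuous. -/

import Mathlib

open Filter Topology TopologicalSpace Set
open scoped ENNReal NNReal

variable {X : Type*}

/-- A subset `D` is a dendrite: a nonempty compact connected, locally connected subspace
containing no subspace homeomorphic to the circle. -/
def IsDendriteSet [TopologicalSpace X] (D : Set X) : Prop :=
  IsCompact D ∧ IsConnected D ∧ LocallyConnectedSpace D ∧
    ¬ ∃ S : Set D, Nonempty (S ≃ₜ (Metric.sphere (0 : ℂ) 1))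

/-- A local dendrite: every point has a neighbourhood which is a dendrite. (The requirement
that `X` be a continuum is imposed via instance arguments.) -/
def IsLocalDendrite (X : Type*) [TopologicalSpace X] : Prop :=
  ∀ x : X, ∃ D : Set X, D ∈ nhds x ∧ IsDendriteSet D

/-- A recurrent point: there is a strictly increasing sequence of positive integers `n_k`
with `f^{n_k}(x) → x`. -/
def IsRecurrentPoint [TopologicalSpace X] (f : X → X) (x : X) : Prop :=
  ∃ u : ℕ → ℕ, StrictMono u ∧ (∀ k, 0 < u k) ∧
    Filter.Tendsto (fun k => f^[u k] x) Filter.atTop (nhds x)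

section PeanoPaths

variable {Y : Type*} [MetricSpace Y]

/-- `a` and `b` lie in a common preconnected set of diameter at most `ε`. -/
def PreconnClose (ε : ℝ) (a b : Y) : Prop :=
  ∃ C : Set Y, IsPreconnected C ∧ a ∈ C ∧ b ∈ C ∧ ∀ x ∈ C, ∀ y ∈ C, dist x y ≤ ε

theorem PreconnClose.refl {ε : ℝ} (hε : 0 ≤ ε) (a : Y) : PreconnClose ε a a :=
  ⟨{a}, isPreconnected_singleton, rfl, rfl, by rintro x rfl y rfl; simpa using hε⟩

theorem PreconnClose.dist_le {ε : ℝ} {a b : Y} (h : PreconnClose ε a b) : dist a b ≤ ε := by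
  obtain ⟨C, -, ha, hb, hd⟩ := h
  exact hd a ha b hb

theorem exists_uniform_chain [CompactSpace Y] [LocallyConnectedSpace Y] {δ : ℝ} (hδ : 0 < δ) :
    ∃ N : ℕ, 0 < N ∧ ∀ ε (a b : Y), PreconnClose ε a b → ∃ c : ℕ → Y, c 0 = a ∧
      (∀ i, N ≤ i → c i = b) ∧ (∀ i, PreconnClose δ (c i) (c (i + 1))) ∧
      ∀ i, dist a (c i) ≤ ε := by
  classical
  have h1 : ∀ x : Y, ∃ O : Set Y, IsOpen O ∧ x ∈ O ∧ IsPreconnected O ∧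
      ∀ y ∈ O, ∀ z ∈ O, dist y z ≤ δ := by
    intro x
    refine ⟨connectedComponentIn (Metric.ball x (δ / 2)) x,
      Metric.isOpen_ball.connectedComponentIn,
      mem_connectedComponentIn (Metric.mem_ball_self (by positivity)),
      isPreconnected_connectedComponentIn, ?_⟩
    intro y hy z hz
    have hy' := connectedComponentIn_subset _ _ hy
    have hz' := connectedComponentIn_subset _ _ hz
    rw [Metric.mem_ball] at hy' hz'
    linarith [dist_triangle_right y z x]
  choose O hO hxO hOc hOd using h1
  obtain ⟨t, ht⟩ := isCompact_univ.elim_finite_subcover O hO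
    (fun x _ => mem_iUnion.2 ⟨x, hxO x⟩)
  refine ⟨t.card + 1, by omega, ?_⟩
  rintro ε a b ⟨C, hC, ha, hb, hd⟩
  let G : SimpleGraph t := SimpleGraph.fromRel (fun i j => (C ∩ (O i ∩ O j)).Nonempty)
  have cov : ∀ x : Y, ∃ i : t, x ∈ O i := by
    intro x
    have := ht (mem_univ x)
    simp only [mem_iUnion] at this
    obtain ⟨i, hi, hx⟩ := this
    exact ⟨⟨i, hi⟩, hx⟩
  obtain ⟨i0, hi0⟩ := cov a
  obtain ⟨j0, hj0⟩ := cov b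
  have hreach : G.Reachable i0 j0 := by
    by_contra hn
    have := hC (⋃ i ∈ {i : t | G.Reachable i0 i}, O i) (⋃ i ∈ {i : t | ¬ G.Reachable i0 i}, O i)
      (isOpen_biUnion fun i _ => hO i) (isOpen_biUnion fun i _ => hO i)
      (by
        intro x _
        obtain ⟨i, hi⟩ := cov x
        by_cases h : G.Reachable i0 i
        · exact Or.inl (mem_biUnion (x := i) h hi)
        · exact Or.inr (mem_biUnion (x := i) h hi))
      ⟨a, ha, mem_biUnion (x := i0) (SimpleGraph.Reachable.refl i0) hi0⟩
      ⟨b, hb, mem_biUnion (x := j0) hn hj0⟩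
    obtain ⟨z, hzC, hz1, hz2⟩ := this
    simp only [mem_iUnion] at hz1 hz2
    obtain ⟨i, hi, hzi⟩ := hz1
    obtain ⟨j, hj, hzj⟩ := hz2
    have hij : i ≠ j := by rintro rfl; exact hj hi
    have hadj : G.Adj i j := by
      rw [SimpleGraph.fromRel_adj]
      exact ⟨hij, Or.inl ⟨z, hzC, hzi, hzj⟩⟩
    exact hj (SimpleGraph.Reachable.trans hi hadj.reachable)
  obtain ⟨p, hp⟩ := hreach.exists_isPath
  have hlen : p.length < t.card := by simpa using hp.length_lt
  have hz : ∀ i, ∃ z, z ∈ C ∧ z ∈ O (p.getVert i) ∧ z ∈ O (p.getVert (i + 1)) ∧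
      (p.length ≤ i → z = b) := by
    intro i
    by_cases hi : i < p.length
    · have := p.adj_getVert_succ hi
      rw [SimpleGraph.fromRel_adj] at this
      rcases this.2 with ⟨z, hz1, hz2, hz3⟩ | ⟨z, hz1, hz2, hz3⟩
      · exact ⟨z, hz1, hz2, hz3, fun h => by omega⟩
      · exact ⟨z, hz1, hz3, hz2, fun h => by omega⟩
    · refine ⟨b, hb, ?_, ?_, fun _ => rfl⟩
      · rw [p.getVert_of_length_le (by omega)]; exact hj0
      · rw [p.getVert_of_length_le (by omega)]; exact hj0
  choose z hzC hz1 hz2 hz3 using hz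
  refine ⟨fun i => Nat.casesOn i a z, rfl, ?_, ?_, ?_⟩
  · intro i hi
    cases i with
    | zero => omega
    | succ k => exact hz3 k (by omega)
  · intro i
    cases i with
    | zero => exact ⟨O i0, hOc _, hi0, by simpa using hz1 0, hOd _⟩
    | succ k => exact ⟨O (p.getVert (k + 1)), hOc _, hz2 k, hz1 (k + 1), hOd _⟩
  · intro i
    cases i with
    | zero => exact hd a ha a ha
    | succ k => exact hd a ha _ (hzC k)

/-- A chain of `P` steps from `a` to `b` with consecutive points `ε`-close. -/
structure IsFineChain (ε : ℝ) (a b : Y) (P : ℕ) (γ : ℕ → Y) : Prop where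
  pos : 0 < P
  left : γ 0 = a
  right : ∀ m, P ≤ m → γ m = b
  close : ∀ m, PreconnClose ε (γ m) (γ (m + 1))

theorem IsFineChain.refine [CompactSpace Y] [LocallyConnectedSpace Y] {δ ε : ℝ} (hδ : 0 < δ)
    {a b : Y} {P : ℕ} {γ : ℕ → Y} (hε : 0 ≤ ε) (h : IsFineChain ε a b P γ) :
    ∃ (N : ℕ) (γ' : ℕ → Y), 0 < N ∧ IsFineChain δ a b (P * N) γ' ∧
      ∀ m, dist (γ (m / N)) (γ' m) ≤ ε := by
  obtain ⟨N, hN, hch⟩ := exists_uniform_chain (Y := Y) hδ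
  choose! c hc0 hcN hcc hcd using hch
  let γ' : ℕ → Y := fun m => if P ≤ m / N then b else c ε (γ (m / N)) (γ (m / N + 1)) (m % N)
  refine ⟨N, γ', hN, ⟨Nat.mul_pos h.pos hN, ?_, ?_, ?_⟩, ?_⟩
  · have := h.pos
    simp only [γ', Nat.zero_div, Nat.zero_mod]
    rw [if_neg (by omega), hc0 _ _ _ (h.close 0), h.left]
  · intro m hm
    simp only [γ']
    rw [if_pos ((Nat.le_div_iff_mul_le hN).2 hm)]
  · intro m
    simp only [γ']
    have hm := Nat.mod_lt m hN
    by_cases hr : m % N + 1 < N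
    · have e1 : (m + 1) / N = m / N := by
        rw [Nat.succ_div_of_not_dvd]
        intro hd
        have := Nat.mod_eq_zero_of_dvd hd
        rw [Nat.add_mod, Nat.mod_eq_of_lt (a := 1) (by omega), Nat.mod_eq_of_lt hr] at this
        omega
      have e2 : (m + 1) % N = m % N + 1 := by
        rw [Nat.add_mod, Nat.mod_eq_of_lt (a := 1) (by omega), Nat.mod_eq_of_lt hr]
      rw [e1, e2]
      split_ifs with hP
      · exact PreconnClose.refl hδ.le _
      · exact hcc _ _ _ (h.close _) _
    · have hr' : m % N + 1 = N := by omega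
      have hm1 : m + 1 = N * (m / N + 1) := by
        have := Nat.div_add_mod m N
        rw [mul_add, mul_one]; omega
      have e1 : (m + 1) / N = m / N + 1 := by
        rw [hm1, Nat.mul_div_cancel_left _ hN]
      have e2 : (m + 1) % N = 0 := by rw [hm1, Nat.mul_mod_right]
      rw [e1, e2]
      by_cases hP : P ≤ m / N
      · rw [if_pos hP, if_pos (by omega)]
        exact PreconnClose.refl hδ.le _
      · rw [if_neg hP]
        have h3 := hcc _ _ _ (h.close (m / N)) (m % N)
        rw [hr', hcN _ _ _ (h.close (m / N)) N le_rfl] at h3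
        split_ifs with hP'
        · rwa [← h.right _ hP']
        · rwa [hc0 _ _ _ (h.close _)]
  · intro m
    simp only [γ']
    split_ifs with hP
    · rw [h.right _ hP, dist_self]; exact hε
    · exact hcd _ _ _ (h.close _) _

theorem PreconnClose.exists_path [CompactSpace Y] [LocallyConnectedSpace Y] {r : ℝ} (hr : 0 < r)
    {a b : Y} (h : PreconnClose r a b) :
    ∃ γ : ℝ → Y, Continuous γ ∧ γ 0 = a ∧ γ 1 = b ∧ ∀ t, dist a (γ t) ≤ 5 * r := by
  classical
  let S : ℕ → Type _ := fun n => {p : ℕ × (ℕ → Y) // IsFineChain (r / 2 ^ n) a b p.1 p.2}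
  have hstart : IsFineChain (r / 2 ^ 0) a b 1 (fun m => if m = 0 then a else b) := by
    refine ⟨one_pos, by simp, fun m hm => by simp; omega, fun m => ?_⟩
    rw [pow_zero, div_one]
    by_cases hm : m = 0
    · subst hm; simpa using h
    · simp only [hm, if_false]; simpa using PreconnClose.refl hr.le b
  have hstep : ∀ n (p : S n), ∃ q : S (n + 1), ∃ N, 0 < N ∧ q.1.1 = p.1.1 * N ∧
      ∀ m, dist (p.1.2 (m / N)) (q.1.2 m) ≤ r / 2 ^ n := by
    rintro n ⟨p, hp⟩
    obtain ⟨N, γ', hN, h1, h2⟩ := hp.refine (δ := r / 2 ^ (n + 1)) (by positivity) (by positivity)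
    exact ⟨⟨(p.1 * N, γ'), h1⟩, N, hN, rfl, h2⟩
  choose nx N hN hnP hnd using hstep
  let s : ∀ n, S n := fun n => Nat.rec ⟨(1, _), hstart⟩ (fun n p => nx n p) n
  have hs : ∀ n, s (n + 1) = nx n (s n) := fun n => rfl
  let P : ℕ → ℕ := fun n => (s n).1.1
  let g : ℕ → ℕ → Y := fun n => (s n).1.2
  have hg : ∀ n, IsFineChain (r / 2 ^ n) a b (P n) (g n) := fun n => (s n).2
  have hd : ∀ n (t : ℝ), dist (g n ⌊t * P n⌋₊) (g (n + 1) ⌊t * P (n + 1)⌋₊) ≤ r / 2 ^ n := by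
    intro n t
    have hNn := hN n (s n)
    have e1 : P (n + 1) = P n * N n (s n) := hnP n (s n)
    have e2 : ⌊t * P (n + 1)⌋₊ / N n (s n) = ⌊t * P n⌋₊ := by
      rw [← Nat.floor_div_natCast, e1]
      congr 1
      push_cast
      field_simp
    have := hnd n (s n) ⌊t * P (n + 1)⌋₊
    rw [e2] at this
    exact this
  have hd' : ∀ (t : ℝ) n, dist (g n ⌊t * P n⌋₊) (g (n + 1) ⌊t * P (n + 1)⌋₊) ≤
      (2 * r) / 2 / 2 ^ n := by
    intro t n
    have := hd n t
    rwa [mul_div_cancel_left₀ _ (two_ne_zero)]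
  have hlim : ∀ t : ℝ, ∃ y, Tendsto (fun n => g n ⌊t * P n⌋₊) atTop (𝓝 y) := fun t =>
    cauchySeq_tendsto_of_complete (cauchySeq_of_le_geometric_two (hd' t))
  choose γ hγ using hlim
  have hγd : ∀ (n : ℕ) (t : ℝ), dist (g n ⌊t * P n⌋₊) (γ t) ≤ 2 * r / 2 ^ n := fun n t =>
    dist_le_of_le_geometric_two_of_tendsto (hd' t) (hγ t) n
  have hPpos : ∀ n, 0 < P n := fun n => (hg n).pos
  refine ⟨γ, ?_, ?_, ?_, ?_⟩
  · rw [Metric.continuous_iff]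
    intro t ε hε
    obtain ⟨n, hn⟩ : ∃ n : ℕ, 5 * r / 2 ^ n < ε := by
      obtain ⟨n, hn⟩ := exists_pow_lt_of_lt_one (show 0 < ε / (5 * r) by positivity)
        (show (1 / 2 : ℝ) < 1 by norm_num)
      refine ⟨n, ?_⟩
      rw [lt_div_iff₀ (by positivity), one_div, inv_pow] at hn
      rw [div_eq_mul_inv]; linarith
    have hPn : (0 : ℝ) < P n := by exact_mod_cast hPpos n
    refine ⟨1 / P n, by positivity, fun t' ht' => ?_⟩
    have hfl : dist (g n ⌊t' * P n⌋₊) (g n ⌊t * P n⌋₊) ≤ r / 2 ^ n := by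
      have hlt : |t' * P n - t * P n| < 1 := by
        rw [← sub_mul, abs_mul, abs_of_pos hPn]
        rw [Real.dist_eq, lt_div_iff₀ hPn] at ht'
        exact ht'
      rw [abs_lt] at hlt
      have h1 : ⌊t' * P n⌋₊ ≤ ⌊t * P n⌋₊ + 1 := by
        rw [← Nat.lt_succ_iff]
        rcases le_or_gt 0 (t' * P n) with h0 | h0
        · rw [Nat.floor_lt h0]
          have := Nat.lt_floor_add_one (t * P n)
          push_cast; linarith
        · rw [Nat.floor_of_nonpos h0.le]; omega
      have h2 : ⌊t * P n⌋₊ ≤ ⌊t' * P n⌋₊ + 1 := by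
        rw [← Nat.lt_succ_iff]
        rcases le_or_gt 0 (t * P n) with h0 | h0
        · rw [Nat.floor_lt h0]
          have := Nat.lt_floor_add_one (t' * P n)
          push_cast; linarith
        · rw [Nat.floor_of_nonpos h0.le]; omega
      have h3 : ⌊t' * P n⌋₊ = ⌊t * P n⌋₊ ∨ ⌊t' * P n⌋₊ = ⌊t * P n⌋₊ + 1 ∨
        ⌊t * P n⌋₊ = ⌊t' * P n⌋₊ + 1 := by omega
      rcases h3 with h3 | h3 | h3
      · rw [h3, dist_self]; positivity
      · rw [h3, dist_comm]; exact ((hg n).close _).dist_le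
      · rw [h3]; exact ((hg n).close _).dist_le
    have h1 := hγd n t
    have h2 := hγd n t'
    rw [dist_comm] at h2
    have h3 := dist_triangle4 (γ t') (g n ⌊t' * P n⌋₊) (g n ⌊t * P n⌋₊) (γ t)
    calc dist (γ t') (γ t) ≤ 2 * r / 2 ^ n + r / 2 ^ n + 2 * r / 2 ^ n := by linarith
      _ = 5 * r / 2 ^ n := by ring
      _ < ε := hn
  · refine tendsto_nhds_unique (hγ 0) ?_
    have : ∀ n, g n ⌊(0 : ℝ) * P n⌋₊ = a := fun n => by simp [(hg n).left]
    simp_rw [this]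
    exact tendsto_const_nhds
  · refine tendsto_nhds_unique (hγ 1) ?_
    have : ∀ n, g n ⌊(1 : ℝ) * P n⌋₊ = b := fun n => by simp [(hg n).right]
    simp_rw [this]
    exact tendsto_const_nhds
  · intro t
    have h1 := hγd 0 t
    have h2 : dist a (g 0 ⌊t * P 0⌋₊) ≤ r := by
      change dist a (if _ then a else b) ≤ r
      split_ifs
      · simpa using hr.le
      · exact h.dist_le
    have h3 := dist_triangle a (g 0 ⌊t * P 0⌋₊) (γ t)
    simp only [pow_zero, div_one] at h1
    linarith

theorem locallyPathConnectedSpace_of_compact_metric [CompactSpace Y] [LocallyConnectedSpace Y] :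
    LocallyPathConnectedSpace Y := by
  rw [locallyPathConnectedSpace_iff_pathComponentIn_mem_nhds]
  intro x u hu hx
  obtain ⟨ε, hε, hball⟩ := Metric.isOpen_iff.1 hu x hx
  have hop := (Metric.isOpen_ball (x := x) (ε := ε / 24)).connectedComponentIn (x := x)
  have hxm := mem_connectedComponentIn (Metric.mem_ball_self (x := x) (ε := ε / 24) (by positivity))
  refine mem_of_superset (hop.mem_nhds hxm) ?_
  intro y hy
  have hc : PreconnClose (ε / 12) x y := by
    refine ⟨_, isPreconnected_connectedComponentIn, hxm, hy, ?_⟩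
    intro y hy z hz
    have hy' := connectedComponentIn_subset _ _ hy
    have hz' := connectedComponentIn_subset _ _ hz
    rw [Metric.mem_ball] at hy' hz'
    linarith [dist_triangle_right y z x]
  obtain ⟨γ, hγ, h0, h1, hd⟩ := hc.exists_path (by positivity)
  refine JoinedIn.ofLine (f := γ) hγ.continuousOn h0 h1 ?_
  rintro _ ⟨t, -, rfl⟩
  apply hball
  rw [Metric.mem_ball, dist_comm]
  linarith [hd t]

end PeanoPaths

section ArcsFromPaths

variable {Y : Type*} [MetricSpace Y]

/-- Truncated size of the piece of the path `γ` between parameters `r` and `t`. -/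
noncomputable def pathSpread (γ : ℝ → Y) (r t : ℝ) : ℝ :=
  sSup ((fun p : ℝ => min 1 (dist (γ (r + p * max (t - r) 0)) (γ r))) '' Icc 0 1)

theorem pathSpread_bddAbove (γ : ℝ → Y) (r t : ℝ) :
    BddAbove ((fun p : ℝ => min 1 (dist (γ (r + p * max (t - r) 0)) (γ r))) '' Icc 0 1) :=
  ⟨1, by rintro _ ⟨p, -, rfl⟩; exact min_le_left _ _⟩

theorem le_pathSpread (γ : ℝ → Y) {r t u : ℝ} (hu : u ∈ Icc r t) :
    min 1 (dist (γ u) (γ r)) ≤ pathSpread γ r t := by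
  apply le_csSup (pathSpread_bddAbove γ r t)
  rcases eq_or_lt_of_le (hu.1.trans hu.2) with h | h
  · subst h
    obtain rfl : u = r := le_antisymm hu.2 hu.1
    exact ⟨0, by simp, by simp⟩
  · refine ⟨(u - r) / (t - r), ⟨div_nonneg (by linarith [hu.1]) (by linarith), ?_⟩, ?_⟩
    · rw [div_le_one (by linarith)]; linarith [hu.2]
    · have : t - r ≠ 0 := by linarith
      simp only
      rw [max_eq_left (by linarith), div_mul_cancel₀ _ this]
      simp

theorem pathSpread_le (γ : ℝ → Y) {r t c : ℝ} (hc : 0 ≤ c)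
    (h : ∀ u ∈ Icc r t, min 1 (dist (γ u) (γ r)) ≤ c) : pathSpread γ r t ≤ c := by
  apply csSup_le ((nonempty_Icc.2 zero_le_one).image _)
  rintro _ ⟨p, hp, rfl⟩
  simp only
  rcases le_total t r with htr | htr
  · rw [max_eq_right (by linarith)]
    simpa using hc
  · rw [max_eq_left (by linarith)]
    apply h
    constructor
    · nlinarith [hp.1]
    · nlinarith [hp.2]

theorem pathSpread_nonneg (γ : ℝ → Y) (r t : ℝ) : 0 ≤ pathSpread γ r t := by
  apply Real.sSup_nonneg
  rintro _ ⟨p, -, rfl⟩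
  positivity

theorem pathSpread_le_one (γ : ℝ → Y) (r t : ℝ) : pathSpread γ r t ≤ 1 :=
  pathSpread_le γ zero_le_one fun _ _ => min_le_left _ _

theorem pathSpread_mono (γ : ℝ → Y) (r : ℝ) : Monotone (pathSpread γ r) := fun _ _ hst =>
  pathSpread_le γ (pathSpread_nonneg _ _ _) fun _ hu => le_pathSpread γ ⟨hu.1, hu.2.trans hst⟩

theorem continuous_pathSpread {γ : ℝ → Y} (hγ : Continuous γ) (r : ℝ) :
    Continuous (pathSpread γ r) := by
  have := (isCompact_Icc (a := (0 : ℝ)) (b := 1)).continuous_sSup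
    (f := fun (t p : ℝ) => min 1 (dist (γ (r + p * max (t - r) 0)) (γ r)))
    (by simp only [Function.HasUncurry.uncurry, id]; fun_prop)
  exact this

theorem exists_monotone_separating {γ : ℝ → Y} (hγ : Continuous γ)
    (hconv : ∀ s t u, 0 ≤ s → s ≤ u → u ≤ t → t ≤ 1 → γ s = γ t → γ u = γ s) :
    ∃ φ : ℝ → ℝ, Continuous φ ∧ Monotone φ ∧
      ∀ s ∈ Icc (0 : ℝ) 1, ∀ t ∈ Icc (0 : ℝ) 1, φ s = φ t ↔ γ s = γ t := by
  let q := denseSeq ℝ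
  have hsum : ∀ t, Summable fun n => (1 / 2 : ℝ) ^ n * pathSpread γ (q n) t := fun t =>
    summable_geometric_two.of_nonneg_of_le
      (fun n => mul_nonneg (by positivity) (pathSpread_nonneg _ _ _))
      (fun n => mul_le_of_le_one_right (by positivity) (pathSpread_le_one _ _ _))
  have hmono : ∀ n, Monotone fun t => (1 / 2 : ℝ) ^ n * pathSpread γ (q n) t := fun n s t hst =>
    mul_le_mul_of_nonneg_left (pathSpread_mono γ _ hst) (by positivity)
  have key : ∀ s t, 0 ≤ s → s ≤ t → t ≤ 1 →
      (∑' n, (1 / 2 : ℝ) ^ n * pathSpread γ (q n) s = ∑' n, (1 / 2 : ℝ) ^ n * pathSpread γ (q n) t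
        ↔ γ s = γ t) := by
    intro s t hs hst ht
    constructor
    · intro h
      by_contra hne
      have hlt : s < t := lt_of_le_of_ne hst (by rintro rfl; exact hne rfl)
      have hnb : {u | γ u ≠ γ t} ∈ 𝓝 s := (isOpen_ne.preimage hγ).mem_nhds hne
      obtain ⟨δ, hδ, hball⟩ := Metric.mem_nhds_iff.1 hnb
      obtain ⟨n, hn1, hn2⟩ := (denseRange_denseSeq ℝ).exists_mem_open (isOpen_Ioo)
        (nonempty_Ioo.2 (show s < min t (s + δ) from lt_min hlt (by linarith)))
      rw [lt_min_iff] at hn2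
      have h1 : γ (q n) ≠ γ t := hball (by
        rw [Metric.mem_ball, Real.dist_eq, abs_lt]
        constructor <;> linarith)
      refine (Summable.tsum_lt_tsum (fun m => hmono m hst) (i := n) ?_ (hsum s) (hsum t)).ne h
      apply mul_lt_mul_of_pos_left _ (by positivity)
      have h2 : pathSpread γ (q n) s ≤ 0 := pathSpread_le γ le_rfl fun u hu => by
        have := hu.1.trans hu.2
        exact absurd this (not_le.2 hn1)
      have h3 := le_pathSpread γ (r := q n) (t := t) (u := t) ⟨hn2.1.le, le_rfl⟩
      have h4 : 0 < min 1 (dist (γ t) (γ (q n))) := lt_min one_pos (dist_pos.2 h1.symm)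
      linarith
    · intro h
      refine tsum_congr fun n => ?_
      congr 1
      refine le_antisymm (pathSpread_mono γ _ hst) ?_
      refine pathSpread_le γ (pathSpread_nonneg _ _ _) fun u hu => ?_
      rcases le_total u s with hus | hus
      · exact le_pathSpread γ ⟨hu.1, hus⟩
      · have e1 := hconv s t u hs hus hu.2 ht h
        rcases le_total (q n) s with hqs | hqs
        · rw [e1]; exact le_pathSpread γ ⟨hqs, le_rfl⟩
        · have e2 := hconv s t (q n) hs hqs (hu.1.trans hu.2) ht h
          rw [e1, e2, dist_self]
          simpa using pathSpread_nonneg _ _ _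
  refine ⟨fun t => ∑' n, (1 / 2 : ℝ) ^ n * pathSpread γ (q n) t, ?_, ?_, ?_⟩
  · refine continuous_tsum (fun n => continuous_const.mul (continuous_pathSpread hγ _))
      summable_geometric_two fun n t => ?_
    rw [Real.norm_of_nonneg (mul_nonneg (by positivity) (pathSpread_nonneg _ _ _))]
    exact mul_le_of_le_one_right (by positivity) (pathSpread_le_one _ _ _)
  · exact fun s t hst => Summable.tsum_le_tsum (fun n => hmono n hst) (hsum s) (hsum t)
  · intro s hs t ht
    rcases le_total s t with h | h
    · exact key s t hs.1 h ht.2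
    · rw [eq_comm, key t s ht.1 h hs.2, eq_comm]

theorem exists_arc_of_convex_fibers {γ : ℝ → Y} (hγ : Continuous γ)
    (hconv : ∀ s t u, 0 ≤ s → s ≤ u → u ≤ t → t ≤ 1 → γ s = γ t → γ u = γ s)
    (h01 : γ 0 ≠ γ 1) :
    ∃ α : ℝ → Y, Continuous α ∧ InjOn α (Icc 0 1) ∧ α 0 = γ 0 ∧ α 1 = γ 1 ∧
      α '' Icc 0 1 ⊆ γ '' Icc 0 1 := by
  obtain ⟨φ, hφ, hφm, hφi⟩ := exists_monotone_separating hγ hconv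
  have h0 : (0 : ℝ) ∈ Icc (0 : ℝ) 1 := by simp
  have h1 : (1 : ℝ) ∈ Icc (0 : ℝ) 1 := by simp
  have hlt : φ 0 < φ 1 := lt_of_le_of_ne (hφm zero_le_one) fun h => h01 ((hφi 0 h0 1 h1).1 h)
  have hpos : 0 < φ 1 - φ 0 := by linarith
  let ψ : Icc (0 : ℝ) 1 → Icc (0 : ℝ) 1 := fun t => ⟨(φ t - φ 0) / (φ 1 - φ 0),
    div_nonneg (by linarith [hφm t.2.1]) hpos.le, (div_le_one hpos).2 (by linarith [hφm t.2.2])⟩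
  have hψ : Continuous ψ := by
    apply Continuous.subtype_mk
    fun_prop
  have hψs : Function.Surjective ψ := by
    rintro ⟨y, hy⟩
    have : φ 0 + y * (φ 1 - φ 0) ∈ Icc (φ 0) (φ 1) := ⟨by nlinarith [hy.1], by nlinarith [hy.2]⟩
    obtain ⟨t, ht, hty⟩ := intermediate_value_Icc zero_le_one hφ.continuousOn this
    refine ⟨⟨t, ht⟩, Subtype.ext ?_⟩
    simp only [ψ]
    rw [hty]
    field_simp
    ring
  have hψe : ∀ s t, ψ s = ψ t ↔ γ s = γ t := by
    intro s t
    rw [← hφi s s.2 t t.2, Subtype.ext_iff]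
    simp only [ψ]
    rw [div_left_inj' hpos.ne']
    constructor <;> intro h <;> linarith
  choose σ hσ using hψs
  let a : Icc (0 : ℝ) 1 → Y := fun y => γ (σ y)
  have haψ : a ∘ ψ = fun t : Icc (0 : ℝ) 1 => γ t := by
    funext t
    exact (hψe _ _).1 (hσ (ψ t))
  have hq : IsQuotientMap ψ := IsQuotientMap.of_surjective_continuous (fun y => ⟨σ y, hσ y⟩) hψ
  have ha : Continuous a := by
    rw [hq.continuous_iff, haψ]
    fun_prop
  have hai : Function.Injective a := fun x y hxy => by
    have := (hψe _ _).2 hxy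
    rwa [hσ, hσ] at this
  have e0 : ψ ⟨0, h0⟩ = ⟨0, h0⟩ := Subtype.ext (by simp [ψ])
  have e1 : ψ ⟨1, h1⟩ = ⟨1, h1⟩ := Subtype.ext (by simp [ψ, div_self hpos.ne'])
  refine ⟨IccExtend zero_le_one a, ha.Icc_extend', ?_, ?_, ?_, ?_⟩
  · intro s hs t ht hst
    rw [IccExtend_of_mem _ _ hs, IccExtend_of_mem _ _ ht] at hst
    simpa using hai hst
  · rw [IccExtend_of_mem _ _ h0, ← e0]
    exact congrFun haψ ⟨0, h0⟩
  · rw [IccExtend_of_mem _ _ h1, ← e1]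
    exact congrFun haψ ⟨1, h1⟩
  · rintro _ ⟨t, ht, rfl⟩
    rw [IccExtend_of_mem _ _ ht]
    exact ⟨_, (σ ⟨t, ht⟩).2, rfl⟩

end ArcsFromPaths

section ArcsFromPaths

variable {Y : Type*} [MetricSpace Y]

/-- The closed parameter sets containing both endpoints along which the path `γ` jumps only
between equal values. -/
def skeletons (γ : ℝ → Y) : Set (Set ℝ) :=
  {K | IsClosed K ∧ K ⊆ Icc 0 1 ∧ 0 ∈ K ∧ 1 ∈ K ∧
    ∀ s ∈ K, ∀ t ∈ K, s < t → Ioo s t ∩ K = ∅ → γ s = γ t}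

theorem sInter_mem_skeletons {γ : ℝ → Y} (hγ : Continuous γ) {c : Set (Set ℝ)}
    (hc : c ⊆ skeletons γ) (hch : IsChain (· ⊆ ·) c) (hne : c.Nonempty) :
    ⋂₀ c ∈ skeletons γ := by
  obtain ⟨K₀, hK₀⟩ := hne
  refine ⟨isClosed_sInter fun K hK => (hc hK).1, (sInter_subset_of_mem hK₀).trans (hc hK₀).2.1,
    fun K hK => (hc hK).2.2.1, fun K hK => (hc hK).2.2.2.1, ?_⟩
  intro s hs t ht hst hgap
  by_contra hne
  have hd : 0 < dist (γ s) (γ t) := dist_pos.2 hne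
  obtain ⟨δ₁, hδ₁, h₁⟩ := Metric.continuousAt_iff.1 (hγ.continuousAt (x := s)) _ (half_pos hd)
  obtain ⟨δ₂, hδ₂, h₂⟩ := Metric.continuousAt_iff.1 (hγ.continuousAt (x := t)) _ (half_pos hd)
  let ε := min (min δ₁ δ₂) (t - s) / 3
  have hm : 0 < min (min δ₁ δ₂) (t - s) := lt_min (lt_min hδ₁ hδ₂) (by linarith)
  have hε : 0 < ε := by positivity
  have hε1 : ε < δ₁ := by
    have : min (min δ₁ δ₂) (t - s) ≤ δ₁ := (min_le_left _ _).trans (min_le_left _ _)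
    simp only [ε]; linarith
  have hε2 : ε < δ₂ := by
    have : min (min δ₁ δ₂) (t - s) ≤ δ₂ := (min_le_left _ _).trans (min_le_right _ _)
    simp only [ε]; linarith
  have hε3 : 3 * ε ≤ t - s := by
    have : min (min δ₁ δ₂) (t - s) ≤ t - s := min_le_right _ _
    simp only [ε]; linarith
  obtain ⟨K, hK, hKe⟩ : ∃ K ∈ c, K ∩ Icc (s + ε) (t - ε) = ∅ := by
    by_contra hcon
    push Not at hcon
    have : (⋂₀ ((fun K => K ∩ Icc (s + ε) (t - ε)) '' c)).Nonempty := by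
      have : Nonempty ((fun K => K ∩ Icc (s + ε) (t - ε)) '' c) := ⟨_, mem_image_of_mem _ hK₀⟩
      apply IsCompact.nonempty_sInter_of_directed_nonempty_isCompact_isClosed
      · rintro _ ⟨A, hA, rfl⟩ _ ⟨B, hB, rfl⟩
        rcases hch.total hA hB with h | h
        · exact ⟨_, mem_image_of_mem _ hA, Subset.rfl, inter_subset_inter_left _ h⟩
        · exact ⟨_, mem_image_of_mem _ hB, inter_subset_inter_left _ h, Subset.rfl⟩
      · rintro _ ⟨A, hA, rfl⟩
        exact hcon A hA
      · rintro _ ⟨A, hA, rfl⟩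
        exact isCompact_Icc.inter_left (hc hA).1
      · rintro _ ⟨A, hA, rfl⟩
        exact (hc hA).1.inter isClosed_Icc
    obtain ⟨x, hx⟩ := this
    have hx1 := hx _ (mem_image_of_mem _ hK₀)
    have hx2 : x ∈ ⋂₀ c := fun A hA => (hx _ (mem_image_of_mem _ hA)).1
    have : x ∈ Ioo s t ∩ ⋂₀ c := ⟨⟨by linarith [hx1.2.1], by linarith [hx1.2.2]⟩, hx2⟩
    rw [hgap] at this
    exact this
  have hKc := (hc hK).1
  obtain ⟨s', hs', hs'2⟩ := ((isCompact_Icc (a := s) (b := s + ε)).inter_left hKc).exists_isGreatest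
    ⟨s, hs K hK, le_rfl, by linarith⟩
  obtain ⟨t', ht', ht'2⟩ := ((isCompact_Icc (a := t - ε) (b := t)).inter_left hKc).exists_isLeast
    ⟨t, ht K hK, by linarith, le_rfl⟩
  have heq : γ s' = γ t' := by
    refine (hc hK).2.2.2.2 s' hs'.1 t' ht'.1 (by linarith [hs'.2.2, ht'.2.1]) ?_
    rw [eq_empty_iff_forall_notMem]
    rintro x ⟨hx, hxK⟩
    rcases lt_or_ge x (s + ε) with h | h
    · have := hs'2 ⟨hxK, by linarith [hx.1, hs'.2.1], h.le⟩
      linarith [hx.1]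
    · rcases lt_or_ge (t - ε) x with h' | h'
      · have := ht'2 ⟨hxK, h'.le, by linarith [hx.2, ht'.2.2]⟩
        linarith [hx.2]
      · have : x ∈ K ∩ Icc (s + ε) (t - ε) := ⟨hxK, h, h'⟩
        rw [hKe] at this
        exact this
  have d1 := h₁ (x := s') (by
    rw [Real.dist_eq, abs_lt]; constructor <;> linarith [hs'.2.1, hs'.2.2])
  have d2 := h₂ (x := t') (by
    rw [Real.dist_eq, abs_lt]; constructor <;> linarith [ht'.2.1, ht'.2.2])
  rw [heq] at d1
  linarith [dist_triangle_left (γ s) (γ t) (γ t')]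

theorem exists_skeleton {γ : ℝ → Y} (hγ : Continuous γ) :
    ∃ K ∈ skeletons γ, ∀ s ∈ K, ∀ t ∈ K, s < t → γ s = γ t → Ioo s t ∩ K = ∅ := by
  obtain ⟨K, -, hK⟩ := zorn_superset_nonempty (skeletons γ)
    (fun c hc hch hne => ⟨_, sInter_mem_skeletons hγ hc hch hne, fun s hs => sInter_subset_of_mem hs⟩)
    (Icc 0 1) ⟨isClosed_Icc, Subset.rfl, by simp, by simp, fun s hs t ht hst h => by
      have : (s + t) / 2 ∈ Ioo s t ∩ Icc (0 : ℝ) 1 :=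
        ⟨⟨by linarith, by linarith⟩, ⟨by linarith [hs.1, ht.1], by linarith [hs.2, ht.2]⟩⟩
      rw [h] at this
      exact this.elim⟩
  refine ⟨K, hK.1, fun s hs t ht hst heq => ?_⟩
  obtain ⟨hcl, hsub, h0, h1, hgap⟩ := hK.1
  have : K \ Ioo s t ∈ skeletons γ := by
    refine ⟨hcl.sdiff isOpen_Ioo, sdiff_subset.trans hsub, ⟨h0, fun h => ?_⟩, ⟨h1, fun h => ?_⟩, ?_⟩
    · linarith [h.1, (hsub hs).1]
    · linarith [h.2, (hsub ht).2]
    · intro a ha b hb hab hemp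
      by_cases hk : Ioo a b ∩ K = ∅
      · exact hgap a ha.1 b hb.1 hab hk
      · obtain ⟨k, hk1, hk2⟩ := nonempty_iff_ne_empty.2 hk
        rw [eq_empty_iff_forall_notMem] at hemp
        have hk3 : k ∈ Ioo s t := by
          by_contra h
          exact hemp k ⟨hk1, hk2, h⟩
        have e1 : a = s := by
          have h1 : a ≤ s := by
            by_contra! h
            exact ha.2 ⟨h, hk1.1.trans hk3.2⟩
          by_contra hne
          exact hemp s ⟨⟨lt_of_le_of_ne h1 hne, hk3.1.trans hk1.2⟩, hs, fun h => lt_irrefl _ h.1⟩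
        have e2 : b = t := by
          have h1 : t ≤ b := by
            by_contra! h
            exact hb.2 ⟨hk3.1.trans hk1.2, h⟩
          by_contra hne
          exact hemp t ⟨⟨hk1.1.trans hk3.2, lt_of_le_of_ne h1 (Ne.symm hne)⟩, ht,
            fun h => lt_irrefl _ h.2⟩
        rw [e1, e2, heq]
  have hle := hK.2 this sdiff_subset
  rw [eq_empty_iff_forall_notMem]
  rintro x ⟨hx1, hx2⟩
  exact (hle hx2).2 hx1

/-- The endpoints of a path are joined by an arc inside the image of the path. -/
theorem exists_arc_of_path {γ : ℝ → Y} (hγ : Continuous γ) (h01 : γ 0 ≠ γ 1) :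
    ∃ α : ℝ → Y, Continuous α ∧ InjOn α (Icc 0 1) ∧ α 0 = γ 0 ∧ α 1 = γ 1 ∧
      α '' Icc 0 1 ⊆ γ '' Icc 0 1 := by
  obtain ⟨K, ⟨hcl, hsub, h0, h1, hgap⟩, hmin⟩ := exists_skeleton hγ
  have hK : IsCompact K := isCompact_Icc.of_isClosed_subset hcl hsub
  have hex : ∀ t : ℝ, ∃ p, 0 ≤ t → IsGreatest (K ∩ Iic t) p := by
    intro t
    by_cases ht : 0 ≤ t
    · obtain ⟨p, hp⟩ := (hK.inter_right isClosed_Iic).exists_isGreatest ⟨0, h0, ht⟩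
      exact ⟨p, fun _ => hp⟩
    · exact ⟨0, fun h => absurd h ht⟩
  choose π hπ using hex
  have hπK : ∀ t, 0 ≤ t → π t ∈ K := fun t ht => (hπ t ht).1.1
  have hπle : ∀ t, 0 ≤ t → π t ≤ t := fun t ht => (hπ t ht).1.2
  have hleπ : ∀ t, 0 ≤ t → ∀ k ∈ K, k ≤ t → k ≤ π t := fun t ht k hk hkt => (hπ t ht).2 ⟨hk, hkt⟩
  have hmono : ∀ s t, 0 ≤ s → s ≤ t → π s ≤ π t := fun s t hs hst =>
    hleπ t (hs.trans hst) _ (hπK s hs) ((hπle s hs).trans hst)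
  have hfix : ∀ t ∈ K, π t = t := fun t ht =>
    le_antisymm (hπle t (hsub ht).1) (hleπ t (hsub ht).1 t ht le_rfl)
  have hcont : ∀ t₀, 0 ≤ t₀ → ∀ ε > 0, ∃ δ > 0, ∀ t, 0 ≤ t → |t - t₀| < δ →
      dist (γ (π t)) (γ (π t₀)) < ε := by
    intro t₀ ht₀ ε hε
    by_cases htK : t₀ ∈ K
    · rw [hfix t₀ htK]
      obtain ⟨δ, hδ, hd⟩ := Metric.continuousAt_iff.1 (hγ.continuousAt (x := t₀)) _ hε
      have hright : ∀ t, t₀ ≤ t → |t - t₀| < δ → dist (γ (π t)) (γ t₀) < ε := by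
        intro t ht htd
        apply hd
        have h1 := hleπ t (ht₀.trans ht) t₀ htK ht
        have h2 := hπle t (ht₀.trans ht)
        rw [Real.dist_eq, abs_of_nonneg (by linarith)]
        rw [abs_of_nonneg (by linarith)] at htd
        linarith
      by_cases hk : ∃ k ∈ K, t₀ - δ < k ∧ k < t₀
      · obtain ⟨k, hkK, hk1, hk2⟩ := hk
        refine ⟨t₀ - k, by linarith, fun t ht htd => ?_⟩
        rcases le_total t₀ t with h | h
        · exact hright t h (by linarith)
        · rw [abs_lt] at htd
          have h1 := hleπ t ht k hkK (by linarith)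
          have h2 := hπle t ht
          apply hd
          rw [Real.dist_eq, abs_lt]
          constructor <;> linarith
      · refine ⟨δ, hδ, fun t ht htd => ?_⟩
        rcases le_or_gt t₀ t with h | h
        · exact hright t h htd
        · rw [hgap (π t) (hπK t ht) t₀ htK ((hπle t ht).trans_lt h), dist_self]
          · exact hε
          · rw [eq_empty_iff_forall_notMem]
            rintro k ⟨hk1, hk2⟩
            rw [abs_lt] at htd
            rcases le_or_gt k t with h' | h'
            · linarith [hleπ t ht k hk2 h', hk1.1]
            · exact hk ⟨k, hk2, by linarith, hk1.2⟩
    · obtain ⟨δ, hδ, hball⟩ := Metric.isOpen_iff.1 hcl.isOpen_compl t₀ htK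
      refine ⟨δ, hδ, fun t ht htd => ?_⟩
      have : π t = π t₀ := by
        have hno : ∀ k ∈ K, ¬ |k - t₀| < δ := fun k hk h => hball (by
          rw [Metric.mem_ball, Real.dist_eq]; exact h) hk
        rw [abs_lt] at htd
        apply le_antisymm
        · refine hleπ t₀ ht₀ _ (hπK t ht) ?_
          by_contra! h
          have := hπle t ht
          exact hno _ (hπK t ht) (by rw [abs_lt]; constructor <;> linarith)
        · refine hleπ t ht _ (hπK t₀ ht₀) ?_
          by_contra! h
          have := hπle t₀ ht₀
          exact hno _ (hπK t₀ ht₀) (by rw [abs_lt]; constructor <;> linarith)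
      rw [this, dist_self]
      exact hε
  let g : ℝ → Y := fun t => γ (π (max t 0))
  have hg : Continuous g := by
    rw [Metric.continuous_iff]
    intro t₀ ε hε
    obtain ⟨δ, hδ, h⟩ := hcont (max t₀ 0) (le_max_right _ _) ε hε
    refine ⟨δ, hδ, fun t ht => h _ (le_max_right _ _) ?_⟩
    exact (abs_max_sub_max_le_abs t t₀ 0).trans_lt ht
  have hg' : ∀ t, 0 ≤ t → g t = γ (π t) := fun t ht => by simp only [g]; rw [max_eq_left ht]
  have g0 : g 0 = γ 0 := by rw [hg' 0 le_rfl, hfix 0 h0]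
  have g1 : g 1 = γ 1 := by rw [hg' 1 zero_le_one, hfix 1 h1]
  obtain ⟨α, ha, hi, ha0, ha1, him⟩ := exists_arc_of_convex_fibers hg (by
    intro s t u hs hsu hut ht hst
    rw [hg' s hs, hg' t (by linarith)] at hst
    rw [hg' s hs, hg' u (by linarith)]
    rcases (hmono s u hs hsu).eq_or_lt with h | h
    · rw [h]
    rcases (hmono u t (by linarith) hut).eq_or_lt with h' | h'
    · rw [h', hst]
    have := hmin _ (hπK s hs) _ (hπK t (by linarith)) (h.trans h') hst
    rw [eq_empty_iff_forall_notMem] at this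
    exact (this _ ⟨⟨h, h'⟩, hπK u (by linarith)⟩).elim) (by rwa [g0, g1])
  refine ⟨α, ha, hi, ha0.trans g0, ha1.trans g1, him.trans ?_⟩
  rintro _ ⟨t, ht, rfl⟩
  rw [hg' t ht.1]
  exact mem_image_of_mem _ (hsub (hπK t ht.1))

end ArcsFromPaths

section ArcHulls

theorem exists_path_of_isOpen {Y : Type*} [TopologicalSpace Y] [LocallyPathConnectedSpace Y]
    {Q : Set Y} (hQ : IsOpen Q) (hQc : IsPreconnected Q) {u v : Y} (hu : u ∈ Q) (hv : v ∈ Q) :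
    ∃ γ : ℝ → Y, Continuous γ ∧ γ 0 = u ∧ γ 1 = v ∧ ∀ t, γ t ∈ Q := by
  obtain ⟨γ, hγ⟩ := (hQ.isConnected_iff_isPathConnected.1 ⟨⟨u, hu⟩, hQc⟩).joinedIn u hu v hv
  refine ⟨γ.extend, γ.extend.continuous, by simp, by simp, fun t => ?_⟩
  exact hγ (projIcc 0 1 zero_le_one t)

theorem exists_arc_of_isOpen {Y : Type*} [MetricSpace Y] [LocallyPathConnectedSpace Y]
    {Q : Set Y} (hQ : IsOpen Q) (hQc : IsPreconnected Q) {u v : Y} (hu : u ∈ Q) (hv : v ∈ Q)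
    (huv : u ≠ v) :
    ∃ α : ℝ → Y, Continuous α ∧ InjOn α (Icc 0 1) ∧ α 0 = u ∧ α 1 = v ∧
      ∀ t ∈ Icc (0 : ℝ) 1, α t ∈ Q := by
  obtain ⟨γ, hγ, h0, h1, hQ⟩ := exists_path_of_isOpen hQ hQc hu hv
  obtain ⟨α, ha, hi, ha0, ha1, him⟩ := exists_arc_of_path hγ (by rwa [h0, h1])
  refine ⟨α, ha, hi, ha0.trans h0, ha1.trans h1, fun t ht => ?_⟩
  obtain ⟨s, -, hs⟩ := him (mem_image_of_mem _ ht)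
  rw [← hs]; exact hQ s

variable {Y : Type*} [MetricSpace Y]

theorem exists_homeomorph_circle {L : ℝ → Y} (hL : Continuous L) (hi : InjOn L (Ico 0 2))
    (h02 : L 0 = L 2) : ∃ S : Set Y, Nonempty (S ≃ₜ Metric.sphere (0 : ℂ) 1) := by
  have : Fact ((0 : ℝ) < 2) := ⟨two_pos⟩
  let e : AddCircle (2 : ℝ) → Y := AddCircle.liftIco 2 0 L
  have he : Continuous e := AddCircle.liftIco_continuous (by simpa using h02) hL.continuousOn
  have hei : Function.Injective e := by
    intro x y hxy
    have hx : x ∈ ((↑) : ℝ → AddCircle (2 : ℝ)) '' Ico 0 (0 + 2) := by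
      rw [AddCircle.coe_image_Ico_eq]; trivial
    have hy : y ∈ ((↑) : ℝ → AddCircle (2 : ℝ)) '' Ico 0 (0 + 2) := by
      rw [AddCircle.coe_image_Ico_eq]; trivial
    obtain ⟨s, hs, rfl⟩ := hx
    obtain ⟨t, ht, rfl⟩ := hy
    simp only [e] at hxy
    rw [AddCircle.liftIco_coe_apply hs, AddCircle.liftIco_coe_apply ht] at hxy
    rw [zero_add] at hs ht
    rw [hi hs ht hxy]
  let c : Circle ≃ₜ Metric.sphere (0 : ℂ) 1 := Homeomorph.refl (Metric.sphere (0 : ℂ) 1)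
  exact ⟨range e, ⟨((he.isClosedEmbedding hei).toIsEmbedding.toHomeomorph.symm.trans
    (AddCircle.homeomorphCircle two_ne_zero)).trans c⟩⟩

/-- In a space without circles, a point of an arc belongs to every connected set containing two
points of the arc on both sides of it. -/
theorem mem_of_arc_of_no_circle [CompactSpace Y] [LocallyConnectedSpace Y]
    (hno : ¬ ∃ S : Set Y, Nonempty (S ≃ₜ Metric.sphere (0 : ℂ) 1)) {α : ℝ → Y}
    (hα : Continuous α) (hαi : InjOn α (Icc 0 1)) {s r t : ℝ} (hs : 0 ≤ s) (hsr : s ≤ r)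
    (hrt : r ≤ t) (ht : t ≤ 1) {C : Set Y} (hC : IsPreconnected C) (hsC : α s ∈ C)
    (htC : α t ∈ C) : α r ∈ C := by
  have := locallyPathConnectedSpace_of_compact_metric (Y := Y)
  by_contra hr
  have hsr' : s < r := lt_of_le_of_ne hsr (by rintro rfl; exact hr hsC)
  have hrt' : r < t := lt_of_le_of_ne hrt (by rintro rfl; exact hr htC)
  have hCsub : C ⊆ {α r}ᶜ := fun x hx h => hr (by rw [← mem_singleton_iff.1 h]; exact hx)
  obtain ⟨β, hβ, hβi, hβ0, hβ1, hβm⟩ := exists_arc_of_isOpen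
    (isOpen_compl_singleton.connectedComponentIn (x := α s)) isPreconnected_connectedComponentIn
    (mem_connectedComponentIn (hCsub hsC)) (hC.subset_connectedComponentIn hsC hCsub htC)
    (fun h => by
      have := hαi ⟨hs, by linarith⟩ ⟨by linarith, ht⟩ h
      linarith)
  have hβr : α r ∉ β '' Icc 0 1 := by
    rintro ⟨x, hx, hxr⟩
    exact connectedComponentIn_subset _ _ (hβm x hx) hxr
  have hB : IsClosed (α ⁻¹' (β '' Icc 0 1)) :=
    ((isCompact_Icc.image hβ).isClosed).preimage hα
  obtain ⟨s', hs', hs'2⟩ := ((isCompact_Icc (a := s) (b := r)).inter_right hB).exists_isGreatest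
    ⟨s, ⟨le_rfl, hsr⟩, ⟨0, by simp, hβ0⟩⟩
  obtain ⟨t', ht', ht'2⟩ := ((isCompact_Icc (a := r) (b := t)).inter_right hB).exists_isLeast
    ⟨t, ⟨hrt, le_rfl⟩, ⟨1, by simp, hβ1⟩⟩
  obtain ⟨hs'i, p, hp, hps⟩ := hs'
  obtain ⟨ht'i, q, hq, hqt⟩ := ht'
  have hs'r : s' < r := lt_of_le_of_ne hs'i.2 (by rintro rfl; exact hβr ⟨p, hp, hps⟩)
  have hrt'' : r < t' := lt_of_le_of_ne ht'i.1 (by rintro rfl; exact hβr ⟨q, hq, hqt⟩)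
  have hmid : ∀ x, s' < x → x < t' → α x ∉ β '' Icc 0 1 := by
    intro x hx1 hx2 hx
    rcases le_total x r with h | h
    · exact absurd (hs'2 ⟨⟨by linarith [hs'i.1], h⟩, hx⟩) (by linarith)
    · exact absurd (ht'2 ⟨⟨h, by linarith [ht'i.2]⟩, hx⟩) (by linarith)
  have hst' : s' ∈ Icc (0 : ℝ) 1 := ⟨by linarith [hs'i.1], by linarith⟩
  have htt' : t' ∈ Icc (0 : ℝ) 1 := ⟨by linarith, by linarith [ht'i.2]⟩
  have hpq : p ≠ q := by
    rintro rfl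
    have := hαi hst' htt' (hps.symm.trans hqt)
    linarith
  let A : ℝ → ℝ := fun x => s' + x * (t' - s')
  let B : ℝ → ℝ := fun x => q + (x - 1) * (p - q)
  have hA : ∀ x, 0 ≤ x → x ≤ 1 → A x ∈ Icc (0 : ℝ) 1 := fun x h0 h1 => by
    simp only [A]
    constructor <;> nlinarith [hst'.1, htt'.2]
  have hBm : ∀ x, 1 ≤ x → x ≤ 2 → B x ∈ Icc (0 : ℝ) 1 := fun x h0 h1 => by
    simp only [B]
    have e : q + (x - 1) * (p - q) = (2 - x) * q + (x - 1) * p := by ring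
    rw [e]
    constructor
    · have := hp.1; have := hq.1; have : 0 ≤ 2 - x := by linarith
      have : 0 ≤ x - 1 := by linarith
      positivity
    · nlinarith [hp.2, hq.2]
  have hAB : A 1 = t' ∧ B 1 = q ∧ A 0 = s' ∧ B 2 = p := by
    simp only [A, B]; refine ⟨?_, ?_, ?_, ?_⟩ <;> ring
  have hBi : ∀ x y, B x = B y → x = y := fun x y h => by
    simp only [B] at h
    have : (x - y) * (p - q) = 0 := by linarith
    rcases mul_eq_zero.1 this with h | h
    · linarith
    · exact absurd (by linarith) hpq
  have hAi : ∀ x y, A x = A y → x = y := fun x y h => by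
    simp only [A] at h
    have : (x - y) * (t' - s') = 0 := by linarith
    rcases mul_eq_zero.1 this with h | h <;> linarith
  let L : ℝ → Y := fun x => if x ≤ 1 then α (A x) else β (B x)
  have hL : Continuous L := by
    refine Continuous.if_le (by fun_prop) (by fun_prop) continuous_id continuous_const ?_
    rintro x rfl
    rw [hAB.1, hAB.2.1, hqt]
  refine hno (exists_homeomorph_circle hL ?_ ?_)
  · have cross : ∀ x y, 0 ≤ x → x ≤ 1 → 1 < y → y < 2 → α (A x) ≠ β (B y) := by
      intro x y hx0 hx1 hy1 hy2 h
      have hy := hBm y hy1.le hy2.le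
      rcases hx0.eq_or_lt with rfl | hx0
      · rw [hAB.2.2.1, ← hps] at h
        rw [← hAB.2.2.2] at h hp
        have := hBi _ _ (hβi hp hy h)
        linarith
      rcases hx1.eq_or_lt with rfl | hx1
      · rw [hAB.1, ← hqt] at h
        rw [← hAB.2.1] at h hq
        have := hBi _ _ (hβi hq hy h)
        linarith
      refine hmid (A x) ?_ ?_ ⟨_, hy, h.symm⟩
      · simp only [A]; nlinarith
      · simp only [A]; nlinarith
    intro x hx y hy hxy
    simp only [L] at hxy
    split_ifs at hxy with h1 h2 h2
    · exact hAi _ _ (hαi (hA x hx.1 h1) (hA y hy.1 h2) hxy)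
    · exact (cross x y hx.1 h1 (not_le.1 h2) hy.2 hxy).elim
    · exact (cross y x hy.1 h2 (not_le.1 h1) hx.2 hxy.symm).elim
    · exact hBi _ _ (hβi (hBm x (not_le.1 h1).le hx.2.le) (hBm y (not_le.1 h2).le hy.2.le) hxy)
  · simp only [L]
    rw [if_pos zero_le_one, if_neg (by norm_num), hAB.2.2.1, hAB.2.2.2, hps]

/-- A set in which any two points are joined by an arc each of whose subarcs is contained in every
connected subset containing its endpoints. -/
def UniquelyArcwise (D : Set Y) : Prop :=
  ∀ u ∈ D, ∀ v ∈ D, u ≠ v → ∃ α : ℝ → Y, Continuous α ∧ InjOn α (Icc 0 1) ∧ α 0 = u ∧ α 1 = v ∧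
    (∀ t ∈ Icc (0 : ℝ) 1, α t ∈ D) ∧ ∀ s r t, 0 ≤ s → s ≤ r → r ≤ t → t ≤ 1 → ∀ C ⊆ D,
      IsPreconnected C → α s ∈ C → α t ∈ C → α r ∈ C

theorem uniquelyArcwise_of_no_circle {D : Set Y} (hD : IsCompact D) (hDc : IsPreconnected D)
    (hDl : LocallyConnectedSpace D)
    (hno : ¬ ∃ S : Set D, Nonempty (S ≃ₜ Metric.sphere (0 : ℂ) 1)) : UniquelyArcwise D := by
  have := isCompact_iff_compactSpace.1 hD
  have := locallyPathConnectedSpace_of_compact_metric (Y := D)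
  have := Subtype.preconnectedSpace hDc
  intro u hu v hv huv
  obtain ⟨α, hα, hαi, h0, h1, -⟩ := exists_arc_of_isOpen (Y := D) isOpen_univ isPreconnected_univ
    (mem_univ ⟨u, hu⟩) (mem_univ ⟨v, hv⟩) (fun h => huv (congrArg Subtype.val h))
  refine ⟨fun t => α t, by fun_prop, fun s hs t ht h => hαi hs ht (Subtype.ext h),
    congrArg Subtype.val h0, congrArg Subtype.val h1, fun t _ => (α t).2, ?_⟩
  intro s r t hs hsr hrt ht C hCD hC hsC htC
  have hC' : IsPreconnected ((↑) ⁻¹' C : Set D) := by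
    rw [← Topology.IsInducing.subtypeVal.isPreconnected_image, Subtype.image_preimage_coe,
      inter_eq_right.2 hCD]
    exact hC
  exact mem_of_arc_of_no_circle hno hα hαi hs hsr hrt ht hC' hsC htC

end ArcHulls

section Components

variable {X : Type*} [TopologicalSpace X]

theorem IsPreconnected.subset_of_disjoint_frontier {C V : Set X} (hC : IsPreconnected C)
    (hV : IsOpen V) (hne : (C ∩ V).Nonempty) (hd : ∀ x ∈ C, x ∉ frontier V) : C ⊆ V := by
  refine hC.subset_left_of_subset_union hV (isClosed_closure (s := V)).isOpen_compl ?_ ?_ hne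
  · exact disjoint_compl_right_iff_subset.2 subset_closure
  · intro x hx
    by_cases h : x ∈ closure V
    · left
      by_contra hxV
      exact hd x hx (hV.frontier_eq ▸ ⟨h, hxV⟩)
    · exact Or.inr h

theorem frontier_connectedComponentIn_subset [LocallyConnectedSpace X] {U : Set X}
    (hU : IsOpen U) (x : X) : frontier (connectedComponentIn U x) ⊆ Uᶜ := by
  intro y hy hyU
  rw [hU.connectedComponentIn.frontier_eq] at hy
  obtain ⟨z, hz1, hz2⟩ := mem_closure_iff.1 hy.1 _ hU.connectedComponentIn
    (mem_connectedComponentIn hyU)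
  apply hy.2
  rw [connectedComponentIn_eq hz2, ← connectedComponentIn_eq hz1]
  exact mem_connectedComponentIn hyU

theorem exists_isPreconnected_nhds [LocallyConnectedSpace X] {O : Set X} {x : X}
    (hO : O ∈ 𝓝 x) : ∃ N, IsOpen N ∧ IsPreconnected N ∧ x ∈ N ∧ N ⊆ O := by
  refine ⟨connectedComponentIn (interior O) x, isOpen_interior.connectedComponentIn,
    isPreconnected_connectedComponentIn, mem_connectedComponentIn (mem_interior_iff_mem_nhds.2 hO),
    (connectedComponentIn_subset _ _).trans interior_subset⟩

/-- A path leaving an open set does so through the frontier. -/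
theorem exists_exit {γ : ℝ → X} (hγ : Continuous γ) {V : Set X} (hV : IsOpen V) (h0 : γ 0 ∈ V)
    {t : ℝ} (ht : 0 ≤ t) (h1 : γ t ∉ V) :
    ∃ T ∈ Icc 0 t, γ T ∈ frontier V ∧ ∀ s ∈ Icc 0 T, γ s ∈ closure V := by
  obtain ⟨T, hT, hT2⟩ := ((isCompact_Icc (a := 0) (b := t)).inter_right
    (hV.isClosed_compl.preimage hγ)).exists_isLeast ⟨t, ⟨ht, le_rfl⟩, h1⟩
  have hin : ∀ s, 0 ≤ s → s < T → γ s ∈ V := by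
    intro s hs hsT
    by_contra h
    exact absurd (hT2 ⟨⟨hs, hsT.le.trans hT.1.2⟩, h⟩) (by linarith)
  have hT0 : 0 < T := lt_of_le_of_ne hT.1.1 (by rintro rfl; exact hT.2 h0)
  have hcl : γ T ∈ closure V := by
    have : T ∈ closure (Ico 0 T) := by rw [closure_Ico hT0.ne]; exact ⟨hT0.le, le_rfl⟩
    have := mem_closure_image hγ.continuousAt this
    refine closure_mono ?_ this
    rintro _ ⟨s, hs, rfl⟩
    exact hin s hs.1 hs.2
  refine ⟨T, hT.1, hV.frontier_eq ▸ ⟨hcl, hT.2⟩, fun s hs => ?_⟩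
  rcases hs.2.eq_or_lt with rfl | h
  · exact hcl
  · exact subset_closure (hin s hs.1 h)

/-- The intersection of all connected subsets of `D` containing `u` and `v`. -/
def connHull (D : Set X) (u v : X) : Set X :=
  {c | c ∈ D ∧ ∀ C ⊆ D, IsPreconnected C → u ∈ C → v ∈ C → c ∈ C}

variable {D : Set X} {u v w x y z c : X}

theorem connHull_subset : connHull D u v ⊆ D := fun _ h => h.1

theorem connHull_subset_of {C : Set X} (hCD : C ⊆ D) (hC : IsPreconnected C) (hu : u ∈ C)
    (hv : v ∈ C) : connHull D u v ⊆ C := fun _ h => h.2 C hCD hC hu hv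

theorem connHull_comm : connHull D u v = connHull D v u := by
  ext c
  constructor <;> exact fun h => ⟨h.1, fun C h1 h2 h3 h4 => h.2 C h1 h2 h4 h3⟩

theorem left_mem_connHull (hu : u ∈ D) : u ∈ connHull D u v := ⟨hu, fun _ _ _ h _ => h⟩

theorem right_mem_connHull (hv : v ∈ D) : v ∈ connHull D u v := ⟨hv, fun _ _ _ _ h => h⟩

theorem connHull_trans (h1 : x ∈ connHull D u y) (h2 : y ∈ connHull D u z) :
    x ∈ connHull D u z :=
  ⟨h1.1, fun C hCD hC hu hz => h1.2 C hCD hC hu (h2.2 C hCD hC hu hz)⟩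

theorem connHull_self (hu : u ∈ D) : connHull D u u = {u} :=
  Subset.antisymm (connHull_subset_of (by simpa using hu) isPreconnected_singleton rfl rfl)
    (by simpa using left_mem_connHull hu)

theorem connHull_move {N : Set X} (hN : IsPreconnected N) (hND : N ⊆ D) (hv : v ∈ N) (hw : w ∈ N)
    (hcN : c ∉ N) (hc : c ∈ connHull D u v) : c ∈ connHull D u w := by
  refine ⟨hc.1, fun C hCD hC hu hwC => ?_⟩
  have := hc.2 (C ∪ N) (union_subset hCD hND) (hC.union w hwC hw hN) (Or.inl hu) (Or.inr hv)
  exact this.resolve_right hcN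

theorem connHull_move_left {N : Set X} (hN : IsPreconnected N) (hND : N ⊆ D) (hv : v ∈ N)
    (hw : w ∈ N) (hcN : c ∉ N) (hc : c ∈ connHull D v u) : c ∈ connHull D w u := by
  rw [connHull_comm] at hc ⊢
  exact connHull_move hN hND hv hw hcN hc

end Components

section ArcHulls

variable {X : Type*} [MetricSpace X] {D : Set X} {u v : X}

theorem UniquelyArcwise.exists_arc (hD : UniquelyArcwise D) (hu : u ∈ D) (hv : v ∈ D)
    (huv : u ≠ v) :
    ∃ α : ℝ → X, Continuous α ∧ InjOn α (Icc 0 1) ∧ α 0 = u ∧ α 1 = v ∧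
      ∀ s t, 0 ≤ s → s ≤ t → t ≤ 1 → connHull D (α s) (α t) = α '' Icc s t := by
  obtain ⟨α, hα, hαi, h0, h1, hαD, h⟩ := hD u hu v hv huv
  refine ⟨α, hα, hαi, h0, h1, fun s t hs hst ht => ?_⟩
  have hsub : α '' Icc s t ⊆ D := by
    rintro _ ⟨r, hr, rfl⟩
    exact hαD r ⟨hs.trans hr.1, hr.2.trans ht⟩
  apply Subset.antisymm
  · exact connHull_subset_of hsub (isPreconnected_Icc.image _ hα.continuousOn)
      (mem_image_of_mem _ ⟨le_rfl, hst⟩) (mem_image_of_mem _ ⟨hst, le_rfl⟩)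
  · rintro _ ⟨r, hr, rfl⟩
    exact ⟨hsub (mem_image_of_mem _ hr), fun C hCD hC hsC htC =>
      h s r t hs hr.1 hr.2 ht C hCD hC hsC htC⟩

theorem UniquelyArcwise.isPreconnected_connHull (hD : UniquelyArcwise D) (hu : u ∈ D)
    (hv : v ∈ D) : IsPreconnected (connHull D u v) := by
  by_cases huv : u = v
  · subst huv; rw [connHull_self hu]; exact isPreconnected_singleton
  · obtain ⟨α, hα, -, rfl, rfl, h⟩ := hD.exists_arc hu hv huv
    rw [h 0 1 le_rfl zero_le_one le_rfl]
    exact isPreconnected_Icc.image _ hα.continuousOn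

theorem UniquelyArcwise.isCompact_connHull (hD : UniquelyArcwise D) (hu : u ∈ D)
    (hv : v ∈ D) : IsCompact (connHull D u v) := by
  by_cases huv : u = v
  · subst huv; rw [connHull_self hu]; exact isCompact_singleton
  · obtain ⟨α, hα, -, rfl, rfl, h⟩ := hD.exists_arc hu hv huv
    rw [h 0 1 le_rfl zero_le_one le_rfl]
    exact isCompact_Icc.image hα

theorem UniquelyArcwise.exists_mem_ne (hD : UniquelyArcwise D) (hu : u ∈ D) (hv : v ∈ D)
    (huv : u ≠ v) {S : Set X} (hS : ∀ u ∈ D, ∀ v ∈ D, u ≠ v → (connHull D u v ∩ S).Nonempty) :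
    ∃ c ∈ connHull D u v, c ∈ S ∧ c ≠ u ∧ c ≠ v := by
  obtain ⟨α, hα, hαi, rfl, rfl, h⟩ := hD.exists_arc hu hv huv
  have h01 := h 0 1 le_rfl zero_le_one le_rfl
  have hm : ∀ t ∈ Icc (0 : ℝ) 1, α t ∈ connHull D (α 0) (α 1) := fun t ht => by
    rw [h01]; exact mem_image_of_mem _ ht
  have hD' : ∀ t ∈ Icc (0 : ℝ) 1, α t ∈ D := fun t ht => connHull_subset (hm t ht)
  have m1 : (1 / 3 : ℝ) ∈ Icc (0 : ℝ) 1 := by constructor <;> norm_num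
  have m2 : (2 / 3 : ℝ) ∈ Icc (0 : ℝ) 1 := by constructor <;> norm_num
  obtain ⟨c, hc, hcS⟩ := hS _ (hD' _ m1) _ (hD' _ m2) (fun h => by
    have := hαi m1 m2 h
    norm_num at this)
  rw [h _ _ m1.1 (by norm_num) m2.2] at hc
  obtain ⟨t, ht, rfl⟩ := hc
  have ht' : t ∈ Icc (0 : ℝ) 1 := ⟨by linarith [ht.1], by linarith [ht.2]⟩
  refine ⟨α t, hm t ht', hcS, fun h => ?_, fun h => ?_⟩
  · have := hαi ht' (by simp) h
    linarith [ht.1]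
  · have := hαi ht' (by simp) h
    linarith [ht.2]

theorem UniquelyArcwise.exists_between (hD : UniquelyArcwise D) (hu : u ∈ D) (hv : v ∈ D)
    (huv : u ≠ v) : ∃ c ∈ connHull D u v, c ≠ u ∧ c ≠ v := by
  obtain ⟨c, h1, -, h2⟩ := hD.exists_mem_ne hu hv huv (S := univ)
    (fun u hu v _ _ => ⟨u, left_mem_connHull hu, trivial⟩)
  exact ⟨c, h1, h2⟩

/-- Small open connected neighbourhoods with finite frontier inside a prescribed set meeting every
arc. -/
theorem UniquelyArcwise.exists_nhds_finite_frontier [CompactSpace X] [LocallyConnectedSpace X]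
    (hD : UniquelyArcwise D) {x : X} (hx : D ∈ 𝓝 x) {O : Set X} (hO : O ∈ 𝓝 x) {S : Set X}
    (hS : ∀ u ∈ D, ∀ v ∈ D, u ≠ v → (connHull D u v ∩ S).Nonempty) :
    ∃ V, IsOpen V ∧ IsPreconnected V ∧ x ∈ V ∧ closure V ⊆ interior D ∩ O ∧
      (frontier V).Finite ∧ frontier V ⊆ S := by
  have hDO : interior D ∩ O ∈ 𝓝 x := inter_mem (interior_mem_nhds.2 hx) hO
  obtain ⟨r, hr, hball⟩ := Metric.nhds_basis_closedBall.mem_iff.1 hDO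
  have hxD : x ∈ D := mem_of_mem_nhds hx
  have hcl : ∀ z ∈ Metric.closedBall x r, z ∈ D := fun z hz => interior_subset (hball hz).1
  have hsph : ∀ z ∈ Metric.sphere x r, ∃ c N, IsOpen N ∧ z ∈ N ∧ c ∈ S ∧ c ≠ x ∧
      ∀ z' ∈ N, c ∈ connHull D x z' := by
    intro z hz
    have hzc := Metric.sphere_subset_closedBall hz
    have hxz : x ≠ z := by
      rintro rfl
      rw [Metric.mem_sphere, dist_self] at hz
      exact hr.ne hz
    obtain ⟨c, hc, hcS, hcx, hcz⟩ := hD.exists_mem_ne hxD (hcl z hzc) hxz hS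
    obtain ⟨N, hNo, hNc, hzN, hND⟩ := exists_isPreconnected_nhds
      (inter_mem (isOpen_interior.mem_nhds (hball hzc).1) (isOpen_ne.mem_nhds hcz.symm))
    exact ⟨c, N, hNo, hzN, hcS, hcx, fun z' hz' => connHull_move hNc
      (fun y hy => interior_subset (hND hy).1) hzN hz' (fun h => (hND h).2 rfl) hc⟩
  choose! c N hNo hzN hcS hcx hcN using hsph
  obtain ⟨t, htS, ht⟩ := (isCompact_sphere x r).elim_nhds_subcover N
    (fun z hz => (hNo z hz).mem_nhds (hzN z hz))
  let F : Set X := c '' t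
  have hF : F.Finite := t.finite_toSet.image c
  have hxF : x ∉ F := by
    rintro ⟨z, hz, hzx⟩
    exact hcx z (htS z hz) hzx
  let V := connectedComponentIn (Metric.ball x r \ F) x
  have hop : IsOpen (Metric.ball x r \ F) := Metric.isOpen_ball.sdiff hF.isClosed
  have hVo : IsOpen V := hop.connectedComponentIn
  have hVs : V ⊆ Metric.ball x r \ F := connectedComponentIn_subset _ _
  have hxV : x ∈ V := mem_connectedComponentIn ⟨Metric.mem_ball_self hr, hxF⟩
  have hVcl : closure V ⊆ Metric.closedBall x r :=
    closure_minimal (fun y hy => Metric.ball_subset_closedBall (hVs hy).1) Metric.isClosed_closedBall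
  have hVD : V ⊆ D := fun y hy => hcl y (hVcl (subset_closure hy))
  have hfr : frontier V ⊆ F := by
    intro y hy
    have hyc := hVcl (frontier_subset_closure hy)
    by_contra hyF
    have h1 := frontier_connectedComponentIn_subset hop x hy
    have h2 : y ∈ Metric.sphere x r := by
      rw [Metric.mem_sphere]
      by_contra hne
      exact h1 ⟨lt_of_le_of_ne hyc hne, hyF⟩
    have := ht h2
    simp only [mem_iUnion] at this
    obtain ⟨z, hz, hyN⟩ := this
    obtain ⟨v, hvN, hvV⟩ := mem_closure_iff.1 (frontier_subset_closure hy) _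
      (hNo z (htS z hz)) hyN
    have h3 := (hcN z (htS z hz) v hvN).2 V hVD isPreconnected_connectedComponentIn hxV hvV
    exact (hVs h3).2 (mem_image_of_mem _ hz)
  exact ⟨V, hVo, isPreconnected_connectedComponentIn, hxV, hVcl.trans hball, hF.subset hfr,
    hfr.trans (by rintro _ ⟨z, hz, rfl⟩; exact hcS z (htS z hz))⟩

/-- From an open connected set not contained in `V` one can leave `V` along a hull. -/
theorem exists_connHull_to_frontier [LocallyPathConnectedSpace X] {Q V : Set X} (hQ : IsOpen Q)
    (hQc : IsPreconnected Q) (hV : IsOpen V) (hVD : closure V ⊆ D) {x : X} (hxQ : x ∈ Q)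
    (hxV : x ∈ V) (hQV : ¬ Q ⊆ V) : ∃ v ∈ frontier V, v ∈ Q ∧ connHull D x v ⊆ Q := by
  obtain ⟨z, hzQ, hzV⟩ := not_subset.1 hQV
  obtain ⟨γ, hγ, h0, h1, hγQ⟩ := exists_path_of_isOpen hQ hQc hxQ hzQ
  obtain ⟨T, hT, hTf, hTc⟩ := exists_exit hγ hV (by rwa [h0]) zero_le_one (by rwa [h1])
  refine ⟨γ T, hTf, hγQ T, ?_⟩
  refine (connHull_subset_of (C := γ '' Icc 0 T) ?_ (isPreconnected_Icc.image _ hγ.continuousOn)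
    ⟨0, ⟨le_rfl, hT.1⟩, h0⟩ ⟨T, ⟨hT.1, le_rfl⟩, rfl⟩).trans ?_
  · rintro _ ⟨s, hs, rfl⟩
    exact hVD (hTc s hs)
  · rintro _ ⟨s, -, rfl⟩
    exact hγQ s

theorem locallyConnectedSpace_of_nhds {X : Type*} [TopologicalSpace X]
    (h : ∀ x : X, ∃ D ∈ 𝓝 x, LocallyConnectedSpace D) : LocallyConnectedSpace X := by
  rw [locallyConnectedSpace_iff_connected_subsets]
  intro x U hU
  obtain ⟨D, hD, hDl⟩ := h x
  obtain ⟨V, hV, hVc, hVU⟩ := locallyConnectedSpace_iff_connected_subsets.1 hDl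
    ⟨x, mem_of_mem_nhds hD⟩ ((↑) ⁻¹' U) (continuous_subtype_val.continuousAt.preimage_mem_nhds hU)
  refine ⟨(↑) '' V, ?_, hVc.image _ continuous_subtype_val.continuousOn, ?_⟩
  · rw [nhds_subtype_eq_comap] at hV
    obtain ⟨W, hW, hWV⟩ := hV
    filter_upwards [hW, hD] with y hy1 hy2
    exact ⟨⟨y, hy2⟩, hWV hy1, rfl⟩
  · rintro _ ⟨y, hy, rfl⟩
    exact hVU hy

end ArcHulls

section FiniteBoundary

variable {X : Type*} [MetricSpace X] {D : Set X}

theorem UniquelyArcwise.exists_pieces [LocallyPathConnectedSpace X] (hD : UniquelyArcwise D)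
    {Q V : Set X} (hQ : IsOpen Q) (hQc : IsPreconnected Q) (hV : IsOpen V)
    (hVD : closure V ⊆ D) (hVf : (frontier V).Finite) :
    ∃ 𝓐 : Set (Set X), 𝓐.Finite ∧ Q ∩ V ⊆ ⋃₀ 𝓐 ∧
      ∀ P ∈ 𝓐, P ⊆ D ∧ ∀ y ∈ P, ∀ y' ∈ P, connHull D y y' ⊆ Q := by
  by_cases hQV : Q ⊆ V
  · have hQD : Q ⊆ D := (hQV.trans subset_closure).trans hVD
    refine ⟨{Q}, finite_singleton Q, by simp, ?_⟩
    rintro P rfl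
    exact ⟨hQD, fun y hy y' hy' => connHull_subset_of hQD hQc hy hy'⟩
  · refine ⟨(fun v => {y | y ∈ V ∧ connHull D y v ⊆ Q}) '' frontier V, hVf.image _, ?_, ?_⟩
    · rintro x ⟨hxQ, hxV⟩
      obtain ⟨v, hv, -, h⟩ := exists_connHull_to_frontier hQ hQc hV hVD hxQ hxV hQV
      exact ⟨_, mem_image_of_mem _ hv, hxV, h⟩
    · rintro _ ⟨v, hv, rfl⟩
      have hvD : v ∈ D := hVD (frontier_subset_closure hv)
      refine ⟨fun y hy => hVD (subset_closure hy.1), fun y hy y' hy' => ?_⟩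
      have hyD : y ∈ D := hVD (subset_closure hy.1)
      have hyD' : y' ∈ D := hVD (subset_closure hy'.1)
      refine (connHull_subset_of (union_subset connHull_subset connHull_subset)
        ((hD.isPreconnected_connHull hyD hvD).union v (right_mem_connHull hvD)
          (right_mem_connHull hvD) (hD.isPreconnected_connHull hyD' hvD))
        (Or.inl (left_mem_connHull hyD)) (Or.inr (left_mem_connHull hyD'))).trans ?_
      exact union_subset hy.2 hy'.2

theorem UniquelyArcwise.mem_of_mem_connHull_closure [LocallyConnectedSpace X] {P Q : Set X}
    (hP : ∀ y ∈ P, ∀ y' ∈ P, connHull D y y' ⊆ Q) {a b c : X} (ha : a ∈ interior D)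
    (hb : b ∈ interior D) (haP : a ∈ closure P) (hbP : b ∈ closure P)
    (hc : c ∈ connHull D a b) (hca : c ≠ a) (hcb : c ≠ b) : c ∈ Q := by
  obtain ⟨N, hNo, hNc, haN, hN⟩ := exists_isPreconnected_nhds
    (inter_mem (isOpen_interior.mem_nhds ha) (isOpen_ne.mem_nhds hca.symm))
  obtain ⟨M, hMo, hMc, hbM, hM⟩ := exists_isPreconnected_nhds
    (inter_mem (isOpen_interior.mem_nhds hb) (isOpen_ne.mem_nhds hcb.symm))
  obtain ⟨y, hyN, hyP⟩ := mem_closure_iff.1 haP N hNo haN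
  obtain ⟨z, hzM, hzP⟩ := mem_closure_iff.1 hbP M hMo hbM
  refine hP y hyP z hzP ?_
  exact connHull_move hMc (fun x hx => interior_subset (hM hx).1) hbM hzM (fun h => (hM h).2 rfl)
    (connHull_move_left hNc (fun x hx => interior_subset (hN hx).1) haN hyN
      (fun h => (hN h).2 rfl) hc)

/-- Disjoint open connected sets of a compact locally uniquely arcwise connected space have
closures meeting in a finite set. -/
theorem finite_closure_inter_closure [CompactSpace X] [LocallyConnectedSpace X]
    [LocallyPathConnectedSpace X] (hX : ∀ x : X, ∃ D ∈ 𝓝 x, UniquelyArcwise D) {Q R : Set X}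
    (hQ : IsOpen Q) (hQc : IsPreconnected Q) (hR : IsOpen R) (hRc : IsPreconnected R)
    (hQR : Disjoint Q R) : (closure Q ∩ closure R).Finite := by
  have hloc : ∀ x : X, ∃ V ∈ 𝓝 x, (V ∩ (closure Q ∩ closure R)).Finite := by
    intro x
    obtain ⟨D, hDx, hD⟩ := hX x
    obtain ⟨V, hVo, hVc, hxV, hVcl, hVf, -⟩ := hD.exists_nhds_finite_frontier hDx univ_mem
      (S := univ) (fun u hu v _ _ => ⟨u, left_mem_connHull hu, trivial⟩)
    have hVi : closure V ⊆ interior D := fun y hy => (hVcl hy).1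
    refine ⟨V, hVo.mem_nhds hxV, ?_⟩
    obtain ⟨𝓐, hfin, hcov, hP⟩ := hD.exists_pieces hQ hQc hVo (hVi.trans interior_subset) hVf
    obtain ⟨𝓑, hfin', hcov', hP'⟩ := hD.exists_pieces hR hRc hVo (hVi.trans interior_subset) hVf
    have hfinu : (⋃ P ∈ 𝓐, ⋃ P' ∈ 𝓑, V ∩ (closure P ∩ closure P')).Finite := by
      refine hfin.biUnion fun P hPm => hfin'.biUnion fun P' hPm' => Set.Subsingleton.finite ?_
      rintro a ⟨haV, haP, haP'⟩ b ⟨hbV, hbP, hbP'⟩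
      by_contra hab
      have ha := hVi (subset_closure haV)
      have hb := hVi (subset_closure hbV)
      obtain ⟨c, hc, hca, hcb⟩ := hD.exists_between (interior_subset ha) (interior_subset hb) hab
      exact disjoint_left.1 hQR
        (UniquelyArcwise.mem_of_mem_connHull_closure (hP P hPm).2 ha hb haP hbP hc hca hcb)
        (UniquelyArcwise.mem_of_mem_connHull_closure (hP' P' hPm').2 ha hb haP' hbP' hc hca hcb)
    refine hfinu.subset ?_
    rintro y ⟨hyV, hyQ, hyR⟩
    have h1 : y ∈ closure (⋃₀ 𝓐) :=
      closure_mono hcov (by rw [inter_comm]; exact hVo.inter_closure ⟨hyV, hyQ⟩)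
    have h2 : y ∈ closure (⋃₀ 𝓑) :=
      closure_mono hcov' (by rw [inter_comm]; exact hVo.inter_closure ⟨hyV, hyR⟩)
    rw [hfin.closure_sUnion] at h1
    rw [hfin'.closure_sUnion] at h2
    simp only [mem_iUnion] at h1 h2 ⊢
    obtain ⟨P, hPm, hyP⟩ := h1
    obtain ⟨P', hPm', hyP'⟩ := h2
    exact ⟨P, hPm, P', hPm', hyV, hyP, hyP'⟩
  choose V hV hVf using hloc
  obtain ⟨t, -, ht⟩ := isCompact_univ.elim_nhds_subcover V (fun x _ => hV x)
  refine (t.finite_toSet.biUnion fun x _ => hVf x).subset fun y hy => ?_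
  have := ht (mem_univ y)
  simp only [mem_iUnion] at this ⊢
  obtain ⟨x, hx, hyx⟩ := this
  exact ⟨x, hx, hyx, hy⟩

end FiniteBoundary

theorem exists_finite_mapsTo_of_mem_periodicPts {X : Type*} {f : X → X} {q : X}
    (hq : q ∈ Function.periodicPts f) : ∃ F : Set X, F.Finite ∧ MapsTo f F F ∧ q ∈ F ∧
      F ⊆ Function.periodicPts f := by
  obtain ⟨m, hm, hp⟩ := hq
  refine ⟨(fun i => f^[i] q) '' (Iio m), (finite_Iio m).image _, ?_, ⟨0, hm, rfl⟩, ?_⟩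
  · rintro _ ⟨i, hi, rfl⟩
    simp only [← Function.iterate_succ_apply' f]
    rcases Nat.lt_or_ge (i + 1) m with h | h
    · exact ⟨i + 1, h, rfl⟩
    · obtain rfl : m = i + 1 := le_antisymm h hi
      exact ⟨0, hm, hp.symm⟩
  · rintro _ ⟨i, hi, rfl⟩
    exact ⟨m, hm, hp.apply_iterate i⟩

theorem periodicPts_iterate {X : Type*} {f : X → X} {m : ℕ} (hm : 0 < m) :
    Function.periodicPts f^[m] = Function.periodicPts f := by
  ext x
  constructor
  · rintro ⟨n, hn, h⟩
    refine ⟨m * n, Nat.mul_pos hm hn, ?_⟩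
    rwa [Function.IsPeriodicPt, Function.iterate_mul]
  · rintro ⟨n, hn, h⟩
    exact ⟨n, hn, h.iterate m⟩

section Recurrence

variable {X : Type*} [TopologicalSpace X]

/-- Every point returns to each of its neighbourhoods in positive time. -/
def PointwiseRecurrent (f : X → X) : Prop :=
  ∀ x, ∀ U ∈ 𝓝 x, ∃ n > 0, f^[n] x ∈ U

namespace PointwiseRecurrent

variable {f : X → X}

theorem iterate (hrec : PointwiseRecurrent f) (hf : Continuous f) {m : ℕ} (hm : 0 < m) :
    PointwiseRecurrent f^[m] := by
  intro x
  have : NeZero m := ⟨hm.ne'⟩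
  let R : Set (ZMod m) := {r | ∀ U ∈ 𝓝 x, ∃ n : ℕ, 0 < n ∧ (n : ZMod m) = r ∧ f^[n] x ∈ U}
  have hadd : ∀ r ∈ R, ∀ s ∈ R, r + s ∈ R := by
    intro r hr s hs U hU
    obtain ⟨n, hn, hnr, hnU⟩ := hr _ (interior_mem_nhds.2 hU)
    have hW : f^[n] ⁻¹' interior U ∈ 𝓝 x :=
      (isOpen_interior.preimage (hf.iterate n)).mem_nhds hnU
    obtain ⟨k, hk, hks, hkW⟩ := hs _ hW
    refine ⟨n + k, by omega, by push_cast; rw [hnr, hks], ?_⟩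
    rw [Function.iterate_add_apply]
    exact interior_subset hkW
  have hne : R.Nonempty := by
    by_contra hR
    have hR' : ∀ r, ∃ U ∈ 𝓝 x, ∀ n : ℕ, 0 < n → (n : ZMod m) = r → f^[n] x ∉ U := by
      intro r
      by_contra h
      push Not at h
      exact hR ⟨r, h⟩
    choose U hU hUr using hR'
    obtain ⟨n, hn, hnU⟩ := hrec x (⋂ r, U r) (iInter_mem.2 hU)
    exact hUr n n hn rfl (mem_iInter.1 hnU _)
  obtain ⟨r, hr⟩ := hne
  have hmul : ∀ k : ℕ, ((k + 1 : ℕ) : ZMod m) * r ∈ R := by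
    intro k
    induction k with
    | zero => simpa using hr
    | succ k ih =>
      have := hadd _ ih _ hr
      convert this using 1
      push_cast
      ring
  have h0 : (0 : ZMod m) ∈ R := by
    obtain ⟨k, rfl⟩ : ∃ k, m = k + 1 := ⟨m - 1, by omega⟩
    simpa using hmul k
  intro U hU
  obtain ⟨n, hn, hn0, hnU⟩ := h0 U hU
  obtain ⟨k, rfl⟩ := (ZMod.natCast_eq_zero_iff n m).1 hn0
  refine ⟨k, Nat.pos_of_ne_zero ?_, by rwa [← Function.iterate_mul]⟩
  rintro rfl
  simp at hn

theorem mem_of_iterate_mem (hrec : PointwiseRecurrent f) {K : Set X}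
    (hK : IsClosed K) (hinv : MapsTo f K K) {n : ℕ} {x : X} (h : f^[n] x ∈ K) : x ∈ K := by
  induction n generalizing x with
  | zero => simpa using h
  | succ n ih =>
    rw [Function.iterate_succ_apply] at h
    have h1 := ih h
    by_contra hx
    obtain ⟨k, hk, hkK⟩ := hrec x _ (hK.isOpen_compl.mem_nhds hx)
    obtain ⟨j, rfl⟩ : ∃ j, k = j + 1 := ⟨k - 1, by omega⟩
    rw [Function.iterate_succ_apply] at hkK
    exact hkK (hinv.iterate j h1)

theorem exists_mapsTo (hrec : PointwiseRecurrent f) (hf : Continuous f) {K V : Set X}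
    (hK : IsClosed K) (hinv : MapsTo f K K) (hV : IsOpen V) (hVc : IsPreconnected V)
    (hVK : Disjoint V K) (hVf : frontier V ⊆ K) : ∃ k > 0, MapsTo f^[k] V V := by
  rcases V.eq_empty_or_nonempty with rfl | ⟨x, hx⟩
  · exact ⟨1, one_pos, mapsTo_empty _ _⟩
  obtain ⟨k, hk, hkV⟩ := hrec x V (hV.mem_nhds hx)
  refine ⟨k, hk, mapsTo_iff_image_subset.2 ?_⟩
  refine (hVc.image _ (hf.iterate k).continuousOn).subset_of_disjoint_frontier hV
    ⟨_, mem_image_of_mem _ hx, hkV⟩ ?_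
  rintro _ ⟨y, hy, rfl⟩ hyf
  exact disjoint_left.1 hVK hy (hrec.mem_of_iterate_mem hK hinv (hVf hyf))

theorem exists_mapsTo_component [LocallyConnectedSpace X] (hrec : PointwiseRecurrent f)
    (hf : Continuous f) {K : Set X} (hK : IsClosed K) (hinv : MapsTo f K K) (x : X) :
    ∃ k > 0, MapsTo f^[k] (connectedComponentIn Kᶜ x) (connectedComponentIn Kᶜ x) := by
  refine hrec.exists_mapsTo hf hK hinv hK.isOpen_compl.connectedComponentIn
    isPreconnected_connectedComponentIn ?_ ?_
  · exact disjoint_left.2 fun y hy => connectedComponentIn_subset _ _ hy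
  · simpa using frontier_connectedComponentIn_subset hK.isOpen_compl x

theorem mem_periodicPts [T1Space X] (hrec : PointwiseRecurrent f) {F : Set X} (hF : F.Finite)
    (hinv : MapsTo f F F) {x : X} (hx : x ∈ F) : x ∈ Function.periodicPts f := by
  obtain ⟨n, hn, hnU⟩ := hrec x (F \ {x})ᶜ
    ((hF.subset sdiff_subset).isClosed.isOpen_compl.mem_nhds (by simp))
  refine Function.mk_mem_periodicPts hn ?_
  by_contra h
  exact hnU ⟨hinv.iterate n hx, h⟩

theorem mem_periodicPts_of_iterate [T1Space X] (hrec : PointwiseRecurrent f) {n : ℕ} {x : X}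
    (h : f^[n] x ∈ Function.periodicPts f) : x ∈ Function.periodicPts f := by
  obtain ⟨F, hF, hinv, hm, -⟩ := exists_finite_mapsTo_of_mem_periodicPts h
  exact hrec.mem_periodicPts hF hinv (hrec.mem_of_iterate_mem hF.isClosed hinv hm)

theorem surjective [T2Space X] [CompactSpace X] (hrec : PointwiseRecurrent f)
    (hf : Continuous f) : Function.Surjective f := by
  intro x
  exact hrec.mem_of_iterate_mem (K := range f) (n := 1) (isCompact_range hf).isClosed
    (fun y _ => ⟨y, rfl⟩) ⟨x, rfl⟩

end PointwiseRecurrent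

/-- If every frontier point of an open set enters it, then so does every point of a connected
space. -/
theorem PointwiseRecurrent.forall_exists_iterate_mem [CompactSpace X] [PreconnectedSpace X]
    {h : X → X} (hrec : PointwiseRecurrent h) (hh : Continuous h) {U : Set X} (hU : IsOpen U)
    (hne : U.Nonempty) (hfr : ∀ t ∈ frontier U, ∃ i, h^[i] t ∈ U) (w : X) :
    ∃ i, h^[i] w ∈ U := by
  have hcl : ∀ w ∈ closure U, ∃ i > 0, h^[i] w ∈ U := by
    intro w hw
    by_cases hwU : w ∈ U
    · exact hrec w U (hU.mem_nhds hwU)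
    · obtain ⟨i, hi⟩ := hfr w (hU.frontier_eq ▸ ⟨hw, hwU⟩)
      refine ⟨i, Nat.pos_of_ne_zero ?_, hi⟩
      rintro rfl
      exact hwU hi
  obtain ⟨L, hL⟩ : ∃ L : ℕ, ∀ w ∈ closure U, ∃ i > 0, i ≤ L ∧ h^[i] w ∈ U := by
    obtain ⟨t, ht⟩ := isClosed_closure.isCompact.elim_finite_subcover
      (fun i : ℕ => h^[i + 1] ⁻¹' U) (fun i => hU.preimage (hh.iterate _)) (fun w hw => by
        obtain ⟨i, hi, hiU⟩ := hcl w hw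
        obtain ⟨j, rfl⟩ : ∃ j, i = j + 1 := ⟨i - 1, by omega⟩
        exact mem_iUnion.2 ⟨j, hiU⟩)
    refine ⟨t.sup id + 1, fun w hw => ?_⟩
    obtain ⟨i, hi, hiU⟩ := mem_iUnion₂.1 (ht hw)
    have := Finset.le_sup (f := id) hi
    exact ⟨i + 1, by omega, by simpa using this, hiU⟩
  let A : Set X := {w | ∃ i, h^[i] w ∈ U}
  let A' : Set X := ⋃ i ∈ Iic L, h^[i] ⁻¹' closure U
  have hA'c : IsClosed A' :=
    (finite_Iic L).isClosed_biUnion fun i _ => isClosed_closure.preimage (hh.iterate i)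
  have hA'inv : MapsTo h A' A' := by
    intro w hw
    obtain ⟨i, hi, hiU⟩ := mem_iUnion₂.1 hw
    rcases Nat.eq_zero_or_pos i with rfl | hi0
    · obtain ⟨j, hj, hjL, hjU⟩ := hL w hiU
      obtain ⟨j, rfl⟩ : ∃ k, j = k + 1 := ⟨j - 1, by omega⟩
      exact mem_iUnion₂.2 ⟨j, by rw [mem_Iic]; omega, subset_closure hjU⟩
    · obtain ⟨j, rfl⟩ : ∃ k, i = k + 1 := ⟨i - 1, by omega⟩
      exact mem_iUnion₂.2 ⟨j, by rw [mem_Iic] at *; omega, hiU⟩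
  have hAA' : A = A' := by
    apply Subset.antisymm
    · rintro w ⟨i, hi⟩
      exact hrec.mem_of_iterate_mem hA'c hA'inv
        (mem_iUnion₂.2 ⟨0, Nat.zero_le _, subset_closure hi⟩)
    · intro w hw
      obtain ⟨i, -, hiU⟩ := mem_iUnion₂.1 hw
      obtain ⟨j, -, hj⟩ := hcl _ hiU
      exact ⟨j + i, by rwa [Function.iterate_add_apply]⟩
  have hAo : IsOpen A := by
    have : A = ⋃ i, h^[i] ⁻¹' U := by ext w; simp [A]
    rw [this]
    exact isOpen_iUnion fun i => hU.preimage (hh.iterate i)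
  have : A = univ := IsClopen.eq_univ ⟨hAA' ▸ hA'c, hAo⟩ (hne.mono fun x hx => ⟨0, hx⟩)
  exact this.ge (mem_univ w)

/-- A periodic point cannot separate two points whose images lie in a common connected set of
nonperiodic points. -/
theorem PointwiseRecurrent.notMem_connHull [T1Space X] [LocallyConnectedSpace X] {f : X → X}
    (hrec : PointwiseRecurrent f) (hf : Continuous f) {M : Set X} (hM : IsPreconnected M)
    (hMp : Disjoint M (Function.periodicPts f)) {i : ℕ} {w w' q : X} (hw : f^[i] w ∈ M)
    (hw' : f^[i] w' ∈ M) (hq : q ∈ Function.periodicPts f) : q ∉ connHull univ w w' := by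
  obtain ⟨F, hF, hinv, hqF, hFp⟩ := exists_finite_mapsTo_of_mem_periodicPts hq
  have hnF : ∀ {y}, f^[i] y ∈ M → y ∈ Fᶜ := fun hy hyF =>
    disjoint_left.1 hMp hy (hFp (hinv.iterate i hyF))
  obtain ⟨k, hk, hkQ⟩ := hrec.exists_mapsTo_component hf hF.isClosed hinv w
  obtain ⟨k', hk', hkQ'⟩ := hrec.exists_mapsTo_component hf hF.isClosed hinv w'
  have hle : i ≤ k * k' * (i + 1) := by
    have : 0 < k * k' := Nat.mul_pos hk hk'
    nlinarith
  have m1 : MapsTo f^[k * k' * (i + 1)] (connectedComponentIn Fᶜ w)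
      (connectedComponentIn Fᶜ w) := by
    rw [mul_assoc, Function.iterate_mul]
    exact hkQ.iterate _
  have m2 : MapsTo f^[k * k' * (i + 1)] (connectedComponentIn Fᶜ w')
      (connectedComponentIn Fᶜ w') := by
    rw [mul_comm k, mul_assoc, Function.iterate_mul]
    exact hkQ'.iterate _
  have hsub : f^[k * k' * (i + 1) - i] '' M ⊆ Fᶜ := by
    rintro _ ⟨y, hy, rfl⟩ hyF
    exact disjoint_left.1 hMp hy (hrec.mem_periodicPts_of_iterate (hFp hyF))
  have himg : ∀ {y}, f^[i] y ∈ M → f^[k * k' * (i + 1)] y ∈ f^[k * k' * (i + 1) - i] '' M := by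
    intro y hy
    refine ⟨_, hy, ?_⟩
    rw [← Function.iterate_add_apply]
    congr 1
    omega
  have h1 := m1 (mem_connectedComponentIn (hnF hw))
  have h2 := m2 (mem_connectedComponentIn (hnF hw'))
  have h3 := (hM.image _ (hf.iterate _).continuousOn).subset_connectedComponentIn
    (himg hw) hsub (himg hw')
  rw [← connectedComponentIn_eq h1] at h3
  have h4 : connectedComponentIn Fᶜ w = connectedComponentIn Fᶜ w' := by
    rw [connectedComponentIn_eq h3, ← connectedComponentIn_eq h2]
  intro hqh
  exact connectedComponentIn_subset Fᶜ w (hqh.2 _ (subset_univ _)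
    isPreconnected_connectedComponentIn (mem_connectedComponentIn (hnF hw))
    (h4 ▸ mem_connectedComponentIn (hnF hw'))) hqF

end Recurrence

section LocalArcs

variable {X : Type*} [MetricSpace X] [CompactSpace X] [LocallyConnectedSpace X]
  [LocallyPathConnectedSpace X]

/-- A connected set of nonperiodic points meeting the closure of an invariant open connected set
lies in that closure. -/
theorem PointwiseRecurrent.subset_closure_of_mapsTo (hX : ∀ x : X, ∃ D ∈ 𝓝 x, UniquelyArcwise D)
    {g : X → X} (hrec : PointwiseRecurrent g) (hg : Continuous g) {Q J : Set X} (hQ : IsOpen Q)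
    (hQc : IsPreconnected Q) (hgQ : MapsTo g Q Q) (hJ : IsPreconnected J)
    (hJp : Disjoint J (Function.periodicPts g)) (hJQ : (J ∩ closure Q).Nonempty) :
    J ⊆ closure Q := by
  intro y hy
  by_contra hyQ
  have hinv : MapsTo g (closure Q) (closure Q) := hgQ.closure hg
  have hRo := (isClosed_closure (s := Q)).isOpen_compl.connectedComponentIn (x := y)
  have hRf := frontier_connectedComponentIn_subset (isClosed_closure (s := Q)).isOpen_compl y
  obtain ⟨k, hk, hkR⟩ := hrec.exists_mapsTo_component hg isClosed_closure hinv y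
  set R := connectedComponentIn (closure Q)ᶜ y
  have hRQ : Disjoint Q R := disjoint_left.2 fun z hz hzR =>
    connectedComponentIn_subset _ _ hzR (subset_closure hz)
  have hfin := finite_closure_inter_closure hX hQ hQc hRo isPreconnected_connectedComponentIn hRQ
  obtain ⟨s, hsJ, hsR⟩ : ∃ s ∈ J, s ∈ frontier R := by
    by_contra! h
    have := hJ.subset_of_disjoint_frontier hRo ⟨y, hy, mem_connectedComponentIn hyQ⟩ h
    obtain ⟨z, hzJ, hzQ⟩ := hJQ
    exact connectedComponentIn_subset _ _ (this hzJ) hzQ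
  refine disjoint_left.1 hJp hsJ ?_
  rw [← periodicPts_iterate hk]
  refine (hrec.iterate hg hk).mem_periodicPts hfin ?_
    ⟨not_not.1 (hRf hsR), frontier_subset_closure hsR⟩
  exact (hinv.iterate k).inter_inter (hkR.closure (hg.iterate k))

end LocalArcs

theorem exists_iterate_fix_of_finite {X : Type*} {f : X → X} {F : Set X} (hF : F.Finite)
    (hFp : F ⊆ Function.periodicPts f) : ∃ N > 0, ∀ y ∈ F, f^[N] y = y := by
  refine ⟨∏ y ∈ hF.toFinset, Function.minimalPeriod f y, Finset.prod_pos fun y hy => ?_,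
    fun y hy => ?_⟩
  · exact Function.minimalPeriod_pos_of_mem_periodicPts (hFp (hF.mem_toFinset.1 hy))
  · exact (Function.isPeriodicPt_minimalPeriod f y).trans_dvd
      (Finset.dvd_prod_of_mem _ (hF.mem_toFinset.2 hy))

section DensePeriodic

variable {X : Type*} [MetricSpace X] [CompactSpace X] [LocallyConnectedSpace X]

/-- Equicontinuity when periodic points are dense on every arc. -/
theorem PointwiseRecurrent.equicontinuous_of_dense_periodicPts
    (hX : ∀ x : X, ∃ D ∈ 𝓝 x, UniquelyArcwise D) {f : X → X} (hrec : PointwiseRecurrent f)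
    (hf : Continuous f) (hS : ∀ D : Set X, UniquelyArcwise D → ∀ u ∈ D, ∀ v ∈ D, u ≠ v →
      (connHull D u v ∩ Function.periodicPts f).Nonempty) {ε : ℝ} (hε : 0 < ε) :
    ∃ δ : ℝ, 0 < δ ∧ ∀ x y : X, dist x y < δ → ∀ n : ℕ, dist (f^[n] x) (f^[n] y) < ε := by
  have hloc : ∀ x : X, ∃ V m, IsOpen V ∧ x ∈ V ∧ V ⊆ Metric.ball x (ε / 2) ∧ 0 < m ∧
      MapsTo f^[m] V V := by
    intro x
    obtain ⟨D, hDx, hD⟩ := hX x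
    obtain ⟨V, hVo, hVc, hxV, hVcl, hVf, hVS⟩ := hD.exists_nhds_finite_frontier hDx
      (Metric.ball_mem_nhds x (half_pos hε)) (hS D hD)
    obtain ⟨N, hN, hNf⟩ := exists_iterate_fix_of_finite hVf hVS
    obtain ⟨k, hk, hkV⟩ := (hrec.iterate hf hN).exists_mapsTo (hf.iterate N) hVf.isClosed
      (fun y hy => by rwa [hNf y hy]) hVo hVc
      (disjoint_left.2 fun y hy hyf => (hVo.frontier_eq ▸ hyf).2 hy) Subset.rfl
    refine ⟨V, N * k, hVo, hxV, fun y hy => (hVcl (subset_closure hy)).2, Nat.mul_pos hN hk, ?_⟩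
    rwa [Function.iterate_mul]
  choose V m hVo hxV hVb hm hmV using hloc
  obtain ⟨t, -, ht⟩ := isCompact_univ.elim_nhds_subcover V (fun x _ => (hVo x).mem_nhds (hxV x))
  obtain ⟨δ, hδ, hleb⟩ := lebesgue_number_lemma_of_metric (c := fun x : t => V x)
    (isCompact_univ (X := X)) (fun x => hVo x) (fun y hy => by
      simpa using ht hy)
  set M := ∏ x ∈ t, m x
  have hM : 0 < M := Finset.prod_pos fun x _ => hm x
  have hMV : ∀ x ∈ t, ∀ j, MapsTo f^[M * j] (V x) (V x) := by
    intro x hx j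
    obtain ⟨c, hc⟩ := Finset.dvd_prod_of_mem m hx
    rw [show M = m x * c from hc, mul_assoc, Function.iterate_mul]
    exact (hmV x).iterate _
  have huc : ∀ i : ℕ, ∃ δ' > 0, ∀ x y : X, dist x y < δ' → dist (f^[i] x) (f^[i] y) < δ := by
    intro i
    obtain ⟨δ', h, h'⟩ := Metric.uniformContinuous_iff.1
      (CompactSpace.uniformContinuous_of_continuous (hf.iterate i)) δ hδ
    exact ⟨δ', h, fun x y hxy => h' hxy⟩
  choose η hη hηd using huc
  have hne : (Finset.range M).Nonempty := Finset.nonempty_range_iff.2 hM.ne'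
  refine ⟨(Finset.range M).inf' hne η, (Finset.lt_inf'_iff _).2 fun i _ => hη i, ?_⟩
  intro x y hxy n
  have hi : n % M ∈ Finset.range M := Finset.mem_range.2 (Nat.mod_lt _ hM)
  have h1 := hηd (n % M) x y (hxy.trans_le (Finset.inf'_le _ hi))
  obtain ⟨⟨z, hz⟩, hzV⟩ := hleb (f^[n % M] x) (mem_univ _)
  have hx' := hMV z hz (n / M) (hzV (Metric.mem_ball_self hδ))
  have hy' := hMV z hz (n / M) (hzV (Metric.mem_ball'.2 h1))
  rw [← Function.iterate_add_apply, Nat.div_add_mod] at hx' hy'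
  calc dist (f^[n] x) (f^[n] y) ≤ dist (f^[n] x) z + dist (f^[n] y) z :=
        dist_triangle_right _ _ _
    _ < ε / 2 + ε / 2 := add_lt_add (hVb z hx') (hVb z hy')
    _ = ε := add_halves ε

end DensePeriodic

section Separation

variable {X : Type*} [MetricSpace X] {D E : Set X} {b s u v x y z c : X}

theorem UniquelyArcwise.connHull_antisymm (hD : UniquelyArcwise D) (hs : s ∈ D)
    (h1 : x ∈ connHull D s y) (h2 : y ∈ connHull D s x) : x = y := by
  by_cases hsx : s = x
  · subst hsx
    rw [connHull_self hs] at h2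
    exact h2.symm
  obtain ⟨α, hα, hαi, h0, hα1, h⟩ := hD.exists_arc hs (connHull_subset h1) hsx
  have h2' := h2
  rw [← h0, ← hα1, h 0 1 le_rfl zero_le_one le_rfl] at h2'
  obtain ⟨r, hr, rfl⟩ := h2'
  rw [← h0, h 0 r le_rfl hr.1 hr.2] at h1
  obtain ⟨r', hr', h1⟩ := h1
  rw [← hα1] at h1
  have := hαi ⟨hr'.1, hr'.2.trans hr.2⟩ (right_mem_Icc.2 zero_le_one) h1
  rw [← hα1, le_antisymm hr.2 (this ▸ hr'.2)]

theorem connHull_subset_univ_restrict (h : c ∈ connHull univ u v) (hc : c ∈ D) :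
    c ∈ connHull D u v :=
  ⟨hc, fun C _ hC hu hv => h.2 C (subset_univ _) hC hu hv⟩

theorem connHull_trans_right (h1 : x ∈ connHull D s y) (h2 : z ∈ connHull D x y) :
    z ∈ connHull D s y :=
  ⟨h2.1, fun C hCD hC hs hy => h2.2 C hCD hC (h1.2 C hCD hC hs hy) hy⟩

theorem isClosed_connHull_rel [LocallyConnectedSpace X] [LocallyPathConnectedSpace X] (s : X) :
    IsClosed {p : X × X | p.1 ∈ connHull univ s p.2} := by
  rw [← isOpen_compl_iff, isOpen_iff_mem_nhds]
  rintro ⟨x, y⟩ hxy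
  obtain ⟨C, hC, hs, hy, hx⟩ : ∃ C, IsPreconnected C ∧ s ∈ C ∧ y ∈ C ∧ x ∉ C := by
    by_contra! h
    exact hxy ⟨mem_univ _, fun C _ hC hs hy => h C hC hs hy⟩
  have hCs : C ⊆ connectedComponentIn {x}ᶜ s :=
    hC.subset_connectedComponentIn hs (subset_compl_singleton_iff.2 hx)
  obtain ⟨γ, hγ, h0, h1, hγx⟩ := exists_path_of_isOpen
    isOpen_compl_singleton.connectedComponentIn isPreconnected_connectedComponentIn
    (hCs hs) (hCs hy)
  have hK : IsCompact (γ '' Icc 0 1) := isCompact_Icc.image hγ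
  obtain ⟨N, W, hN, hW, hxN, hKW, hNW⟩ := SeparatedNhds.of_isCompact_isCompact
    isCompact_singleton hK (disjoint_singleton_left.2 (by
      rintro ⟨t, -, rfl⟩
      exact connectedComponentIn_subset _ _ (hγx t) rfl) : Disjoint {x} _)
  obtain ⟨M, hM, hMc, hyM, hMW⟩ := exists_isPreconnected_nhds
    (hW.mem_nhds (hKW ⟨1, ⟨zero_le_one, le_rfl⟩, h1⟩))
  refine mem_of_superset (prod_mem_nhds (hN.mem_nhds (hxN rfl)) (hM.mem_nhds hyM)) ?_
  rintro ⟨x', y'⟩ ⟨hx', hy'⟩ h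
  have := h.2 (γ '' Icc 0 1 ∪ M) (subset_univ _)
    ((isPreconnected_Icc.image _ hγ.continuousOn).union y ⟨1, ⟨zero_le_one, le_rfl⟩, h1⟩ hyM hMc)
    (Or.inl ⟨0, ⟨le_rfl, zero_le_one⟩, h0⟩) (Or.inr hy')
  exact disjoint_left.1 hNW hx' (this.elim (fun h => hKW h) (fun h => hMW h))

theorem insert_connectedComponentIn_preconnected [PreconnectedSpace X] [LocallyConnectedSpace X]
    (h : y ≠ z) : IsPreconnected (insert z (connectedComponentIn {z}ᶜ y)) := by
  refine isPreconnected_connectedComponentIn.subset_closure (subset_insert _ _)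
    (insert_subset ?_ subset_closure)
  by_contra hz
  have hf := frontier_connectedComponentIn_subset (isOpen_compl_singleton (x := z)) y
  rw [compl_compl] at hf
  have hsub := isPreconnected_univ.subset_of_disjoint_frontier
    (isOpen_compl_singleton (x := z)).connectedComponentIn
    ⟨y, mem_univ _, mem_connectedComponentIn h⟩
    (fun w _ hw => hz (mem_of_eq_of_mem (hf hw : w = z).symm (frontier_subset_closure hw)))
  exact connectedComponentIn_subset _ _ (hsub (mem_univ z)) rfl

/-- A connected open set `E` inside the uniquely arcwise connected set `D`, attached to the rest of
the space at the point `b`. -/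
structure IsEndBranch (D E : Set X) (b : X) : Prop where
  arcwise : UniquelyArcwise D
  isOpen : IsOpen E
  isPreconnected : IsPreconnected E
  notMem : b ∉ E
  frontier_subset : frontier E ⊆ {b}
  closure_subset : closure E ⊆ D

namespace IsEndBranch

theorem eq_of_mem_closure (h : IsEndBranch D E b) (hx : x ∈ closure E) (hxE : x ∉ E) : x = b :=
  h.frontier_subset (h.isOpen.frontier_eq ▸ ⟨hx, hxE⟩)

theorem subset (h : IsEndBranch D E b) : E ⊆ D := subset_closure.trans h.closure_subset

theorem mem_closure [PreconnectedSpace X] (h : IsEndBranch D E b) (hne : E.Nonempty) :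
    b ∈ closure E := by
  by_contra hb
  obtain ⟨x, hx⟩ := hne
  exact h.notMem (isPreconnected_univ.subset_of_disjoint_frontier h.isOpen ⟨x, mem_univ _, hx⟩
    (fun w _ hw => hb (by rw [← h.frontier_subset hw]; exact frontier_subset_closure hw))
    (mem_univ b))

theorem mem_of_mem_connHull (h : IsEndBranch D E b) (hu : u ∈ closure E) (hv : v ∈ closure E)
    (hc : c ∈ connHull D u v) (hcu : c ≠ u) (hcv : c ≠ v) : c ∈ E := by
  by_contra hcE
  have hb := h.eq_of_mem_closure
    (connHull_subset_of h.closure_subset h.isPreconnected.closure hu hv hc) hcE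
  have hu' : u ∈ E := by
    by_contra hu'
    exact hcu (hb.trans (h.eq_of_mem_closure hu hu').symm)
  have hv' : v ∈ E := by
    by_contra hv'
    exact hcv (hb.trans (h.eq_of_mem_closure hv hv').symm)
  exact hcE (connHull_subset_of h.subset h.isPreconnected hu' hv' hc)

theorem mem_connHull_univ [PreconnectedSpace X] (h : IsEndBranch D E b) (hu : u ∈ closure E)
    (hv : v ∈ closure E) (hc : c ∈ connHull D u v) (hcu : c ≠ u) (hcv : c ≠ v) :
    c ∈ connHull univ u v := by
  classical
  have hcE := h.mem_of_mem_connHull hu hv hc hcu hcv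
  have hbE := h.mem_closure ⟨c, hcE⟩
  have hρ : Continuous (fun x => if x ∈ closure E then x else b) :=
    Continuous.if (fun a ha => h.frontier_subset (frontier_closure_subset ha)) continuous_id
      continuous_const
  refine ⟨mem_univ c, fun C _ hC huC hvC => ?_⟩
  have := hc.2 ((fun x => if x ∈ closure E then x else b) '' C) ?_ (hC.image _ hρ.continuousOn)
    ⟨u, huC, if_pos hu⟩ ⟨v, hvC, if_pos hv⟩
  · obtain ⟨x, hx, hxc⟩ := this
    dsimp only at hxc
    split_ifs at hxc with h'
    · rwa [← hxc]
    · exact (h.notMem (hxc ▸ hcE)).elim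
  · rintro _ ⟨x, -, rfl⟩
    dsimp only
    split_ifs with h'
    · exact h.closure_subset h'
    · exact h.closure_subset hbE

theorem isPreconnected_compl [PreconnectedSpace X] (h : IsEndBranch D E b) :
    IsPreconnected Eᶜ := by
  classical
  have hρ : Continuous (fun x => if x ∈ closure E then b else x) :=
    Continuous.if (fun a ha => (h.frontier_subset (frontier_closure_subset ha)).symm)
      continuous_const continuous_id
  convert isPreconnected_range hρ using 1
  ext x
  constructor
  · intro hx
    by_cases hxE : x ∈ closure E
    · exact ⟨x, (if_pos hxE).trans (h.eq_of_mem_closure hxE hx).symm⟩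
    · exact ⟨x, if_neg hxE⟩
  · rintro ⟨y, rfl⟩
    dsimp only
    split_ifs with h'
    · exact h.notMem
    · exact fun hy => h' (subset_closure hy)

theorem component [PreconnectedSpace X] [LocallyConnectedSpace X] (h : IsEndBranch D E b)
    (hs : s ∈ E) (hy : y ≠ s) (hb : b ∉ connectedComponentIn {s}ᶜ y) :
    IsEndBranch D (connectedComponentIn {s}ᶜ y) s ∧ connectedComponentIn {s}ᶜ y ⊆ E := by
  have hf := frontier_connectedComponentIn_subset (isOpen_compl_singleton (x := s)) y
  have hQo := (isOpen_compl_singleton (x := s)).connectedComponentIn (x := y)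
  have hpre := insert_connectedComponentIn_preconnected hy
  have hsub : connectedComponentIn {s}ᶜ y ⊆ E := by
    refine (subset_insert _ _).trans (hpre.subset_of_disjoint_frontier h.isOpen
      ⟨s, mem_insert _ _, hs⟩ fun w hw hwf => ?_)
    obtain rfl := h.frontier_subset hwf
    rcases hw with rfl | hw
    · exact h.notMem hs
    · exact hb hw
  exact ⟨⟨h.arcwise, hQo, isPreconnected_connectedComponentIn,
    fun hs' => connectedComponentIn_subset _ _ hs' rfl, by simpa using hf,
    (closure_mono hsub).trans h.closure_subset⟩, hsub⟩

/-- One of the two sides of a separating point of an end branch lies in the branch. -/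
theorem component_or_component [PreconnectedSpace X] [LocallyConnectedSpace X]
    (h : IsEndBranch D E b) (hs : s ∈ E) (hu : u ≠ s) (hv : v ≠ s)
    (hsep : s ∈ connHull univ u v) :
    (IsEndBranch D (connectedComponentIn {s}ᶜ u) s ∧ connectedComponentIn {s}ᶜ u ⊆ E) ∨
    (IsEndBranch D (connectedComponentIn {s}ᶜ v) s ∧ connectedComponentIn {s}ᶜ v ⊆ E) := by
  by_cases h1 : b ∈ connectedComponentIn {s}ᶜ u
  · by_cases h2 : b ∈ connectedComponentIn {s}ᶜ v
    · have h3 : v ∈ connectedComponentIn {s}ᶜ u := by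
        rw [connectedComponentIn_eq h1, ← connectedComponentIn_eq h2]
        exact mem_connectedComponentIn hv
      exact (connectedComponentIn_subset _ _ (hsep.2 _ (subset_univ _)
        isPreconnected_connectedComponentIn (mem_connectedComponentIn hu) h3) rfl).elim
    · exact Or.inr (h.component hs hv h2)
  · exact Or.inl (h.component hs hu h1)

end IsEndBranch

end Separation

section EndBranches

variable {X : Type*} [MetricSpace X] [CompactSpace X]
  [LocallyConnectedSpace X] [LocallyPathConnectedSpace X] {D E C : Set X} {b s : X} {f g : X → X}

namespace PointwiseRecurrent

theorem subset_of_mem_connHull (hX : ∀ x : X, ∃ D ∈ 𝓝 x, UniquelyArcwise D)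
    (hrec : PointwiseRecurrent g) (hg : Continuous g) (hC : IsPreconnected C)
    (hCp : Disjoint C (Function.periodicPts g)) {K : Set X} (hK : IsClosed K)
    (hinv : MapsTo g K K) {a c : X} (hsK : s ∈ K) (ha : a ∈ C) (hc : c ∈ C)
    (hsac : s ∈ connHull univ a c) (hsa : s ≠ a) (hsc : s ≠ c) : C ⊆ K := by
  intro y hy
  by_contra hyK
  obtain ⟨k, hk, hkQ⟩ := hrec.exists_mapsTo_component hg hK hinv y
  have hyQ := mem_connectedComponentIn (F := Kᶜ) hyK
  have hcl := (hrec.iterate hg hk).subset_closure_of_mapsTo hX (hg.iterate k)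
    hK.isOpen_compl.connectedComponentIn isPreconnected_connectedComponentIn hkQ hC
    (by rwa [periodicPts_iterate hk]) ⟨y, hy, subset_closure hyQ⟩
  have hpre : IsPreconnected (insert a (insert c (connectedComponentIn Kᶜ y))) :=
    isPreconnected_connectedComponentIn.subset_closure
      ((subset_insert _ _).trans (subset_insert _ _))
      (insert_subset (hcl ha) (insert_subset (hcl hc) subset_closure))
  rcases hsac.2 _ (subset_univ _) hpre (mem_insert _ _)
    (mem_insert_of_mem _ (mem_insert _ _)) with h | h | h
  · exact hsa h
  · exact hsc h
  · exact connectedComponentIn_subset _ _ h hsK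

theorem subset_closure_orbit (hX : ∀ x : X, ∃ D ∈ 𝓝 x, UniquelyArcwise D)
    (hrec : PointwiseRecurrent g) (hg : Continuous g) (hC : IsPreconnected C)
    (hCp : Disjoint C (Function.periodicPts g)) {a c : X} (ha : a ∈ C) (hc : c ∈ C)
    (hsac : s ∈ connHull univ a c) (hsa : s ≠ a) (hsc : s ≠ c) :
    C ⊆ closure (range fun n => g^[n] s) := by
  refine hrec.subset_of_mem_connHull hX hg hC hCp isClosed_closure (MapsTo.closure ?_ hg)
    (subset_closure ⟨0, rfl⟩) ha hc hsac hsa hsc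
  rintro _ ⟨n, rfl⟩
  exact ⟨n + 1, Function.iterate_succ_apply' g n s⟩

end PointwiseRecurrent

/-- A maximal fixed point argument along an end branch. -/
theorem IsEndBranch.exists_fixed [PreconnectedSpace X] (hE : IsEndBranch D E s) (hg : Continuous g)
    (hC : IsPreconnected C) (hgC : MapsTo g C C) (hsC : s ∈ C) (hgs : g s ∈ E) :
    ∃ q ∈ E, q ∈ closure C ∧ g q = q := by
  have hsE := hE.mem_closure ⟨_, hgs⟩
  have hT : MapsTo g (closure C) (closure C) := hgC.closure hg
  let L : Set X := {x | x ∈ closure C ∧ x ∈ closure E ∧ x ∈ connHull univ s (g x)}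
  have hL : IsCompact L := by
    refine IsClosed.isCompact (isClosed_closure.inter (isClosed_closure.inter ?_))
    exact (isClosed_connHull_rel s).preimage (continuous_id.prodMk hg)
  have hsL : s ∈ L := ⟨subset_closure hsC, hsE, left_mem_connHull trivial⟩
  have hmax : ∃ m : L, ∀ a : L, (m : X) ∈ connHull univ s (a : X) →
      (a : X) ∈ connHull univ s (m : X) := by
    refine exists_maximal_of_chains_bounded (r := fun a c : L => (a : X) ∈ connHull univ s (c : X))
      (fun c hc => ?_) (fun h1 h2 => connHull_trans h1 h2)
    rcases c.eq_empty_or_nonempty with rfl | hne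
    · exact ⟨⟨s, hsL⟩, by simp⟩
    have : Std.Refl (fun a c : L => (a : X) ∈ connHull univ s (c : X)) :=
      ⟨fun a => right_mem_connHull trivial⟩
    have : Nonempty c := hne.to_subtype
    obtain ⟨x, hx⟩ := IsCompact.nonempty_iInter_of_directed_nonempty_isCompact_isClosed
      (fun a : c => L ∩ {y | (a : X) ∈ connHull univ s y}) (by
        intro a a'
        rcases hc.total a.2 a'.2 with h | h
        · exact ⟨a', fun y hy => ⟨hy.1, connHull_trans h hy.2⟩, Subset.rfl⟩
        · exact ⟨a, Subset.rfl, fun y hy => ⟨hy.1, connHull_trans h hy.2⟩⟩)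
      (fun a => ⟨a, a.1.2, right_mem_connHull trivial⟩)
      (fun a => hL.inter_right ((isClosed_connHull_rel s).preimage
        (continuous_const.prodMk continuous_id)))
      (fun a => hL.isClosed.inter ((isClosed_connHull_rel s).preimage
        (continuous_const.prodMk continuous_id)))
    have hx' := mem_iInter.1 hx
    exact ⟨⟨x, (hx' ⟨_, hne.some_mem⟩).1⟩, fun a ha => (hx' ⟨a, ha⟩).2⟩
  obtain ⟨⟨x, hxC, hxE, hxs⟩, hmax⟩ := hmax
  by_cases hfix : g x = x
  · refine ⟨x, ?_, hxC, hfix⟩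
    by_contra hxE'
    obtain rfl := hE.eq_of_mem_closure hxE hxE'
    exact hxE' (hfix ▸ hgs)
  exfalso
  have hgxE : g x ∈ E := by
    by_contra h
    have hx2 := hxs.2 _ (subset_univ _) hE.isPreconnected_compl hE.notMem h
    obtain rfl := hE.eq_of_mem_closure hxE hx2
    exact h hgs
  have hgxE' := subset_closure hgxE
  obtain ⟨β, hβ, hβi, h0, h1, hβh⟩ := hE.arcwise.exists_arc (hE.closure_subset hxE)
    (hE.subset hgxE) (Ne.symm hfix)
  have hne : ∀ r ∈ Icc (0 : ℝ) 1, ∀ t ∈ Icc (0 : ℝ) 1, r ≠ t → β r ≠ β t :=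
    fun r hr t ht hrt h => hrt (hβi hr ht h)
  have hz1 : β (1 / 2) ≠ x := h0 ▸ hne _ (by norm_num) _ (by norm_num) (by norm_num)
  have hz2 : β (1 / 2) ≠ g x := h1 ▸ hne _ (by norm_num) _ (by norm_num) (by norm_num)
  have hz : β (1 / 2) ∈ connHull D x (g x) := by
    rw [← h1, ← h0, hβh 0 1 le_rfl zero_le_one le_rfl]
    exact mem_image_of_mem _ (by norm_num)
  obtain ⟨N, hNo, hNc, hxN, hN⟩ := exists_isPreconnected_nhds
    ((isOpen_compl_singleton.inter isOpen_compl_singleton).mem_nhds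
      (⟨hz2.symm, hfix⟩ : g x ∈ ({β (1 / 2)}ᶜ : Set X) ∩ {x}ᶜ))
  obtain ⟨t, ht0, ht1, htN⟩ : ∃ t, 0 < t ∧ t < (1 / 2 : ℝ) ∧ g (β t) ∈ N := by
    have : ∀ᶠ t in 𝓝[>] (0 : ℝ), g (β t) ∈ N :=
      nhdsWithin_le_nhds ((hg.comp hβ).continuousAt.preimage_mem_nhds
        (hNo.mem_nhds (by simpa [h0] using hxN)))
    obtain ⟨t, ht, ht'⟩ := (this.and (Ioo_mem_nhdsGT (by norm_num : (0 : ℝ) < 1 / 2))).exists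
    exact ⟨t, ht'.1, ht'.2, ht⟩
  have htI : t ∈ Icc (0 : ℝ) 1 := ⟨ht0.le, by linarith⟩
  have htx : β t ≠ x := h0 ▸ hne _ htI _ (by norm_num) ht0.ne'
  have htg : β t ≠ g x := h1 ▸ hne _ htI _ (by norm_num) (by linarith)
  have htz : β t ≠ β (1 / 2) := hne _ htI _ (by norm_num) (by linarith)
  have ht : β t ∈ connHull D x (g x) := by
    rw [← h1, ← h0, hβh 0 1 le_rfl zero_le_one le_rfl]
    exact mem_image_of_mem _ htI
  have hzE := hE.mem_of_mem_connHull hxE hgxE' hz hz1 hz2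
  have htE := hE.mem_of_mem_connHull hxE hgxE' ht htx htg
  have htT : β t ∈ closure C := (hE.mem_connHull_univ hxE hgxE' ht htx htg).2 _ (subset_univ _)
    hC.closure hxC (hT hxC)
  have hzI : β (1 / 2) ∈ connHull univ x (g (β t)) :=
    connHull_move hNc (subset_univ _) hxN htN (fun h => (hN h).1 rfl)
      (hE.mem_connHull_univ hxE hgxE' hz hz1 hz2)
  have htI' : β t ∈ connHull univ x (β (1 / 2)) := by
    refine hE.mem_connHull_univ hxE (subset_closure hzE) ?_ htx htz
    rw [← h0, hβh 0 (1 / 2) le_rfl (by norm_num) (by norm_num)]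
    exact mem_image_of_mem _ ⟨ht0.le, ht1.le⟩
  have hxI : x ∈ connHull univ s (g (β t)) :=
    connHull_move hNc (subset_univ _) hxN htN (fun h => (hN h).2 rfl) hxs
  have htL : β t ∈ L :=
    ⟨htT, subset_closure htE, connHull_trans_right hxI (connHull_trans htI' hzI)⟩
  have hxt : x ∈ connHull univ s (β t) := by
    refine connHull_move (isPreconnected_Icc.image β hβ.continuousOn (s := Icc t 1))
      (subset_univ _) ⟨1, ⟨htI.2, le_rfl⟩, h1⟩ ⟨t, ⟨le_rfl, htI.2⟩, rfl⟩ ?_ hxs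
    rintro ⟨r, hr, hrx⟩
    exact hne r ⟨ht0.le.trans hr.1, hr.2⟩ 0 (by norm_num) (by linarith [hr.1]) (hrx.trans h0.symm)
  have := hmax ⟨β t, htL⟩ hxt
  exact htx (hE.arcwise.connHull_antisymm (hE.closure_subset hsE)
    (connHull_subset_univ_restrict this (hE.subset htE))
    (connHull_subset_univ_restrict hxt (hE.closure_subset hxE)))

theorem IsEndBranch.not_mapsTo [PreconnectedSpace X] (hX : ∀ x : X, ∃ D ∈ 𝓝 x, UniquelyArcwise D)
    (hrec : PointwiseRecurrent g) (hg : Continuous g) (hE : IsEndBranch D E s)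
    (hC : IsPreconnected C) (hCp : Disjoint C (Function.periodicPts g)) (hgC : MapsTo g C C)
    {a c : X} (hsC : s ∈ C) (ha : a ∈ C) (hc : c ∈ C) (hsac : s ∈ connHull univ a c)
    (hsa : s ≠ a) (hsc : s ≠ c) : ¬ (E ∩ C).Nonempty := by
  rintro ⟨w, hwE, hwC⟩
  obtain ⟨_, hnE, n, rfl⟩ := mem_closure_iff.1
    (hrec.subset_closure_orbit hX hg hC hCp ha hc hsac hsa hsc hwC) E hE.isOpen hwE
  have hn : 0 < n := by
    rw [Nat.pos_iff_ne_zero]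
    rintro rfl
    exact hE.notMem hnE
  obtain ⟨q, hqE, hqC, hq⟩ := hE.exists_fixed (hg.iterate n) hC (hgC.iterate n) hsC hnE
  have hsE := hE.mem_closure ⟨_, hqE⟩
  have hqE' := subset_closure hqE
  have hsq : s ≠ q := fun h => hE.notMem (h ▸ hqE)
  obtain ⟨β, hβ, hβi, h0, h1, hβh⟩ := hE.arcwise.exists_arc (hE.closure_subset hsE)
    (hE.subset hqE) hsq
  have hne : ∀ r ∈ Icc (0 : ℝ) 1, ∀ t ∈ Icc (0 : ℝ) 1, r ≠ t → β r ≠ β t :=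
    fun r hr t ht hrt h => hrt (hβi hr ht h)
  have hqCc : IsPreconnected (insert q C) :=
    hC.subset_closure (subset_insert _ _) (insert_subset hqC subset_closure)
  have hmid : ∀ t, 0 < t → t < 1 → β t ∈ E ∧ β t ∈ C := by
    intro t ht0 ht1
    have ht : β t ∈ connHull D s q := by
      rw [← h0, ← h1, hβh 0 1 le_rfl zero_le_one le_rfl]
      exact mem_image_of_mem _ ⟨ht0.le, ht1.le⟩
    have hts : β t ≠ s := h0 ▸ hne _ ⟨ht0.le, ht1.le⟩ _ (by norm_num) ht0.ne'
    have htq : β t ≠ q := h1 ▸ hne _ ⟨ht0.le, ht1.le⟩ _ (by norm_num) ht1.ne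
    refine ⟨hE.mem_of_mem_connHull hsE hqE' ht hts htq, ?_⟩
    exact ((hE.mem_connHull_univ hsE hqE' ht hts htq).2 _ (subset_univ _) hqCc
      (Or.inr hsC) (Or.inl rfl)).resolve_left htq
  have hsep : ∀ r, 1 / 2 < r → r ≤ 1 → β (1 / 2) ∈ connHull univ s (β r) := by
    intro r hr hr1
    have hrE : β r ∈ E := by
      rcases hr1.eq_or_lt with rfl | hr1
      · rwa [h1]
      · exact (hmid r (by linarith) hr1).1
    refine hE.mem_connHull_univ hsE (subset_closure hrE) ?_ ?_ ?_
    · rw [← h0, hβh 0 r le_rfl (by linarith) hr1]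
      exact mem_image_of_mem _ ⟨by norm_num, hr.le⟩
    · exact h0 ▸ hne _ (by norm_num) _ (by norm_num) (by norm_num)
    · exact hne _ (by norm_num) _ ⟨by linarith, hr1⟩ hr.ne
  have hts : β (1 / 2) ≠ s := h0 ▸ hne _ (by norm_num) _ (by norm_num) (by norm_num)
  have hrec' := hrec.iterate hg hn
  have hcl := hrec'.subset_closure_orbit hX (hg.iterate n) hC (by rwa [periodicPts_iterate hn])
    hsC (hmid (3 / 4) (by norm_num) (by norm_num)).2
    (hsep (3 / 4) (by norm_num) (by norm_num)) hts
    (hne _ (by norm_num) _ (by norm_num) (by norm_num))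
  have hUo := (isOpen_compl_singleton (x := β (1 / 2))).connectedComponentIn (x := s)
  have hsU := mem_connectedComponentIn (F := {β (1 / 2)}ᶜ) hts.symm
  have hUf := frontier_connectedComponentIn_subset (isOpen_compl_singleton (x := β (1 / 2))) s
  rw [compl_compl] at hUf
  obtain ⟨_, htU, i, rfl⟩ := mem_closure_iff.1 (hcl hsC) _ hUo hsU
  obtain ⟨j, hj⟩ := hrec'.forall_exists_iterate_mem (hg.iterate n) hUo ⟨s, hsU⟩
    (fun t ht => ⟨i, by rw [(hUf ht : t = _)]; exact htU⟩) q
  rw [Function.iterate_fixed hq] at hj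
  have h := hsep 1 (by norm_num) le_rfl
  rw [h1] at h
  exact connectedComponentIn_subset _ _ (h.2 _ (subset_univ _)
    isPreconnected_connectedComponentIn hsU hj) rfl

end EndBranches

section EndBranches

variable {X : Type*} [MetricSpace X] [PreconnectedSpace X] [LocallyConnectedSpace X] {D E C : Set X} {b s u v : X} {f g : X → X}

/-- The core of the wandering case: a point `z` of a wandering component cannot be mapped to the far
side of `z'` from both fixed points `q₁` and `q₂` separated by `z`. -/
theorem IsEndBranch.notMem_connHull_of_wandering (hrec : PointwiseRecurrent f)
    (hf : Continuous f) (hE : IsEndBranch D E b) {n : ℕ}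
    (hw : ∀ x ∈ connectedComponentIn (Function.periodicPts f)ᶜ s,
      f^[n] x ∉ connectedComponentIn (Function.periodicPts f)ᶜ s)
    {q₁ q₂ z z' : X} (hq₁ : f^[n] q₁ = q₁) (hq₂ : f^[n] q₂ = q₂)
    (hz : z ∈ connectedComponentIn (Function.periodicPts f)ᶜ s)
    (hz' : z' ∈ connectedComponentIn (Function.periodicPts f)ᶜ s) (hzE : z ∈ E)
    (hzq₁ : q₁ ≠ z) (hzq₂ : q₂ ≠ z) (hsep : z ∈ connHull univ q₁ q₂)
    (h1 : z' ∈ connHull univ q₁ (f^[n] z)) : z' ∉ connHull univ q₂ (f^[n] z) := by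
  intro h2
  set C := connectedComponentIn (Function.periodicPts f)ᶜ s
  have hpre : ∀ {q : X}, q ≠ z → f^[n] q = q → z' ∈ connHull univ q (f^[n] z) →
      ∃ w ∈ connectedComponentIn {z}ᶜ q, f^[n] w = z' := by
    intro q hqz hq h
    have := h.2 (f^[n] '' insert z (connectedComponentIn {z}ᶜ q)) (subset_univ _)
      ((insert_connectedComponentIn_preconnected hqz).image _ (hf.iterate n).continuousOn)
      ⟨q, Or.inr (mem_connectedComponentIn hqz), hq⟩ (mem_image_of_mem _ (mem_insert _ _))
    obtain ⟨w, hwm | hwm, hwz⟩ := this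
    · rw [hwm] at hwz
      exact (hw z hz (hwz ▸ hz')).elim
    · exact ⟨w, hwm, hwz⟩
  obtain ⟨w₁, hw₁, hwz₁⟩ := hpre hzq₁ hq₁ h1
  obtain ⟨w₂, hw₂, hwz₂⟩ := hpre hzq₂ hq₂ h2
  have hz'p : z' ∉ Function.periodicPts f := connectedComponentIn_subset _ _ hz'
  have hzw : z ∈ connHull univ w₁ w₂ := by
    refine ⟨mem_univ _, fun M _ hM h1 h2 => ?_⟩
    by_contra hzM
    have hM' : M ⊆ ({z} : Set X)ᶜ := subset_compl_singleton_iff.2 hzM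
    have h3 := hM.subset_connectedComponentIn h1 hM' h2
    rw [← connectedComponentIn_eq hw₁] at h3
    have h4 : q₂ ∈ connectedComponentIn {z}ᶜ q₁ := by
      rw [connectedComponentIn_eq h3, ← connectedComponentIn_eq hw₂]
      exact mem_connectedComponentIn hzq₂
    exact connectedComponentIn_subset _ _ (hsep.2 _ (subset_univ _)
      isPreconnected_connectedComponentIn (mem_connectedComponentIn hzq₁) h4) rfl
  have key : ∀ w w', f^[n] w = z' → f^[n] w' = z' → w ∈ E → z ∈ connHull univ w w' → False := by
    intro w w' hwz hwz' hwE hzw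
    have hwp : w ∉ Function.periodicPts f := by
      rintro ⟨m, hm, hp⟩
      exact hz'p ⟨m, hm, hwz ▸ hp.apply_iterate n⟩
    obtain ⟨p, hp, hpp⟩ : (connHull D w z ∩ Function.periodicPts f).Nonempty := by
      by_contra h
      have hsub : connHull D w z ⊆ (Function.periodicPts f)ᶜ := fun p hp hpp => h ⟨p, hp, hpp⟩
      have := (hE.arcwise.isPreconnected_connHull (hE.subset hwE)
        (hE.subset hzE)).subset_connectedComponentIn (right_mem_connHull (hE.subset hzE)) hsub
        (left_mem_connHull (hE.subset hwE))
      rw [← connectedComponentIn_eq hz] at this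
      exact hw w this (hwz ▸ hz')
    have hpz : p ≠ z := by
      rintro rfl
      exact connectedComponentIn_subset _ _ hz hpp
    have hpw : p ≠ w := by
      rintro rfl
      exact hwp hpp
    have hp' := hE.mem_connHull_univ (subset_closure hwE) (subset_closure hzE) hp hpw hpz
    exact hrec.notMem_connHull hf isPreconnected_singleton (disjoint_singleton_left.2 hz'p)
      hwz hwz' hpp (connHull_trans hp' hzw)
  rcases hE.component_or_component hzE hzq₁ hzq₂ hsep with h | h
  · exact key w₁ w₂ hwz₁ hwz₂ (h.2 hw₁) hzw
  · exact key w₂ w₁ hwz₂ hwz₁ (h.2 hw₂) (by rwa [connHull_comm])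

/-- Every arc in an end branch contains a periodic point. -/
theorem IsEndBranch.connHull_inter_periodicPts_nonempty [CompactSpace X]
    [LocallyPathConnectedSpace X]
    (hX : ∀ x : X, ∃ D ∈ 𝓝 x, UniquelyArcwise D) (hrec : PointwiseRecurrent f)
    (hf : Continuous f) (hE : IsEndBranch D E b) (hu : u ∈ E) (hv : v ∈ E) (huv : u ≠ v) :
    (connHull D u v ∩ Function.periodicPts f).Nonempty := by
  by_contra hJ
  obtain ⟨α, hα, hαi, h0, h1, hαh⟩ := hE.arcwise.exists_arc (hE.subset hu) (hE.subset hv) huv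
  have hne : ∀ r ∈ Icc (0 : ℝ) 1, ∀ t ∈ Icc (0 : ℝ) 1, r ≠ t → α r ≠ α t :=
    fun r hr t ht hrt h => hrt (hαi hr ht h)
  have hJE := connHull_subset_of hE.subset hE.isPreconnected hu hv
  have hJα : connHull D u v = α '' Icc 0 1 := by
    rw [← hαh 0 1 le_rfl zero_le_one le_rfl, h0, h1]
  have hαE : ∀ t ∈ Icc (0 : ℝ) 1, α t ∈ E := fun t ht =>
    hJE (hJα ▸ mem_image_of_mem _ ht)
  have hJp : connHull D u v ⊆ (Function.periodicPts f)ᶜ := fun p hp hpp => hJ ⟨p, hp, hpp⟩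
  have hJC := (hE.arcwise.isPreconnected_connHull (hE.subset hu)
    (hE.subset hv)).subset_connectedComponentIn (left_mem_connHull (hE.subset hu)) hJp
  have hαC : ∀ t ∈ Icc (0 : ℝ) 1, α t ∈ connectedComponentIn (Function.periodicPts f)ᶜ u :=
    fun t ht => hJC (hJα ▸ mem_image_of_mem _ ht)
  have hCp : connectedComponentIn (Function.periodicPts f)ᶜ u ⊆ (Function.periodicPts f)ᶜ :=
    connectedComponentIn_subset _ _
  have hCc : IsPreconnected (connectedComponentIn (Function.periodicPts f)ᶜ u) :=
    isPreconnected_connectedComponentIn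
  by_cases hk : ∃ k > 0, ∃ c ∈ connectedComponentIn (Function.periodicPts f)ᶜ u,
      f^[k] c ∈ connectedComponentIn (Function.periodicPts f)ᶜ u
  · obtain ⟨k, hk, c, hc, hkc⟩ := hk
    have hmaps : MapsTo f^[k] (connectedComponentIn (Function.periodicPts f)ᶜ u)
        (connectedComponentIn (Function.periodicPts f)ᶜ u) := by
      have hsub : f^[k] '' connectedComponentIn (Function.periodicPts f)ᶜ u ⊆
          (Function.periodicPts f)ᶜ := by
        rintro _ ⟨y, hy, rfl⟩ hyp
        exact hCp hy (hrec.mem_periodicPts_of_iterate hyp)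
      have := (hCc.image _ (hf.iterate k).continuousOn).subset_connectedComponentIn
        (mem_image_of_mem _ hc) hsub
      rw [← connectedComponentIn_eq hkc] at this
      exact mapsTo_iff_image_subset.2 this
    have hsu : α (1 / 2) ≠ u := h0 ▸ hne _ (by norm_num) _ (by norm_num) (by norm_num)
    have hsv : α (1 / 2) ≠ v := h1 ▸ hne _ (by norm_num) _ (by norm_num) (by norm_num)
    have hsJ : α (1 / 2) ∈ connHull D u v := hJα ▸ mem_image_of_mem _ (by norm_num)
    have hsep := hE.mem_connHull_univ (subset_closure hu) (subset_closure hv) hsJ hsu hsv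
    have hCd : Disjoint (connectedComponentIn (Function.periodicPts f)ᶜ u)
        (Function.periodicPts f^[k]) := by
      rw [periodicPts_iterate hk]
      exact disjoint_left.2 fun y hy => hCp hy
    have huC := hJC (left_mem_connHull (hE.subset hu))
    have hvC := hJC (right_mem_connHull (hE.subset hv))
    rcases hE.component_or_component (hJE hsJ) hsu.symm hsv.symm hsep with h | h
    · exact h.1.not_mapsTo hX (hrec.iterate hf hk) (hf.iterate k) hCc hCd hmaps (hJC hsJ) huC hvC
        hsep hsu hsv ⟨u, mem_connectedComponentIn hsu.symm, huC⟩
    · exact h.1.not_mapsTo hX (hrec.iterate hf hk) (hf.iterate k) hCc hCd hmaps (hJC hsJ) huC hvC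
        hsep hsu hsv ⟨v, mem_connectedComponentIn hsv.symm, hvC⟩
  · push Not at hk
    have hdense : ∀ c ∈ connectedComponentIn (Function.periodicPts f)ᶜ u, ∀ N, IsOpen N →
        IsPreconnected N → c ∈ N → ∃ q ∈ N, q ∈ Function.periodicPts f := by
      intro c hc N hN hNc hcN
      by_contra! h
      have hNp : N ⊆ (Function.periodicPts f)ᶜ := h
      have hNC := hNc.subset_connectedComponentIn hcN hNp
      rw [← connectedComponentIn_eq hc] at hNC
      obtain ⟨n, hn, hnN⟩ := hrec c N (hN.mem_nhds hcN)
      exact hk n hn c hc (hNC hnN)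
    have hnhds : ∀ t ∈ Icc (0 : ℝ) 1, ∀ A ⊆ Icc (0 : ℝ) 1, IsClosed A → t ∉ A → ∃ N, IsOpen N ∧
        IsPreconnected N ∧ α t ∈ N ∧ N ⊆ E ∧ ∀ r ∈ A, α r ∉ N := by
      intro t ht A hA hAc htA
      have hcl : IsClosed (α '' A) := ((isCompact_Icc.of_isClosed_subset hAc hA).image hα).isClosed
      obtain ⟨N, hN, hNc, htN, hNs⟩ := exists_isPreconnected_nhds
        ((hE.isOpen.inter hcl.isOpen_compl).mem_nhds (⟨hαE t ht, by
          rintro ⟨r, hr, hrt⟩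
          exact htA (hαi (hA hr) ht hrt ▸ hr)⟩ : α t ∈ E ∩ (α '' A)ᶜ))
      exact ⟨N, hN, hNc, htN, fun y hy => (hNs hy).1,
        fun r hr hrN => (hNs hrN).2 (mem_image_of_mem _ hr)⟩
    have hmem : ∀ r s t, 0 ≤ r → r ≤ s → s ≤ t → t ≤ 1 → α s ∈ connHull D (α r) (α t) := by
      intro r s t hr hrs hst ht
      rw [hαh r t hr (hrs.trans hst) ht]
      exact mem_image_of_mem _ ⟨hrs, hst⟩
    obtain ⟨N₁, hN₁, hN₁c, h0N, hN₁E, hN₁A⟩ := hnhds 0 (by norm_num) (Icc (1 / 3) 1)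
      (Icc_subset_Icc_left (by norm_num)) isClosed_Icc (by norm_num)
    obtain ⟨N₂, hN₂, hN₂c, h1N, hN₂E, hN₂A⟩ := hnhds 1 (by norm_num) (Icc 0 (2 / 3))
      (Icc_subset_Icc_right (by norm_num)) isClosed_Icc (by norm_num)
    obtain ⟨q₁, hq₁N, hq₁⟩ := hdense _ (hαC 0 (by norm_num)) N₁ hN₁ hN₁c h0N
    obtain ⟨q₂, hq₂N, hq₂⟩ := hdense _ (hαC 1 (by norm_num)) N₂ hN₂ hN₂c h1N
    obtain ⟨k, hk0, hkf⟩ := exists_iterate_fix_of_finite (f := f) (F := {q₁, q₂})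
      ((finite_singleton _).insert _) (insert_subset hq₁ (singleton_subset_iff.2 hq₂))
    have hqz : ∀ t ∈ Icc (0 : ℝ) 1, ∀ q ∈ Function.periodicPts f, α t ≠ q :=
      fun t ht q hq h => hCp (hαC t ht) (h ▸ hq)
    obtain ⟨N, hN, hNc, hzN, hNE, hNA⟩ := hnhds (1 / 2) (by norm_num)
      (Icc 0 (2 / 5) ∪ Icc (3 / 5) 1)
      (union_subset (Icc_subset_Icc_right (by norm_num)) (Icc_subset_Icc_left (by norm_num)))
      (isClosed_Icc.union isClosed_Icc) (by norm_num)
    obtain ⟨n, hn, hnN⟩ := hrec.iterate hf hk0 (α (1 / 2)) N (hN.mem_nhds hzN)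
    rw [← Function.iterate_mul] at hnN
    have hfix : ∀ q ∈ ({q₁, q₂} : Set X), f^[k * n] q = q := fun q hq => by
      rw [Function.iterate_mul]
      exact Function.iterate_fixed (hkf q hq) n
    have hnC : f^[k * n] (α (1 / 2)) ∉ connectedComponentIn (Function.periodicPts f)ᶜ u :=
      hk _ (Nat.mul_pos hk0 hn) _ (hαC _ (by norm_num))
    have hqq : ∀ t, 1 / 3 ≤ t → t ≤ 2 / 3 → α t ∈ connHull univ q₁ q₂ := by
      intro t ht1 ht2
      have htI : t ∈ Icc (0 : ℝ) 1 := ⟨by linarith, by linarith⟩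
      refine hE.mem_connHull_univ (subset_closure (hN₁E hq₁N)) (subset_closure (hN₂E hq₂N)) ?_
        (hqz t htI _ hq₁) (hqz t htI _ hq₂)
      exact connHull_move_left hN₁c (hN₁E.trans hE.subset) h0N hq₁N (hN₁A t ⟨ht1, htI.2⟩)
        (connHull_move hN₂c (hN₂E.trans hE.subset) h1N hq₂N (hN₂A t ⟨htI.1, ht2⟩)
          (hmem 0 t 1 le_rfl htI.1 htI.2 le_rfl))
    have hm1 : α (2 / 5) ∈ connHull univ q₁ (f^[k * n] (α (1 / 2))) := by
      refine hE.mem_connHull_univ (subset_closure (hN₁E hq₁N)) (subset_closure (hNE hnN)) ?_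
        (hqz _ (by norm_num) _ hq₁) (fun h => hnC (h ▸ hαC _ (by norm_num)))
      exact connHull_move_left hN₁c (hN₁E.trans hE.subset) h0N hq₁N (hN₁A _ (by norm_num))
        (connHull_move hNc (hNE.trans hE.subset) hzN hnN (hNA _ (by norm_num))
          (hmem 0 (2 / 5) (1 / 2) le_rfl (by norm_num) (by norm_num) (by norm_num)))
    have hm2 : α (3 / 5) ∈ connHull univ q₂ (f^[k * n] (α (1 / 2))) := by
      refine hE.mem_connHull_univ (subset_closure (hN₂E hq₂N)) (subset_closure (hNE hnN)) ?_
        (hqz _ (by norm_num) _ hq₂) (fun h => hnC (h ▸ hαC _ (by norm_num)))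
      rw [connHull_comm]
      exact connHull_move hN₂c (hN₂E.trans hE.subset) h1N hq₂N (hN₂A _ (by norm_num))
        (connHull_move_left hNc (hNE.trans hE.subset) hzN hnN (hNA _ (by norm_num))
          (hmem (1 / 2) (3 / 5) 1 (by norm_num) (by norm_num) (by norm_num) le_rfl))
    have hcl : ∀ q y : X, IsClosed {t : ℝ | α t ∈ connHull univ q y} := fun q y =>
      (isClosed_connHull_rel q).preimage (hα.prodMk continuous_const)
    obtain ⟨t, ht, ht1, ht2⟩ := isPreconnected_closed_iff.1
      (isPreconnected_Icc (a := (2 / 5 : ℝ)) (b := 3 / 5))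
      _ _ (hcl q₁ (f^[k * n] (α (1 / 2)))) (hcl q₂ (f^[k * n] (α (1 / 2)))) (by
        intro t ht
        by_contra h
        simp only [mem_union, mem_ofPred_eq, not_or] at h
        obtain ⟨hn1, hn2⟩ := h
        have hex : ∀ q, α t ∉ connHull univ q (f^[k * n] (α (1 / 2))) → ∃ M, IsPreconnected M ∧
            q ∈ M ∧ f^[k * n] (α (1 / 2)) ∈ M ∧ α t ∉ M := by
          intro q hq
          by_contra! h
          exact hq ⟨mem_univ _, fun M _ hM h1 h2 => h M hM h1 h2⟩
        obtain ⟨M₁, hM₁, h1, h1', h1n⟩ := hex _ hn1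
        obtain ⟨M₂, hM₂, h2, h2', h2n⟩ := hex _ hn2
        exact ((hqq t (by linarith [ht.1]) (by linarith [ht.2])).2 (M₁ ∪ M₂) (subset_univ _)
          (hM₁.union _ h1' h2' hM₂) (Or.inl h1) (Or.inr h2)).elim h1n h2n)
      ⟨2 / 5, by norm_num, hm1⟩ ⟨3 / 5, by norm_num, hm2⟩
    have htI : t ∈ Icc (0 : ℝ) 1 := ⟨by linarith [ht.1], by linarith [ht.2]⟩
    refine hE.notMem_connHull_of_wandering hrec hf (s := u) (n := k * n) ?_ (hfix q₁ (by simp))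
      (hfix q₂ (by simp)) (hαC (1 / 2) (by norm_num)) (hαC t htI) (hαE _ (by norm_num))
      (hqz _ (by norm_num) _ hq₁).symm (hqz _ (by norm_num) _ hq₂).symm
      (hqq _ (by norm_num) (by norm_num)) ht1 ht2
    exact hk _ (Nat.mul_pos hk0 hn)

end EndBranches

section EndBranchComponents

variable {X : Type*} [MetricSpace X] [PreconnectedSpace X] [LocallyConnectedSpace X]
  {D V : Set X} {u v : X}

/-- A component of the complement of an arc that stays in a small region is an end branch. -/
theorem UniquelyArcwise.isEndBranch_component (hD : UniquelyArcwise D)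
    (hVD : closure V ⊆ interior D) (hu : u ∈ V) (hv : v ∈ V) (hJV : connHull D u v ⊆ V) {x : X}
    (hx : x ∉ connHull D u v) (hxV : connectedComponentIn (connHull D u v)ᶜ x ⊆ V) :
    ∃ b ∈ connHull D u v, IsEndBranch D (connectedComponentIn (connHull D u v)ᶜ x) b := by
  have hVD' : V ⊆ interior D := subset_closure.trans hVD
  have huD := interior_subset (hVD' hu)
  have hvD := interior_subset (hVD' hv)
  have hJc := (hD.isCompact_connHull huD hvD).isClosed
  have hf := frontier_connectedComponentIn_subset hJc.isOpen_compl x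
  have hEo := hJc.isOpen_compl.connectedComponentIn (x := x)
  have hxE := mem_connectedComponentIn (F := (connHull D u v)ᶜ) hx
  have hEJ := connectedComponentIn_subset (connHull D u v)ᶜ x
  rw [compl_compl] at hf
  have huE : u ∉ connectedComponentIn (connHull D u v)ᶜ x := fun h =>
    hEJ h (left_mem_connHull huD)
  have hEc : IsPreconnected (connectedComponentIn (connHull D u v)ᶜ x) :=
    isPreconnected_connectedComponentIn
  set E := connectedComponentIn (connHull D u v)ᶜ x
  obtain ⟨b, hb⟩ : (frontier E).Nonempty := by
    rw [nonempty_iff_ne_empty]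
    intro h
    exact huE (isPreconnected_univ.subset_of_disjoint_frontier hEo ⟨x, mem_univ _, hxE⟩
      (by simp [h]) (mem_univ u))
  refine ⟨b, hf hb, hD, hEo, hEc, fun h => hEJ h (hf hb), fun b' hb' => ?_,
    (closure_mono hxV).trans (hVD.trans interior_subset)⟩
  by_contra hne
  have hbi := hVD' (hJV (hf hb))
  have hbi' := hVD' (hJV (hf hb'))
  obtain ⟨c, hc, hcb', hcb⟩ := hD.exists_between (interior_subset hbi') (interior_subset hbi) hne
  have hcE : c ∈ E := UniquelyArcwise.mem_of_mem_connHull_closure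
    (fun y hy y' hy' => connHull_subset_of ((hxV.trans hVD').trans interior_subset) hEc hy hy')
    hbi' hbi (frontier_subset_closure hb') (frontier_subset_closure hb) hc hcb' hcb
  exact hEJ hcE (connHull_subset_of connHull_subset (hD.isPreconnected_connHull huD hvD)
    (hf hb') (hf hb) hc)

end EndBranchComponents

section NonperiodicArcs

variable {X : Type*} [MetricSpace X] [CompactSpace X] [PreconnectedSpace X]
  [LocallyConnectedSpace X] [LocallyPathConnectedSpace X] {D E V J : Set X} {b s u v : X}
  {f g : X → X}

theorem IsEndBranch.exists_periodicPt_between (hX : ∀ x : X, ∃ D ∈ 𝓝 x, UniquelyArcwise D)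
    (hrec : PointwiseRecurrent f) (hf : Continuous f) (hE : IsEndBranch D E b)
    (hu : u ∈ closure E) (hv : v ∈ closure E) (huv : u ≠ v) :
    ∃ q ∈ Function.periodicPts f, q ∈ E ∧ q ≠ u ∧ q ≠ v ∧ q ∈ connHull univ u v := by
  obtain ⟨α, hα, hαi, h0, h1, hαh⟩ := hE.arcwise.exists_arc (hE.closure_subset hu)
    (hE.closure_subset hv) huv
  have hne : ∀ r ∈ Icc (0 : ℝ) 1, ∀ t ∈ Icc (0 : ℝ) 1, r ≠ t → α r ≠ α t :=
    fun r hr t ht hrt h => hrt (hαi hr ht h)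
  have hm : ∀ t, 0 < t → t < 1 → α t ∈ connHull D u v ∧ α t ≠ u ∧ α t ≠ v := by
    intro t ht0 ht1
    have htI : t ∈ Icc (0 : ℝ) 1 := ⟨ht0.le, ht1.le⟩
    refine ⟨?_, h0 ▸ hne _ htI _ (by norm_num) ht0.ne', h1 ▸ hne _ htI _ (by norm_num) ht1.ne⟩
    rw [← h0, ← h1, hαh 0 1 le_rfl zero_le_one le_rfl]
    exact mem_image_of_mem _ htI
  have hmE : ∀ t, 0 < t → t < 1 → α t ∈ E := fun t ht0 ht1 =>
    hE.mem_of_mem_connHull hu hv (hm t ht0 ht1).1 (hm t ht0 ht1).2.1 (hm t ht0 ht1).2.2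
  obtain ⟨q, hq, hqp⟩ := hE.connHull_inter_periodicPts_nonempty hX hrec hf
    (hmE (1 / 3) (by norm_num) (by norm_num)) (hmE (2 / 3) (by norm_num) (by norm_num))
    (hne _ (by norm_num) _ (by norm_num) (by norm_num))
  rw [hαh _ _ (by norm_num) (by norm_num) (by norm_num)] at hq
  obtain ⟨t, ht, rfl⟩ := hq
  have ht0 : 0 < t := by linarith [ht.1]
  have ht1 : t < 1 := by linarith [ht.2]
  obtain ⟨h2, h3, h4⟩ := hm t ht0 ht1
  exact ⟨_, hqp, hmE t ht0 ht1, h3, h4, hE.mem_connHull_univ hu hv h2 h3 h4⟩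

/-- A nontrivial connected set of nonperiodic points never enters an end branch. -/
theorem IsEndBranch.iterate_notMem (hX : ∀ x : X, ∃ D ∈ 𝓝 x, UniquelyArcwise D)
    (hrec : PointwiseRecurrent f) (hf : Continuous f) (hE : IsEndBranch D E b)
    (hJ : IsPreconnected J) (hJp : Disjoint J (Function.periodicPts f))
    (hJn : J.Nontrivial) {y : X} (hy : y ∈ J) (n : ℕ) : f^[n] y ∉ E := by
  intro hc
  have hbE := hE.mem_closure ⟨_, hc⟩
  obtain ⟨q, hq, hqE, hqc, hqb, hqs⟩ := hE.exists_periodicPt_between hX hrec hf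
    (subset_closure hc) hbE (fun h => hE.notMem (h ▸ hc))
  obtain ⟨F, hF, hinv, hqF, hFp⟩ := exists_finite_mapsTo_of_mem_periodicPts hq
  have hJF : J ⊆ Fᶜ := fun z hz hzF => disjoint_left.1 hJp hz (hFp hzF)
  have hFi : ∀ {z : X} {m : ℕ}, z ∈ Fᶜ → f^[m] z ∈ Fᶜ := fun hz hzF =>
    hz (hrec.mem_of_iterate_mem hF.isClosed hinv hzF)
  have hcF : f^[n] y ∈ Fᶜ := hFi (hJF hy)
  have hJP := hJ.subset_connectedComponentIn hy hJF
  obtain ⟨k, hk, hkP⟩ := hrec.exists_mapsTo_component hf hF.isClosed hinv y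
  have hPf := frontier_connectedComponentIn_subset hF.isClosed.isOpen_compl y
  have hPF := connectedComponentIn_subset Fᶜ y
  have hPE : MapsTo f^[n] (connectedComponentIn Fᶜ y) E := by
    have h1 : f^[n] '' connectedComponentIn Fᶜ y ⊆ connectedComponentIn Fᶜ (f^[n] y) := by
      refine (isPreconnected_connectedComponentIn.image _
        (hf.iterate n).continuousOn).subset_connectedComponentIn
        (mem_image_of_mem _ (hJP hy)) ?_
      rintro _ ⟨z, hz, rfl⟩
      exact hFi (hPF hz)
    refine mapsTo_iff_image_subset.2 (h1.trans ?_)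
    refine isPreconnected_connectedComponentIn.subset_of_disjoint_frontier hE.isOpen
      ⟨_, mem_connectedComponentIn hcF, hc⟩ fun z hz hzf => ?_
    obtain rfl := hE.frontier_subset hzf
    exact connectedComponentIn_subset _ _ (hqs.2 _ (subset_univ _)
      isPreconnected_connectedComponentIn (mem_connectedComponentIn hcF) hz) hqF
  set P := connectedComponentIn Fᶜ y
  have hm : MapsTo f^[k * (n + 1)] P P := by
    rw [Function.iterate_mul]
    exact hkP.iterate _
  have hmn : n ≤ k * (n + 1) := by nlinarith
  have hm0 : 0 < k * (n + 1) := Nat.mul_pos hk n.succ_pos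
  generalize k * (n + 1) = m at *
  have hpre : ∀ a ∈ J, ∃ w ∈ E, f^[m - n] w = a := by
    intro a ha
    obtain ⟨p, rfl⟩ := (hrec.surjective hf).iterate m a
    have hpc : p ∈ closure P := (hrec.iterate hf hm0).mem_of_iterate_mem (n := 1)
      isClosed_closure (hm.closure (hf.iterate m)) (subset_closure (hJP ha))
    have hpP : p ∈ P := by
      by_contra hpP
      have hpF : p ∈ F := not_not.1 (hPf
        (hF.isClosed.isOpen_compl.connectedComponentIn.frontier_eq ▸ ⟨hpc, hpP⟩))
      exact hJF ha (hinv.iterate m hpF)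
    refine ⟨_, hPE hpP, ?_⟩
    rw [← Function.iterate_add_apply, Nat.sub_add_cancel hmn]
  obtain ⟨a, ha, a', ha', haa⟩ := hJn
  obtain ⟨w, hw, rfl⟩ := hpre a ha
  obtain ⟨w', hw', rfl⟩ := hpre a' ha'
  obtain ⟨q', hq', -, -, -, hqs'⟩ := hE.exists_periodicPt_between hX hrec hf
    (subset_closure hw) (subset_closure hw') (fun h => haa (by rw [h]))
  exact hrec.notMem_connHull hf hJ hJp ha ha' hq' hqs'

/-- An arc of nonperiodic points has only finitely many points which are not interior to it. -/
theorem UniquelyArcwise.finite_connHull_diff_interior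
    (hX : ∀ x : X, ∃ D ∈ 𝓝 x, UniquelyArcwise D) (hrec : PointwiseRecurrent f)
    (hf : Continuous f) (hD : UniquelyArcwise D) (hV : IsOpen V) (hVc : IsPreconnected V)
    (hVD : closure V ⊆ interior D) (hVf : (frontier V).Finite) (hu : u ∈ V) (hv : v ∈ V)
    (huv : u ≠ v) (hJp : Disjoint (connHull D u v) (Function.periodicPts f)) :
    (connHull D u v \ interior (connHull D u v)).Finite := by
  have hVi : V ⊆ interior D := subset_closure.trans hVD
  have hVD' : V ⊆ D := hVi.trans interior_subset
  have hJV := connHull_subset_of hVD' hVc hu hv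
  have hJpre := hD.isPreconnected_connHull (hVD' hu) (hVD' hv)
  have hJc := (hD.isCompact_connHull (hVD' hu) (hVD' hv)).isClosed
  have hJn : (connHull D u v).Nontrivial :=
    ⟨u, left_mem_connHull (hVD' hu), v, right_mem_connHull (hVD' hv), huv⟩
  have hsub : ∀ {y y'}, y ∈ connHull D u v → y' ∈ connHull D u v →
      connHull D y y' ⊆ connHull D u v := fun hy hy' =>
    connHull_subset_of connHull_subset hJpre hy hy'
  set J := connHull D u v with hJdef
  have hnoE : ∀ x ∉ J, ¬ connectedComponentIn Jᶜ x ⊆ V := by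
    intro x hxJ hxV
    obtain ⟨b, hbJ, hE⟩ := hD.isEndBranch_component hVD hu hv hJV hxJ hxV
    rw [← hJdef] at hE
    have hxE := mem_connectedComponentIn (F := Jᶜ) hxJ
    set E := connectedComponentIn Jᶜ x
    set W : Set X := ⋃ n, f^[n] '' J
    have hWinv : MapsTo f W W := by
      intro z hz
      obtain ⟨n, y, hy, rfl⟩ := mem_iUnion.1 hz
      exact mem_iUnion.2 ⟨n + 1, y, hy, Function.iterate_succ_apply' f n y⟩
    have hWE : Disjoint W E := by
      rw [disjoint_left]
      intro z hz
      obtain ⟨n, y, hy, rfl⟩ := mem_iUnion.1 hz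
      exact hE.iterate_notMem hX hrec hf hJpre hJp hJn hy n
    have hEW : Disjoint E (closure W) := (hWE.closure_left hE.isOpen).symm
    have hbW : b ∈ closure W := subset_closure (mem_iUnion.2 ⟨0, b, hbJ, rfl⟩)
    obtain ⟨k, hk, hkE⟩ := hrec.exists_mapsTo hf isClosed_closure (hWinv.closure hf) hE.isOpen
      hE.isPreconnected hEW (hE.frontier_subset.trans (singleton_subset_iff.2 hbW))
    have hbcl := hkE.closure (hf.iterate k) (hE.mem_closure ⟨x, hxE⟩)
    have hbk : f^[k] b = b := hE.eq_of_mem_closure hbcl fun h =>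
      disjoint_left.1 hEW h ((hWinv.closure hf).iterate k hbW)
    exact disjoint_left.1 hJp hbJ ⟨k, hk, hbk⟩
  let P : X → Set X := fun w => {x | x ∈ D ∧ connHull D x w ⊆ Jᶜ}
  have hP : ∀ w ∈ frontier V, (J ∩ closure (P w)).Subsingleton := by
    rintro w hw a ⟨haJ, haP⟩ a' ⟨haJ', haP'⟩
    by_contra hne
    have hwD : w ∈ D := interior_subset (hVD (frontier_subset_closure hw))
    obtain ⟨c, hc, hca, hca'⟩ := hD.exists_between (connHull_subset haJ) (connHull_subset haJ') hne
    refine UniquelyArcwise.mem_of_mem_connHull_closure (Q := Jᶜ) (P := P w) ?_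
      (hVi (hJV haJ)) (hVi (hJV haJ')) haP haP' hc hca hca' (hsub haJ haJ' hc)
    intro y hy y' hy'
    refine (connHull_subset_of (union_subset connHull_subset connHull_subset)
      ((hD.isPreconnected_connHull hy.1 hwD).union w (right_mem_connHull hwD)
        (right_mem_connHull hwD) (hD.isPreconnected_connHull hy'.1 hwD))
      (Or.inl (left_mem_connHull hy.1)) (Or.inr (left_mem_connHull hy'.1))).trans ?_
    exact union_subset hy.2 hy'.2
  refine (hVf.biUnion fun w hw => (hP w hw).finite).subset ?_
  rintro y ⟨hyJ, hyi⟩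
  have hy : y ∈ closure (⋃ w ∈ frontier V, P w) := by
    rw [mem_closure_iff_nhds]
    intro O hO
    obtain ⟨x, ⟨hxO, hxV⟩, hxJ⟩ : ((O ∩ V) \ J).Nonempty := by
      rw [nonempty_iff_ne_empty, Ne, sdiff_eq_empty]
      intro h
      exact hyi (mem_interior_iff_mem_nhds.2
        (mem_of_superset (inter_mem hO (hV.mem_nhds (hJV hyJ))) h))
    obtain ⟨w, hw, -, hwQ⟩ := exists_connHull_to_frontier hJc.isOpen_compl.connectedComponentIn
      isPreconnected_connectedComponentIn hV (hVD.trans interior_subset)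
      (mem_connectedComponentIn (F := Jᶜ) hxJ) hxV (hnoE x hxJ)
    exact ⟨x, hxO, mem_iUnion₂.2
      ⟨w, hw, hVD' hxV, hwQ.trans (connectedComponentIn_subset _ _)⟩⟩
  rw [hVf.closure_biUnion] at hy
  obtain ⟨w, hw, hyw⟩ := mem_iUnion₂.1 hy
  exact mem_iUnion₂.2 ⟨w, hw, hyJ, hyw⟩

end NonperiodicArcs

section FreeArcs

variable {X : Type*} [MetricSpace X]

/-- An injective path whose interior is open in the ambient space. -/
structure IsFreeArc (α : ℝ → X) : Prop where
  continuous : Continuous α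
  injOn : InjOn α (Icc 0 1)
  isOpen : IsOpen (α '' Ioo 0 1)

namespace IsFreeArc

variable {α : ℝ → X} {a b : ℝ}

theorem isOpen_image_Ioo (hα : IsFreeArc α) (ha : 0 ≤ a) (hb : b ≤ 1) :
    IsOpen (α '' Ioo a b) := by
  have : α '' Ioo a b = α '' Ioo 0 1 \ (α '' Icc 0 a ∪ α '' Icc b 1) := by
    ext y
    constructor
    · rintro ⟨t, ht, rfl⟩
      have ht' : t ∈ Icc (0 : ℝ) 1 := ⟨by linarith [ht.1], by linarith [ht.2]⟩
      refine ⟨⟨t, ⟨by linarith [ht.1], by linarith [ht.2]⟩, rfl⟩, ?_⟩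
      rintro (⟨s, hs, hst⟩ | ⟨s, hs, hst⟩)
      · have := hα.injOn ⟨hs.1, by linarith [hs.2, ht.1, ht.2]⟩ ht' hst
        linarith [hs.2, ht.1]
      · have := hα.injOn ⟨by linarith [hs.1, ht.1, ht.2], hs.2⟩ ht' hst
        linarith [hs.1, ht.2]
    · rintro ⟨⟨t, ht, rfl⟩, h⟩
      refine ⟨t, ⟨?_, ?_⟩, rfl⟩
      · by_contra hta
        exact h (Or.inl ⟨t, ⟨ht.1.le, not_lt.1 hta⟩, rfl⟩)
      · by_contra hta
        exact h (Or.inr ⟨t, ⟨not_lt.1 hta, ht.2.le⟩, rfl⟩)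
  rw [this]
  exact hα.isOpen.sdiff ((isCompact_Icc.image hα.continuous).union
    (isCompact_Icc.image hα.continuous)).isClosed

theorem closure_image_Ioo_subset (hα : IsFreeArc α) : closure (α '' Ioo a b) ⊆ α '' Icc a b :=
  closure_minimal (image_mono Ioo_subset_Icc_self) (isCompact_Icc.image hα.continuous).isClosed

theorem frontier_image_Ioo_subset (hα : IsFreeArc α) (ha : 0 ≤ a) (hb : b ≤ 1) :
    frontier (α '' Ioo a b) ⊆ {α a, α b} := by
  rw [(hα.isOpen_image_Ioo ha hb).frontier_eq]
  rintro y ⟨hy, hy'⟩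
  obtain ⟨t, ht, rfl⟩ := hα.closure_image_Ioo_subset hy
  rcases ht.1.eq_or_lt with h | h
  · exact Or.inl (h ▸ rfl)
  rcases ht.2.eq_or_lt with h' | h'
  · exact Or.inr (h' ▸ rfl)
  exact (hy' ⟨t, ⟨h, h'⟩, rfl⟩).elim

theorem image_Icc_subset_of_isPreconnected (hα : IsFreeArc α) {C : Set X} (hC : IsPreconnected C)
    (hCα : C ⊆ α '' Ioo 0 1) (ha : 0 ≤ a) (hb : b ≤ 1) (haC : α a ∈ C) (hbC : α b ∈ C) :
    α '' Icc a b ⊆ C := by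
  rintro _ ⟨t, ht, rfl⟩
  by_contra htC
  have hta : a < t := lt_of_le_of_ne ht.1 (by rintro rfl; exact htC haC)
  have htb : t < b := lt_of_le_of_ne ht.2 (by rintro rfl; exact htC hbC)
  have ha' : 0 < a := by
    obtain ⟨s, hs, hsa⟩ := hCα haC
    rw [← hα.injOn (Ioo_subset_Icc_self hs) ⟨ha, by linarith⟩ hsa]
    exact hs.1
  have hsub : C ⊆ α '' Ioo 0 t := by
    refine hC.subset_left_of_subset_union (hα.isOpen_image_Ioo le_rfl (by linarith))
      (hα.isOpen_image_Ioo (a := t) (b := 1) (by linarith) le_rfl) ?_ ?_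
      ⟨_, haC, mem_image_of_mem _ ⟨ha', hta⟩⟩
    · rw [disjoint_left]
      rintro _ ⟨r, hr, rfl⟩ ⟨s, hs, hsr⟩
      have := hα.injOn ⟨by linarith [hs.1], hs.2.le⟩ ⟨hr.1.le, by linarith [hr.2]⟩ hsr
      linarith [hs.1, hr.2]
    · intro y hy
      obtain ⟨s, hs, rfl⟩ := hCα hy
      rcases lt_trichotomy s t with h | rfl | h
      · exact Or.inl ⟨s, ⟨hs.1, h⟩, rfl⟩
      · exact (htC hy).elim
      · exact Or.inr ⟨s, ⟨h, hs.2⟩, rfl⟩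
  obtain ⟨s, hs, hsb⟩ := hsub hbC
  have := hα.injOn ⟨hs.1.le, by linarith [hs.2]⟩ ⟨by linarith, hb⟩ hsb
  linarith [hs.2]

end IsFreeArc

end FreeArcs

section Minimality

variable {X : Type*} [MetricSpace X] [CompactSpace X]

theorem eq_univ_of_image_eq_univ {f : X → X} (hf : Continuous f)
    (hmin : ∀ K : Set X, IsClosed K → K.Nonempty → MapsTo f K K → K = univ) {C : Set X}
    (hC : IsClosed C) (hfC : f '' C = univ) : C = univ := by
  rcases isEmpty_or_nonempty X with h | ⟨⟨x⟩⟩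
  · exact Subsingleton.elim _ _
  have hg : ∀ x, ∃ y ∈ C, f y = x := fun x => by
    have : x ∈ f '' C := hfC ▸ mem_univ x
    exact this
  choose g hgC hg using hg
  let L : Set X := ⋂ n : ℕ, closure ((fun k => g^[k + 1] x) '' Ici n)
  have hLC : L ⊆ C := (iInter_subset _ 0).trans (closure_minimal (by
    rintro _ ⟨k, -, rfl⟩
    simp only [Function.iterate_succ_apply']
    exact hgC _) hC)
  have hL : L = univ := by
    refine hmin L (isClosed_iInter fun _ => isClosed_closure) ?_ ?_
    · refine IsCompact.nonempty_iInter_of_sequence_nonempty_isCompact_isClosed _ (fun n => ?_)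
        (fun n => ?_) isClosed_closure.isCompact fun _ => isClosed_closure
      · exact closure_mono (image_mono (Ici_subset_Ici.2 n.le_succ))
      · exact (nonempty_Ici.image _).closure
    · intro y hy
      refine mem_iInter.2 fun n => ?_
      have := mem_iInter.1 hy (n + 1)
      refine closure_mono ?_ (image_closure_subset_closure_image hf (mem_image_of_mem f this))
      rintro _ ⟨_, ⟨k, hk, rfl⟩, rfl⟩
      obtain ⟨j, rfl⟩ : ∃ j, k = j + 1 := ⟨k - 1, by simp at hk; omega⟩
      refine ⟨j, by simpa using hk, ?_⟩
      simp only [Function.iterate_succ_apply', hg]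
  exact univ_subset_iff.1 (hL ▸ hLC)

theorem eq_univ_of_image_iterate_eq_univ {f : X → X} (hf : Continuous f)
    (hmin : ∀ K : Set X, IsClosed K → K.Nonempty → MapsTo f K K → K = univ) (n : ℕ) {C : Set X}
    (hC : IsClosed C) (hfC : f^[n] '' C = univ) : C = univ := by
  induction n generalizing C with
  | zero => simpa using hfC
  | succ n ih =>
    rw [Function.iterate_succ, image_comp] at hfC
    exact eq_univ_of_image_eq_univ hf hmin hC (ih (hC.isCompact.image hf).isClosed hfC)

theorem not_image_iterate_subset_image_compl {f : X → X} (hf : Continuous f)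
    (hs : Function.Surjective f)
    (hmin : ∀ K : Set X, IsClosed K → K.Nonempty → MapsTo f K K → K = univ) (n : ℕ) {G : Set X}
    (hG : IsOpen G) (hne : G.Nonempty) : ¬ f^[n] '' G ⊆ f^[n] '' Gᶜ := by
  intro h
  have := eq_univ_of_image_iterate_eq_univ hf hmin n hG.isClosed_compl (univ_subset_iff.1 ?_)
  · obtain ⟨x, hx⟩ := hne
    exact (this ▸ mem_univ x : x ∈ Gᶜ) hx
  · rw [← (hs.iterate n).range_eq, ← image_univ, ← union_compl_self G, image_union]
    exact union_subset h le_rfl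

/-- Under a minimal map, a point of a free arc has at most two preimages. -/
theorem IsFreeArc.not_three_preimages [LocallyConnectedSpace X] {α : ℝ → X} (hα : IsFreeArc α)
    {f : X → X} (hf : Continuous f) (hs : Function.Surjective f)
    (hmin : ∀ K : Set X, IsClosed K → K.Nonempty → MapsTo f K K → K = univ) {n : ℕ} {t : ℝ}
    (ht : t ∈ Ioo (0 : ℝ) 1) {x y z : X} (hx : f^[n] x = α t) (hy : f^[n] y = α t)
    (hz : f^[n] z = α t) (hxy : x ≠ y) (hxz : x ≠ z) (hyz : y ≠ z) : False := by
  have hirr := fun G => not_image_iterate_subset_image_compl hf hs hmin n (G := G)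
  have hpre : IsOpen (f^[n] ⁻¹' (α '' Ioo 0 1)) := hα.isOpen.preimage (hf.iterate n)
  have hloc : ∀ c w, c ≠ w → f^[n] c = α t → f^[n] w = α t → ∀ O, IsOpen O → c ∈ O → w ∉ O →
      ∃ W ⊆ O, IsOpen W ∧ ∃ r ∈ Ioo (0 : ℝ) 1, r ≠ t ∧
        α '' Icc t r ⊆ f^[n] '' W ∧ α '' Icc r t ⊆ f^[n] '' W := by
    intro c w hcw hc hw O hO hcO hwO
    obtain ⟨W, hWo, hWc, hcW, hW⟩ := exists_isPreconnected_nhds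
      ((hO.inter hpre).mem_nhds ⟨hcO, by rw [mem_preimage, hc]; exact ⟨t, ht, rfl⟩⟩)
    have hWα : f^[n] '' W ⊆ α '' Ioo 0 1 := image_subset_iff.2 (hW.trans inter_subset_right)
    have hpW : α t ∈ f^[n] '' W := ⟨c, hcW, hc⟩
    obtain ⟨y, hyW, hy⟩ : ∃ y ∈ W, f^[n] y ≠ α t := by
      by_contra! h
      refine hirr W hWo ⟨c, hcW⟩ ?_
      rintro _ ⟨y, hy, rfl⟩
      exact ⟨w, fun hwW => hwO (hW hwW).1, hw.trans (h y hy).symm⟩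
    obtain ⟨r, hr, hry⟩ := hWα ⟨y, hyW, rfl⟩
    have hrW : α r ∈ f^[n] '' W := ⟨y, hyW, hry.symm⟩
    have hpc := hWc.image _ (hf.iterate n).continuousOn
    refine ⟨W, hW.trans inter_subset_left, hWo, r, hr, fun h => hy (by rw [← hry, h]), ?_, ?_⟩
    · exact hα.image_Icc_subset_of_isPreconnected hpc hWα ht.1.le hr.2.le hpW hrW
    · exact hα.image_Icc_subset_of_isPreconnected hpc hWα hr.1.le ht.2.le hrW hpW
  have hpair : ∀ {W W' : Set X} {a b : ℝ}, IsOpen W → Disjoint W W' → 0 ≤ a → a < b → b ≤ 1 →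
      α '' Icc a b ⊆ f^[n] '' W → α '' Icc a b ⊆ f^[n] '' W' → False := by
    intro W W' a b hW hd ha hab hb h h'
    refine hirr (W ∩ f^[n] ⁻¹' (α '' Ioo a b))
      (hW.inter ((hα.isOpen_image_Ioo ha hb).preimage (hf.iterate n))) ?_ ?_
    · obtain ⟨y, hy, hyr⟩ := h ⟨(a + b) / 2, ⟨by linarith, by linarith⟩, rfl⟩
      exact ⟨y, hy, (a + b) / 2, ⟨by linarith, by linarith⟩, hyr.symm⟩
    · rintro _ ⟨y, ⟨-, s, hs, hsy⟩, rfl⟩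
      obtain ⟨y', hy', h''⟩ := h' ⟨s, Ioo_subset_Icc_self hs, rfl⟩
      exact ⟨y', fun hy => disjoint_left.1 hd hy.1 hy', h''.trans hsy⟩
  have hpair2 : ∀ {W W' : Set X} {r r' : ℝ}, IsOpen W → Disjoint W W' →
      r ∈ Ioo (0 : ℝ) 1 → r' ∈ Ioo (0 : ℝ) 1 →
      (t < r ∧ t < r' ∨ r < t ∧ r' < t) →
      α '' Icc t r ⊆ f^[n] '' W → α '' Icc r t ⊆ f^[n] '' W →
      α '' Icc t r' ⊆ f^[n] '' W' → α '' Icc r' t ⊆ f^[n] '' W' → False := by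
    intro W W' r r' hW hd hr hr' h h1 h2 h3 h4
    rcases h with ⟨h, h'⟩ | ⟨h, h'⟩
    · exact hpair hW hd ht.1.le (lt_min h h') ((min_le_left _ _).trans hr.2.le)
        ((image_mono (Icc_subset_Icc_right (min_le_left _ _))).trans h1)
        ((image_mono (Icc_subset_Icc_right (min_le_right _ _))).trans h3)
    · exact hpair hW hd (hr.1.le.trans (le_max_left _ _)) (max_lt h h') ht.2.le
        ((image_mono (Icc_subset_Icc_left (le_max_left _ _))).trans h2)
        ((image_mono (Icc_subset_Icc_left (le_max_right _ _))).trans h4)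
  obtain ⟨U, U', hU, hU', hxU, hyU', hUU'⟩ := t2_separation hxy
  obtain ⟨P, P', hP, hP', hxP, hzP', hPP'⟩ := t2_separation hxz
  obtain ⟨Q, Q', hQ, hQ', hyQ, hzQ', hQQ'⟩ := t2_separation hyz
  obtain ⟨W₁, hW₁, hWo₁, r₁, hr₁, hrt₁, h₁, h₁'⟩ := hloc x y hxy hx hy (U ∩ P) (hU.inter hP)
    ⟨hxU, hxP⟩ fun h => disjoint_left.1 hUU' h.1 hyU'
  obtain ⟨W₂, hW₂, hWo₂, r₂, hr₂, hrt₂, h₂, h₂'⟩ := hloc y x hxy.symm hy hx (U' ∩ Q)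
    (hU'.inter hQ) ⟨hyU', hyQ⟩ fun h => disjoint_left.1 hUU' hxU h.1
  obtain ⟨W₃, hW₃, hWo₃, r₃, hr₃, hrt₃, h₃, h₃'⟩ := hloc z x hxz.symm hz hx (P' ∩ Q')
    (hP'.inter hQ') ⟨hzP', hzQ'⟩ fun h => disjoint_left.1 hPP' hxP h.1
  have d₁₂ : Disjoint W₁ W₂ := hUU'.mono (hW₁.trans inter_subset_left) (hW₂.trans inter_subset_left)
  have d₁₃ : Disjoint W₁ W₃ :=
    hPP'.mono (hW₁.trans inter_subset_right) (hW₃.trans inter_subset_left)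
  have d₂₃ : Disjoint W₂ W₃ :=
    hQQ'.mono (hW₂.trans inter_subset_right) (hW₃.trans inter_subset_right)
  rcases hrt₁.lt_or_gt with g₁ | g₁ <;> rcases hrt₂.lt_or_gt with g₂ | g₂
  · exact hpair2 hWo₁ d₁₂ hr₁ hr₂ (Or.inr ⟨g₁, g₂⟩) h₁ h₁' h₂ h₂'
  · rcases hrt₃.lt_or_gt with g₃ | g₃
    · exact hpair2 hWo₁ d₁₃ hr₁ hr₃ (Or.inr ⟨g₁, g₃⟩) h₁ h₁' h₃ h₃'
    · exact hpair2 hWo₂ d₂₃ hr₂ hr₃ (Or.inl ⟨g₂, g₃⟩) h₂ h₂' h₃ h₃'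
  · rcases hrt₃.lt_or_gt with g₃ | g₃
    · exact hpair2 hWo₂ d₂₃ hr₂ hr₃ (Or.inr ⟨g₂, g₃⟩) h₂ h₂' h₃ h₃'
    · exact hpair2 hWo₁ d₁₃ hr₁ hr₃ (Or.inl ⟨g₁, g₃⟩) h₁ h₁' h₃ h₃'
  · exact hpair2 hWo₁ d₁₂ hr₁ hr₂ (Or.inl ⟨g₁, g₂⟩) h₁ h₁' h₂ h₂'

end Minimality

section FreeArcDynamics

variable {X : Type*} [MetricSpace X] [CompactSpace X] [LocallyConnectedSpace X]
  [LocallyPathConnectedSpace X] {f : X → X} {α : ℝ → X}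

theorem IsFreeArc.subset_of_mapsTo (hα : IsFreeArc α)
    (hX : ∀ x : X, ∃ D ∈ 𝓝 x, UniquelyArcwise D) (hrec : PointwiseRecurrent f)
    (hf : Continuous f) (hJ : Disjoint (α '' Icc 0 1) (Function.periodicPts f)) {K : Set X}
    (hK : IsClosed K) (hinv : MapsTo f K K) {t : ℝ} (ht : t ∈ Ioo (0 : ℝ) 1) (htK : α t ∈ K) :
    α '' Icc 0 1 ⊆ K := by
  have hcl : ∀ g ∈ Icc (0 : ℝ) 1, α g ∉ K →
      α '' Icc 0 1 ⊆ closure (connectedComponentIn Kᶜ (α g)) := by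
    intro g hg hgK
    obtain ⟨k, hk, hkQ⟩ := hrec.exists_mapsTo_component hf hK hinv (α g)
    refine (hrec.iterate hf hk).subset_closure_of_mapsTo hX (hf.iterate k)
      hK.isOpen_compl.connectedComponentIn isPreconnected_connectedComponentIn hkQ
      (isPreconnected_Icc.image _ hα.continuous.continuousOn) (by rwa [periodicPts_iterate hk])
      ⟨_, mem_image_of_mem _ hg, subset_closure (mem_connectedComponentIn hgK)⟩
  have hbetween : ∀ a b, 0 < a → a < b → b < 1 → α a ∈ K → α b ∈ K → ∀ g ∈ Ioo a b, α g ∈ K := by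
    intro a b ha hab hb haK hbK g hg
    by_contra hgK
    have hsub : connectedComponentIn Kᶜ (α g) ⊆ α '' Ioo a b := by
      refine isPreconnected_connectedComponentIn.subset_of_disjoint_frontier
        (hα.isOpen_image_Ioo ha.le hb.le)
        ⟨_, mem_connectedComponentIn hgK, mem_image_of_mem _ hg⟩ fun y hy hyf => ?_
      have hyK : y ∉ K := connectedComponentIn_subset _ _ hy
      rcases hα.frontier_image_Ioo_subset ha.le hb.le hyf with rfl | rfl
      exacts [hyK haK, hyK hbK]
    obtain ⟨s, hs, hs0⟩ := ((hcl g ⟨by linarith [hg.1], by linarith [hg.2]⟩ hgK).trans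
      ((closure_mono hsub).trans hα.closure_image_Ioo_subset))
        (mem_image_of_mem _ (left_mem_Icc.2 zero_le_one))
    have := hα.injOn ⟨by linarith [hs.1], by linarith [hs.2]⟩ (left_mem_Icc.2 zero_le_one) hs0
    linarith [hs.1]
  obtain ⟨a, b, ha, hab, hb, haK, hbK⟩ : ∃ a b, 0 < a ∧ a < b ∧ b < 1 ∧ α a ∈ K ∧ α b ∈ K := by
    obtain ⟨n, hn, s, hs, hst⟩ := hrec (α t) _ (hα.isOpen.mem_nhds ⟨t, ht, rfl⟩)
    have hsK : α s ∈ K := hst ▸ hinv.iterate n htK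
    rcases lt_trichotomy s t with h | rfl | h
    · exact ⟨s, t, hs.1, h, ht.2, hsK, htK⟩
    · exact (disjoint_left.1 hJ (mem_image_of_mem _ (Ioo_subset_Icc_self ht))
        ⟨n, hn, hst.symm⟩).elim
    · exact ⟨t, s, ht.1, h, hs.2, htK, hsK⟩
  rintro _ ⟨g, hg, rfl⟩
  by_contra hgK
  have hm : α ((a + b) / 2) ∈ α '' Ioo a b := ⟨_, ⟨by linarith, by linarith⟩, rfl⟩
  obtain ⟨y, hy, hyQ⟩ := mem_closure_iff.1 (hcl g hg hgK ⟨(a + b) / 2,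
    ⟨by linarith, by linarith⟩, rfl⟩) _ (hα.isOpen_image_Ioo ha.le hb.le) hm
  obtain ⟨s, hs, rfl⟩ := hy
  exact connectedComponentIn_subset _ _ hyQ (hbetween a b ha hab hb haK hbK s hs)

theorem IsFreeArc.exists_iterate_mem [PreconnectedSpace X] (hα : IsFreeArc α)
    (hX : ∀ x : X, ∃ D ∈ 𝓝 x, UniquelyArcwise D) (hrec : PointwiseRecurrent f)
    (hf : Continuous f) (hJ : Disjoint (α '' Icc 0 1) (Function.periodicPts f)) {a b : ℝ}
    (ha : 0 ≤ a) (hab : a < b) (hb : b ≤ 1) (x : X) : ∃ i, f^[i] x ∈ α '' Ioo a b := by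
  obtain ⟨a', haa', ha'b⟩ := exists_between hab
  obtain ⟨b', hab', hb'b⟩ := exists_between ha'b
  have hmid : (a' + b') / 2 ∈ Ioo a' b' := ⟨by linarith, by linarith⟩
  have hUo : IsOpen (α '' Ioo a' b') := hα.isOpen_image_Ioo (by linarith) (by linarith)
  have hfr : ∀ c ∈ Ioo (0 : ℝ) 1, ∃ i, f^[i] (α c) ∈ α '' Ioo a' b' := by
    intro c hc
    have hinv : MapsTo f (range fun i => f^[i] (α c)) (range fun i => f^[i] (α c)) := by
      rintro _ ⟨i, rfl⟩
      exact ⟨i + 1, Function.iterate_succ_apply' f i _⟩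
    have := hα.subset_of_mapsTo hX hrec hf hJ isClosed_closure (hinv.closure hf) hc
      (subset_closure ⟨0, rfl⟩)
    obtain ⟨_, hy, i, rfl⟩ := mem_closure_iff.1 (this ⟨(a' + b') / 2,
      ⟨by linarith, by linarith⟩, rfl⟩) _ hUo (mem_image_of_mem _ hmid)
    exact ⟨i, hy⟩
  obtain ⟨i, hi⟩ := hrec.forall_exists_iterate_mem hf hUo ⟨_, mem_image_of_mem _ hmid⟩
    (fun y hy => by
      rcases hα.frontier_image_Ioo_subset (by linarith) (by linarith) hy with rfl | rfl
      exacts [hfr _ ⟨by linarith, by linarith⟩, hfr _ ⟨by linarith, by linarith⟩]) x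
  exact ⟨i, image_mono (Ioo_subset_Ioo haa'.le hb'b.le) hi⟩

theorem IsFreeArc.eq_univ_of_mapsTo [PreconnectedSpace X] (hα : IsFreeArc α)
    (hX : ∀ x : X, ∃ D ∈ 𝓝 x, UniquelyArcwise D) (hrec : PointwiseRecurrent f)
    (hf : Continuous f) (hJ : Disjoint (α '' Icc 0 1) (Function.periodicPts f)) {K : Set X}
    (hK : IsClosed K) (hne : K.Nonempty) (hinv : MapsTo f K K) : K = univ := by
  obtain ⟨x, hx⟩ := hne
  obtain ⟨i, t, ht, hti⟩ := hα.exists_iterate_mem hX hrec hf hJ le_rfl one_pos le_rfl x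
  have hsub := hα.subset_of_mapsTo hX hrec hf hJ hK hinv ht (hti ▸ hinv.iterate i hx)
  refine eq_univ_of_forall fun y => ?_
  obtain ⟨j, hj⟩ := hα.exists_iterate_mem hX hrec hf hJ le_rfl one_pos le_rfl y
  exact hrec.mem_of_iterate_mem hK hinv (hsub (image_mono Ioo_subset_Icc_self hj))

end FreeArcDynamics

section Expansion

theorem exists_forall_subinterval_of_finite {ι : Type*} {s : Set ι} (hs : s.Finite)
    {R : ι → ℝ → ℝ → Prop} (hR : ∀ i a b a' b', a ≤ a' → b' ≤ b → R i a' b' → R i a b)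
    {a b : ℝ} (hab : a < b)
    (h : ∀ a' b', a ≤ a' → a' < b' → b' ≤ b → ∃ i ∈ s, R i a' b') :
    ∃ i ∈ s, ∃ c d, a ≤ c ∧ c < d ∧ d ≤ b ∧
      ∀ a' b', c ≤ a' → a' < b' → b' ≤ d → R i a' b' := by
  induction s, hs using Set.Finite.induction_on generalizing a b with
  | empty =>
    obtain ⟨i, hi, -⟩ := h a b le_rfl hab le_rfl
    exact hi.elim
  | @insert j s _ _ ih =>
    by_cases hj : ∀ a' b', a ≤ a' → a' < b' → b' ≤ b → R j a' b'
    · exact ⟨j, mem_insert _ _, a, b, le_rfl, hab, le_rfl, hj⟩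
    · push Not at hj
      obtain ⟨a₁, b₁, ha₁, hab₁, hb₁, hjR⟩ := hj
      obtain ⟨i, hi, c, d, hc, hcd, hd, hi'⟩ := ih hab₁ fun a' b' h1 h2 h3 => by
        obtain ⟨i, hi, hiR⟩ := h a' b' (ha₁.trans h1) h2 (h3.trans hb₁)
        rcases hi with rfl | hi
        · exact (hjR (hR i _ _ _ _ h1 h3 hiR)).elim
        · exact ⟨i, hi, hiR⟩
      exact ⟨i, mem_insert_of_mem _ hi, c, d, ha₁.trans hc, hcd, hd.trans hb₁, hi'⟩

variable {X : Type*} [MetricSpace X]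

/-- Finitely many arcs such that each path of large diameter covers one of them. -/
theorem exists_finite_connHull_subset_image [CompactSpace X] [LocallyConnectedSpace X]
    (hX : ∀ x : X, ∃ D ∈ 𝓝 x, UniquelyArcwise D) {ε : ℝ} (hε : 0 < ε) :
    ∃ 𝓙 : Set (Set X), 𝓙.Finite ∧
      (∀ J ∈ 𝓙, ∃ D u v, UniquelyArcwise D ∧ u ∈ D ∧ v ∈ D ∧ u ≠ v ∧ J = connHull D u v) ∧
      ∀ γ : ℝ → X, Continuous γ → ∀ s t, ε ≤ dist (γ s) (γ t) → ∃ J ∈ 𝓙, J ⊆ γ '' uIcc s t := by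
  have hloc : ∀ x : X, ∃ V V' D, UniquelyArcwise D ∧ IsOpen V ∧ IsOpen V' ∧ x ∈ V' ∧
      closure V' ⊆ V ∧ closure V ⊆ D ∧ V ⊆ Metric.ball x (ε / 2) ∧ (frontier V).Finite ∧
      (frontier V').Finite := by
    intro x
    obtain ⟨D, hDx, hD⟩ := hX x
    have hu : ∀ u ∈ D, ∀ v ∈ D, u ≠ v → (connHull D u v ∩ univ).Nonempty :=
      fun u hu v _ _ => ⟨u, left_mem_connHull hu, trivial⟩
    obtain ⟨V, hVo, -, hxV, hVcl, hVf, -⟩ := hD.exists_nhds_finite_frontier hDx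
      (Metric.ball_mem_nhds x (half_pos hε)) hu
    obtain ⟨V', hVo', -, hxV', hVcl', hVf', -⟩ := hD.exists_nhds_finite_frontier hDx
      (hVo.mem_nhds hxV) hu
    exact ⟨V, V', D, hD, hVo, hVo', hxV', hVcl'.trans inter_subset_right,
      (hVcl.trans inter_subset_left).trans interior_subset,
      (subset_closure.trans hVcl).trans inter_subset_right, hVf, hVf'⟩
  choose V V' D hD hV hV' hxV' hVV' hVD hVb hVf hVf' using hloc
  obtain ⟨T, hT⟩ := isCompact_univ.elim_nhds_subcover V' fun x _ => (hV' x).mem_nhds (hxV' x)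
  let A : X → Set (Set X) := fun x =>
    (fun p : X × X => connHull (D x) p.1 p.2) '' (frontier (V' x) ×ˢ frontier (V x))
  refine ⟨⋃ x ∈ T, A x, T.finite_toSet.biUnion fun x _ => ((hVf' x).prod (hVf x)).image _, ?_, ?_⟩
  · intro J hJ
    simp only [mem_iUnion] at hJ
    obtain ⟨x, -, ⟨v', v⟩, ⟨hv', hv⟩, rfl⟩ := hJ
    have h' : v' ∈ V x := hVV' x (frontier_subset_closure hv')
    refine ⟨D x, v', v, hD x, hVD x (subset_closure h'), hVD x (frontier_subset_closure hv), ?_,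
      rfl⟩
    rintro rfl
    exact ((hV x).frontier_eq ▸ hv).2 h'
  · intro γ hγ s t hst
    have hs := hT.2 (mem_univ (γ s))
    simp only [mem_iUnion] at hs
    obtain ⟨x, hxT, hs⟩ := hs
    let η : ℝ → X := fun r => γ (s + r * (t - s))
    have hη : Continuous η := by fun_prop
    have h0 : η 0 = γ s := by simp [η]
    have h1 : η 1 = γ t := by simp [η]
    have hηu : η '' Icc 0 1 ⊆ γ '' uIcc s t := by
      rintro _ ⟨r, hr, rfl⟩
      refine ⟨_, ?_, rfl⟩
      rw [← segment_eq_uIcc]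
      exact ⟨1 - r, r, by linarith [hr.2], hr.1, by ring, by simp only [smul_eq_mul]; ring⟩
    have htV : η 1 ∉ V x := by
      rw [h1]
      intro ht
      have := hVb x ht
      have h2 := hVb x (hVV' x (subset_closure hs))
      rw [Metric.mem_ball] at this h2
      linarith [dist_triangle_right (γ s) (γ t) x]
    have h0V' : η 0 ∈ V' x := h0 ▸ hs
    have hVsub : V' x ⊆ V x := subset_closure.trans (hVV' x)
    obtain ⟨r, hr, hrf, hrc⟩ := exists_exit hη (hV x) (hVsub h0V') zero_le_one htV
    have hrV : η r ∉ V x := ((hV x).frontier_eq ▸ hrf).2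
    obtain ⟨r', hr', hrf', -⟩ := exists_exit hη (hV' x) h0V' hr.1 fun h => hrV (hVsub h)
    refine ⟨_, mem_biUnion hxT ⟨(η r', η r), ⟨hrf', hrf⟩, rfl⟩, ?_⟩
    refine (connHull_subset_of (C := η '' Icc r' r) ?_
      (isPreconnected_Icc.image _ hη.continuousOn) ⟨r', left_mem_Icc.2 hr'.2, rfl⟩
      ⟨r, right_mem_Icc.2 hr'.2, rfl⟩).trans ((image_mono ?_).trans hηu)
    · rintro _ ⟨q, hq, rfl⟩
      exact hVD x (hrc q ⟨hr'.1.trans hq.1, hq.2⟩)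
    · exact Icc_subset_Icc hr'.1 hr.2

theorem exists_free_arc [CompactSpace X] [PreconnectedSpace X] [LocallyConnectedSpace X]
    [LocallyPathConnectedSpace X] (hX : ∀ x : X, ∃ D ∈ 𝓝 x, UniquelyArcwise D) {f : X → X}
    (hrec : PointwiseRecurrent f) (hf : Continuous f) {D : Set X} (hD : UniquelyArcwise D)
    {u v : X} (hu : u ∈ D) (hv : v ∈ D) (huv : u ≠ v)
    (hp : Disjoint (connHull D u v) (Function.periodicPts f)) :
    ∃ α : ℝ → X, IsFreeArc α ∧ Disjoint (α '' Icc 0 1) (Function.periodicPts f) := by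
  obtain ⟨β, hβ, hβi, rfl, rfl, hβh⟩ := hD.exists_arc hu hv huv
  obtain ⟨D', hD'x, hD'⟩ := hX (β (1 / 2))
  obtain ⟨V, hVo, hVc, hxV, hVcl, hVf, -⟩ := hD'.exists_nhds_finite_frontier hD'x univ_mem
    (S := univ) fun u hu v _ _ => ⟨u, left_mem_connHull hu, trivial⟩
  have hVcl' := hVcl.trans inter_subset_left
  have hVD' : V ⊆ D' := (subset_closure.trans hVcl').trans interior_subset
  obtain ⟨η, hη, hηV⟩ := Metric.isOpen_iff.1 (hVo.preimage hβ) _ hxV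
  obtain ⟨s, hs, hs'⟩ := exists_between (lt_min (show (1 / 2 : ℝ) < 1 by norm_num)
    (show (1 / 2 : ℝ) < 1 / 2 + η by linarith))
  rw [lt_min_iff] at hs'
  have hβV : β '' Icc (1 / 2) s ⊆ V := by
    rintro _ ⟨r, hr, rfl⟩
    refine hηV ?_
    rw [Metric.mem_ball, Real.dist_eq, abs_lt]
    constructor <;> linarith [hr.1, hr.2]
  have hsV : β s ∈ V := hβV ⟨s, right_mem_Icc.2 hs.le, rfl⟩
  have hne : β (1 / 2) ≠ β s := fun h => hs.ne (hβi (by norm_num) ⟨by linarith, hs'.1.le⟩ h)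
  have hJp : Disjoint (connHull D' (β (1 / 2)) (β s)) (Function.periodicPts f) := by
    refine hp.mono_left ((connHull_subset_of (hβV.trans hVD')
      (isPreconnected_Icc.image _ hβ.continuousOn) ⟨_, left_mem_Icc.2 hs.le, rfl⟩
      ⟨s, right_mem_Icc.2 hs.le, rfl⟩).trans ?_)
    rw [hβh 0 1 le_rfl zero_le_one le_rfl]
    exact image_mono (Icc_subset_Icc (by norm_num) hs'.1.le)
  have hfin := hD'.finite_connHull_diff_interior hX hrec hf hVo hVc hVcl' hVf hxV hsV hne hJp
  obtain ⟨α, hα, hαi, h0, h1, hαh⟩ := hD'.exists_arc (hVD' hxV) (hVD' hsV) hne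
  have hJ : connHull D' (β (1 / 2)) (β s) = α '' Icc 0 1 := by
    rw [← hαh 0 1 le_rfl zero_le_one le_rfl, h0, h1]
  rw [hJ] at hfin hJp
  have hB : (Icc (0 : ℝ) 1 ∩ α ⁻¹' (α '' Icc 0 1 \ interior (α '' Icc 0 1))).Finite :=
    Finite.of_finite_image (hfin.subset (by rintro _ ⟨t, ht, rfl⟩; exact ht.2))
      (hαi.mono inter_subset_left)
  obtain ⟨t, ht, htB⟩ := ((Ioo_infinite (zero_lt_one (α := ℝ))).sdiff hB).nonempty
  obtain ⟨ρ, hρ, hρB⟩ := Metric.isOpen_iff.1 (isOpen_Ioo.sdiff hB.isClosed) t ⟨ht, htB⟩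
  set a := t - ρ / 2 with ha
  set b := t + ρ / 2 with hb
  have hab : ∀ r ∈ Icc a b, r ∈ Ioo (0 : ℝ) 1 ∧ α r ∈ interior (α '' Icc 0 1) := by
    intro r hr
    have hr' := hρB (show r ∈ Metric.ball t ρ by
      rw [Metric.mem_ball, Real.dist_eq, abs_lt]
      constructor <;> linarith [hr.1, hr.2])
    refine ⟨hr'.1, ?_⟩
    by_contra h
    exact hr'.2 ⟨Ioo_subset_Icc_self hr'.1, ⟨r, Ioo_subset_Icc_self hr'.1, rfl⟩, h⟩
  have hlt : a < b := by linarith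
  have ha0 := (hab a (left_mem_Icc.2 hlt.le)).1
  have hb0 := (hab b (right_mem_Icc.2 hlt.le)).1
  have hopen : IsOpen (α '' Ioo a b) := by
    have : α '' Ioo a b = interior (α '' Icc 0 1) \ (α '' Icc 0 a ∪ α '' Icc b 1) := by
      ext y
      constructor
      · rintro ⟨r, hr, rfl⟩
        have hr' := hab r (Ioo_subset_Icc_self hr)
        refine ⟨hr'.2, ?_⟩
        rintro (⟨q, hq, hqr⟩ | ⟨q, hq, hqr⟩)
        · have := hαi ⟨hq.1, by linarith [hq.2, ha0.2]⟩ (Ioo_subset_Icc_self hr'.1) hqr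
          linarith [hq.2, hr.1]
        · have := hαi ⟨by linarith [hq.1, hb0.1], hq.2⟩ (Ioo_subset_Icc_self hr'.1) hqr
          linarith [hq.1, hr.2]
      · rintro ⟨hy, hn⟩
        obtain ⟨r, hr, rfl⟩ := interior_subset hy
        refine ⟨r, ⟨?_, ?_⟩, rfl⟩
        · by_contra h
          exact hn (Or.inl ⟨r, ⟨hr.1, not_lt.1 h⟩, rfl⟩)
        · by_contra h
          exact hn (Or.inr ⟨r, ⟨not_lt.1 h, hr.2⟩, rfl⟩)
    rw [this]
    exact isOpen_interior.sdiff ((isCompact_Icc.image hα).union (isCompact_Icc.image hα)).isClosed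
  have hmaps : ∀ r ∈ Icc (0 : ℝ) 1, a + r * (b - a) ∈ Icc a b := fun r hr =>
    ⟨by nlinarith [hr.1], by nlinarith [hr.2]⟩
  refine ⟨fun r => α (a + r * (b - a)), ⟨by fun_prop, ?_, ?_⟩, ?_⟩
  · intro r hr q hq h
    have := hαi (Ioo_subset_Icc_self (hab _ (hmaps r hr)).1)
      (Ioo_subset_Icc_self (hab _ (hmaps q hq)).1) h
    exact mul_right_cancel₀ (sub_pos.2 hlt).ne' (add_left_cancel this)
  · convert hopen using 1
    ext y
    constructor
    · rintro ⟨r, hr, rfl⟩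
      exact ⟨_, ⟨by nlinarith [hr.1], by nlinarith [hr.2]⟩, rfl⟩
    · rintro ⟨r, hr, rfl⟩
      have hba := sub_pos.2 hlt
      refine ⟨(r - a) / (b - a), ⟨div_pos (by linarith [hr.1]) hba,
        (div_lt_one hba).2 (by linarith [hr.2])⟩, ?_⟩
      simp only [div_mul_cancel₀ _ hba.ne']
      congr 1
      ring
  · refine hJp.mono_left ?_
    rintro _ ⟨r, hr, rfl⟩
    exact ⟨_, Ioo_subset_Icc_self (hab _ (hmaps r hr)).1, rfl⟩

end Expansion

section Equicontinuity

theorem image_iterate_mul_subset {X : Type*} {f : X → X} {B B' : Set X} (hB : B ⊆ B') {m : ℕ}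
    (h : B' ⊆ f^[m] '' B)
    (k : ℕ) : B' ⊆ f^[m * (k + 1)] '' B := by
  induction k with
  | zero => simpa using h
  | succ k ih =>
    rw [show m * (k + 1 + 1) = m + m * (k + 1) by ring, Function.iterate_add, image_comp]
    exact (h.trans (image_mono hB)).trans (image_mono ih)

variable {X : Type*} [MetricSpace X] [CompactSpace X] {f : X → X}

theorem exists_iterate_dist_ge (hf : Continuous f) {ε : ℝ}
    (hne : ∀ δ > 0, ∃ x y, dist x y < δ ∧ ∃ n, ε ≤ dist (f^[n] x) (f^[n] y)) (hε : 0 < ε)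
    {U : Set X} (hU : IsOpen U) (hfU : ∀ x, ∃ i, f^[i] x ∈ U) :
    ∃ n, ∃ x ∈ U, ∃ y ∈ U, ε ≤ dist (f^[n] x) (f^[n] y) := by
  choose i hi using hfU
  let W : X → Set X := fun x =>
    {y | f^[i x] y ∈ U ∧ ∀ j ∈ Finset.range (i x), dist (f^[j] y) (f^[j] x) < ε / 2}
  have hW : ∀ x, W x ∈ 𝓝 x := by
    intro x
    refine Filter.inter_mem ((hU.preimage (hf.iterate _)).mem_nhds (hi x)) ?_
    refine (Finset.eventually_all _).2 fun j _ => ?_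
    exact (hf.iterate j).continuousAt.eventually (Metric.ball_mem_nhds _ (half_pos hε))
  obtain ⟨δ, hδ, hball⟩ := lebesgue_number_lemma_of_metric (isCompact_univ (X := X))
    (c := fun x => interior (W x)) (fun x => isOpen_interior)
    fun x _ => mem_iUnion.2 ⟨x, mem_interior_iff_mem_nhds.2 (hW x)⟩
  obtain ⟨x, y, hxy, n, hn⟩ := hne δ hδ
  obtain ⟨z, hz⟩ := hball x trivial
  have hxW : x ∈ W z := interior_subset (hz (Metric.mem_ball_self hδ))
  have hyW : y ∈ W z := interior_subset (hz (by rwa [Metric.mem_ball, dist_comm]))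
  rcases Nat.lt_or_ge n (i z) with h | h
  · have h1 := hxW.2 n (Finset.mem_range.2 h)
    have h2 := hyW.2 n (Finset.mem_range.2 h)
    linarith [dist_triangle_right (f^[n] x) (f^[n] y) (f^[n] z)]
  · refine ⟨n - i z, _, hxW.1, _, hyW.1, ?_⟩
    rwa [← Function.iterate_add_apply, ← Function.iterate_add_apply, Nat.sub_add_cancel h]

theorem IsFreeArc.equicontinuous [PreconnectedSpace X] [LocallyConnectedSpace X]
    [LocallyPathConnectedSpace X] {α : ℝ → X} (hα : IsFreeArc α)
    (hX : ∀ x : X, ∃ D ∈ 𝓝 x, UniquelyArcwise D) (hrec : PointwiseRecurrent f)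
    (hf : Continuous f) (hJ : Disjoint (α '' Icc 0 1) (Function.periodicPts f)) {ε : ℝ}
    (hε : 0 < ε) :
    ∃ δ : ℝ, 0 < δ ∧ ∀ x y : X, dist x y < δ → ∀ n : ℕ, dist (f^[n] x) (f^[n] y) < ε := by
  by_contra! hne
  have hthree := fun n t ht x y z => hα.not_three_preimages (n := n) (t := t) (x := x) (y := y)
    (z := z) hf (hrec.surjective hf)
    (fun K hK hKne hinv => hα.eq_univ_of_mapsTo hX hrec hf hJ hK hKne hinv) ht
  obtain ⟨𝓙, h𝓙, h𝓙D, h𝓙γ⟩ := exists_finite_connHull_subset_image hX hε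
  obtain ⟨J, hJ𝓙, a, b, ha, hab, hb, hcov⟩ := exists_forall_subinterval_of_finite h𝓙
    (R := fun J a b => ∃ n, J ⊆ f^[n] '' (α '' Icc a b))
    (fun J a b a' b' h1 h2 ⟨n, hn⟩ => ⟨n, hn.trans (image_mono (image_mono (Icc_subset_Icc h1 h2)))⟩)
    (zero_lt_one (α := ℝ)) (by
      intro a b ha hab hb
      obtain ⟨n, _, ⟨s, hs, rfl⟩, _, ⟨t, ht, rfl⟩, hst⟩ := exists_iterate_dist_ge hf
        (fun δ hδ => hne δ hδ) hε (hα.isOpen_image_Ioo ha hb)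
        (hα.exists_iterate_mem hX hrec hf hJ ha hab hb)
      obtain ⟨J, hJ, hJs⟩ := h𝓙γ (f^[n] ∘ α) ((hf.iterate n).comp hα.continuous) s t hst
      refine ⟨J, hJ, n, hJs.trans ?_⟩
      rw [image_comp]
      exact image_mono (image_mono (ordConnected_Icc.uIcc_subset (Ioo_subset_Icc_self hs)
        (Ioo_subset_Icc_self ht))))
  obtain ⟨D, u, v, hD, hu, hv, huv, rfl⟩ := h𝓙D J hJ𝓙
  obtain ⟨β, hβ, hβi, rfl, rfl, hβh⟩ := hD.exists_arc hu hv huv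
  obtain ⟨n, hn⟩ := hα.exists_iterate_mem hX hrec hf hJ ha hab hb (β (1 / 2))
  obtain ⟨η, hη, hηV⟩ := Metric.isOpen_iff.1
    ((hα.isOpen_image_Ioo ha hb).preimage ((hf.iterate n).comp hβ)) _ hn
  obtain ⟨s, hs, hs'⟩ := exists_between (lt_min (show (1 / 2 : ℝ) < 1 by norm_num)
    (show (1 / 2 : ℝ) < 1 / 2 + η by linarith))
  rw [lt_min_iff] at hs'
  set C : Set X := (f^[n] ∘ β) '' Icc (1 / 2) s with hC
  have hCα : C ⊆ α '' Ioo a b := by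
    rintro _ ⟨r, hr, rfl⟩
    refine hηV ?_
    rw [Metric.mem_ball, Real.dist_eq, abs_lt]
    constructor <;> linarith [hr.1, hr.2]
  have hCpre : IsPreconnected C :=
    isPreconnected_Icc.image _ ((hf.iterate n).comp hβ).continuousOn
  have hCJ : C ⊆ f^[n] '' connHull D (β 0) (β 1) := by
    rw [hβh 0 1 le_rfl zero_le_one le_rfl, ← image_comp]
    exact image_mono (Icc_subset_Icc (by norm_num) hs'.1.le)
  have hCnt : C.Nontrivial := by
    by_contra h
    rw [not_nontrivial_iff] at h
    obtain ⟨t, ht, hts⟩ := hn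
    have hmem : ∀ r ∈ Icc (1 / 2) s, f^[n] (β r) = α t := fun r hr => by
      rw [hts]
      exact h ⟨r, hr, rfl⟩ ⟨1 / 2, left_mem_Icc.2 hs.le, rfl⟩
    have hinj : ∀ r ∈ Icc (1 / 2) s, ∀ q ∈ Icc (1 / 2) s, r < q → β r ≠ β q :=
      fun r hr q hq hrq h => hrq.ne (hβi ⟨by linarith [hr.1], by linarith [hr.2]⟩
        ⟨by linarith [hq.1], by linarith [hq.2]⟩ h)
    have e1 : (1 / 2 : ℝ) ∈ Icc (1 / 2) s := left_mem_Icc.2 hs.le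
    have e2 : (1 / 2 + s) / 2 ∈ Icc (1 / 2) s := ⟨by linarith, by linarith⟩
    have e3 : s ∈ Icc (1 / 2) s := right_mem_Icc.2 hs.le
    exact hthree n t ⟨by linarith [ht.1], by linarith [ht.2]⟩ _ _ _ (hmem _ e1) (hmem _ e2)
      (hmem _ e3) (hinj _ e1 _ e2 (by linarith)) (hinj _ e1 _ e3 hs) (hinj _ e2 _ e3 (by linarith))
  obtain ⟨t, t', ht, ht', htt', htC, htC'⟩ : ∃ t t', t ∈ Ioo a b ∧ t' ∈ Ioo a b ∧ t < t' ∧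
      α t ∈ C ∧ α t' ∈ C := by
    obtain ⟨x, hx, y, hy, hxy⟩ := hCnt
    obtain ⟨t, ht, rfl⟩ := hCα hx
    obtain ⟨t', ht', rfl⟩ := hCα hy
    rcases lt_trichotomy t t' with h | rfl | h
    · exact ⟨t, t', ht, ht', h, hx, hy⟩
    · exact (hxy rfl).elim
    · exact ⟨t', t, ht', ht, h, hy, hx⟩
  have hBC : α '' Icc t t' ⊆ C := hα.image_Icc_subset_of_isPreconnected hCpre
    (hCα.trans (image_mono (Ioo_subset_Ioo ha hb))) (by linarith [ht.1]) (by linarith [ht'.2])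
    htC htC'
  have hexp : ∀ c d, t < c → c < d → d ≤ t' → ∃ m > 0, ∀ k,
      α '' Icc t t' ⊆ f^[m * (k + 1)] '' (α '' Icc c d) := by
    intro c d hc hcd hd
    obtain ⟨m, hm⟩ := hcov c d (by linarith [ht.1]) hcd (by linarith [ht'.2])
    have hsub : α '' Icc t t' ⊆ f^[n + m] '' (α '' Icc c d) := by
      rw [Function.iterate_add, image_comp]
      exact (hBC.trans hCJ).trans (image_mono hm)
    refine ⟨n + m, Nat.pos_of_ne_zero fun h0 => ?_,
      image_iterate_mul_subset (image_mono (Icc_subset_Icc hc.le hd)) hsub⟩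
    rw [h0, Function.iterate_zero, image_id] at hsub
    obtain ⟨r, hr, hrt⟩ := hsub ⟨t, left_mem_Icc.2 htt'.le, rfl⟩
    have := hα.injOn ⟨by linarith [hr.1, ht.1], by linarith [hr.2, ht'.2]⟩
      ⟨by linarith [ht.1], by linarith [ht.2]⟩ hrt
    linarith [hr.1]
  set ℓ := (t' - t) / 6 with hℓ
  obtain ⟨m₁, hm₁, h₁⟩ := hexp (t + ℓ) (t + 2 * ℓ) (by linarith) (by linarith) (by linarith)
  obtain ⟨m₂, hm₂, h₂⟩ := hexp (t + 3 * ℓ) (t + 4 * ℓ) (by linarith) (by linarith) (by linarith)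
  obtain ⟨m₃, hm₃, h₃⟩ := hexp (t + 5 * ℓ) (t + 6 * ℓ) (by linarith) (by linarith) (by linarith)
  have hpre : ∀ m > 0, ∀ c d, m ∣ m₁ * m₂ * m₃ →
      (∀ k, α '' Icc t t' ⊆ f^[m * (k + 1)] '' (α '' Icc c d)) →
      ∃ r ∈ Icc c d, f^[m₁ * m₂ * m₃] (α r) = α t := by
    rintro m hm c d ⟨k, hk⟩ h
    obtain ⟨j, rfl⟩ : ∃ j, k = j + 1 := Nat.exists_eq_succ_of_ne_zero (by
      rintro rfl
      have : 0 < m₁ * m₂ * m₃ := by positivity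
      omega)
    obtain ⟨_, ⟨r, hr, rfl⟩, hrt⟩ := h j ⟨t, left_mem_Icc.2 htt'.le, rfl⟩
    exact ⟨r, hr, hk ▸ hrt⟩
  obtain ⟨r₁, hr₁, e₁⟩ := hpre m₁ hm₁ _ _ ⟨m₂ * m₃, by ring⟩ h₁
  obtain ⟨r₂, hr₂, e₂⟩ := hpre m₂ hm₂ _ _ ⟨m₁ * m₃, by ring⟩ h₂
  obtain ⟨r₃, hr₃, e₃⟩ := hpre m₃ hm₃ _ _ ⟨m₁ * m₂, by ring⟩ h₃
  have hinj : ∀ r q, t ≤ r → r < q → q ≤ t' → α r ≠ α q := fun r q h1 h2 h3 h =>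
    h2.ne (hα.injOn ⟨by linarith [ht.1], by linarith [ht'.2]⟩
      ⟨by linarith [ht.1], by linarith [ht'.2]⟩ h)
  exact hthree _ t ⟨by linarith [ht.1], by linarith [ht.2]⟩ _ _ _ e₁ e₂ e₃
    (hinj _ _ (by linarith [hr₁.1]) (by linarith [hr₁.2, hr₂.1]) (by linarith [hr₂.2]))
    (hinj _ _ (by linarith [hr₁.1]) (by linarith [hr₁.2, hr₃.1]) (by linarith [hr₃.2]))
    (hinj _ _ (by linarith [hr₂.1]) (by linarith [hr₂.2, hr₃.1]) (by linarith [hr₃.2]))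

end Equicontinuity

/-- a pointwise-recurrent continuous map of a local dendrite is
equicontinuous. -/
theorem equicontinuous_of_pointwise_recurrent_isLocalDendrite
    {X : Type*} [MetricSpace X] [CompactSpace X] [ConnectedSpace X] [Nonempty X]
    (hX : IsLocalDendrite X) (f : X → X) (hf : Continuous f)
    (hrec : ∀ x : X, IsRecurrentPoint f x) :
    ∀ ε : ℝ, 0 < ε → ∃ δ : ℝ, 0 < δ ∧ ∀ x y : X, dist x y < δ →
      ∀ n : ℕ, dist (f^[n] x) (f^[n] y) < ε := by
  have hX' : ∀ x : X, ∃ D ∈ 𝓝 x, UniquelyArcwise D := fun x => by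
    obtain ⟨D, hDx, hDc, hDconn, hDl, hDno⟩ := hX x
    exact ⟨D, hDx, uniquelyArcwise_of_no_circle hDc hDconn.isPreconnected hDl hDno⟩
  have := locallyConnectedSpace_of_nhds fun x => by
    obtain ⟨D, hDx, -, -, hDl, -⟩ := hX x
    exact ⟨D, hDx, hDl⟩
  have := locallyPathConnectedSpace_of_compact_metric (Y := X)
  have hrec' : PointwiseRecurrent f := fun x U hU => by
    obtain ⟨u, -, hpos, hlim⟩ := hrec x
    obtain ⟨k, hk⟩ := (hlim.eventually hU).exists
    exact ⟨u k, hpos k, hk⟩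
  intro ε hε
  by_cases hS : ∀ D : Set X, UniquelyArcwise D → ∀ u ∈ D, ∀ v ∈ D, u ≠ v →
      (connHull D u v ∩ Function.periodicPts f).Nonempty
  · exact hrec'.equicontinuous_of_dense_periodicPts hX' hf hS hε
  · push Not at hS
    obtain ⟨D, hD, u, hu, v, hv, huv, hp⟩ := hS
    obtain ⟨α, hα, hαp⟩ := exists_free_arc hX' hrec' hf hD hu hv huv
      (disjoint_iff_inter_eq_empty.2 hp)
    exact hα.equicontinuous hX' hrec' hf hαp hε
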